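/- arXiv:math/0201191 — 5 statements merged into one kernel-verified Lean document; each statement's English description precedes it below -/
import Mathlib

section
/- Let φ : A → B be a unital completely positive map between unital C*-algebras. Then for all a, b ∈ A, ‖φ(ab) − φ(a)φ(b)‖ ≤ ‖φ(aa*) − φ(a)φ(a)*‖^{1/2} · ‖φ(b*b) − φ(b)*φ(b)‖^{1/2}. -/
/-- A unital completely positive map between star algebras: it is unital, and entrywise
application to any `n × n` matrix sends positive matrices (those of the form `yᴴ * y`)
to positive matrices. -/
def IsUcp {A B : Type*} [Ring A] [StarRing A] [Module ℂ A]
    [Ring B] [StarRing B] [Module ℂ B] (φ : A →ₗ[ℂ] B) : Prop :=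
  φ 1 = 1 ∧ ∀ (n : ℕ) (M : Matrix (Fin n) (Fin n) A),
    (∃ y : Matrix (Fin n) (Fin n) A, M = y.conjTranspose * y) →
    ∃ z : Matrix (Fin n) (Fin n) B, M.map φ = z.conjTranspose * z

/-- Cauchy–Schwarz for columns over a C*-algebra. -/
theorem cs_column {B : Type*} [CStarAlgebra B] (u v : Fin 3 → B) :
    ‖∑ k, star (u k) * v k‖ ≤
      Real.sqrt ‖∑ k, star (u k) * u k‖ * Real.sqrt ‖∑ k, star (v k) * v k‖ := by
  letI : PartialOrder B := CStarAlgebra.spectralOrder B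
  haveI : StarOrderedRing B := CStarAlgebra.spectralOrderedRing B
  let x : WithCStarModule B (Fin 3 → B) :=
    (WithCStarModule.equiv B (Fin 3 → B)).symm (fun k => star (u k))
  let y : WithCStarModule B (Fin 3 → B) :=
    (WithCStarModule.equiv B (Fin 3 → B)).symm (fun k => star (v k))
  have h := CStarModule.norm_inner_le (A := B) (WithCStarModule B (Fin 3 → B)) (x := y) (y := x)
  rw [WithCStarModule.pi_norm, WithCStarModule.pi_norm, WithCStarModule.pi_inner] at h
  simp only [WithCStarModule.inner_def, x, y, WithCStarModule.equiv_symm_pi_apply,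
    star_star] at h
  rw [mul_comm]
  exact h

theorem stmt_3 {A B : Type*} [CStarAlgebra A] [CStarAlgebra B]
    (φ : A →ₗ[ℂ] B) (hφ : IsUcp φ) (a b : A) :
    ‖φ (a * b) - φ a * φ b‖ ≤
      Real.sqrt ‖φ (a * star a) - φ a * star (φ a)‖ *
        Real.sqrt ‖φ (star b * b) - star (φ b) * φ b‖ := by
  obtain ⟨h1, hcp⟩ := hφ
  let r : Fin 3 → A := ![1, star a, b]
  let y : Matrix (Fin 3) (Fin 3) A := Matrix.of fun i j => if i = 0 then r j else 0
  obtain ⟨z, hz⟩ := hcp 3 _ ⟨y, rfl⟩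
  have key : ∀ i j, φ (star (r i) * r j) = ∑ k, star (z k i) * z k j := by
    intro i j
    have := congrFun (congrFun hz i) j
    simpa [Matrix.mul_apply, y, Fin.sum_univ_three] using this
  have k00 : ∑ k, star (z k 0) * z k 0 = 1 := by rw [← key]; simp [r, h1]
  have hw : ∀ i j, ∑ k, star (z k i - z k 0 * φ (r i)) * (z k j - z k 0 * φ (r j))
      = φ (star (r i) * r j) - star (φ (r i)) * φ (r j) := by
    intro i j
    have e1 : ∑ k, star (z k 0) * z k j = φ (r j) := by rw [← key]; simp [r]
    have e2 : ∑ k, star (z k i) * z k 0 = star (φ (r i)) := by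
      have e3 : ∑ k, star (z k 0) * z k i = φ (r i) := by rw [← key]; simp [r]
      rw [← e3]; simp
    have : ∀ k, star (z k i - z k 0 * φ (r i)) * (z k j - z k 0 * φ (r j))
      = star (z k i) * z k j - (star (z k i) * z k 0) * φ (r j)
        - star (φ (r i)) * (star (z k 0) * z k j)
        + star (φ (r i)) * (star (z k 0) * z k 0) * φ (r j) := by
      intro k
      simp only [star_sub, star_mul]
      noncomm_ring
    simp only [this, Finset.sum_add_distrib, Finset.sum_sub_distrib, ← Finset.sum_mul,
      ← Finset.mul_sum, e1, e2, k00, ← key]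
    noncomm_ring
  have hstar : φ (star a) = star (φ a) := by
    have e1 : φ (star a) = ∑ k, star (z k 0) * z k 1 := by rw [← key]; simp [r]
    have e2 : φ a = ∑ k, star (z k 1) * z k 0 := by rw [← key]; simp [r]
    rw [e1, e2]; simp
  have h := cs_column (fun k => z k 1 - z k 0 * φ (r 1)) (fun k => z k 2 - z k 0 * φ (r 2))
  simp only [hw] at h
  simpa [r, hstar] using h
end

section
/- Let β : M_p(ℂ) → M_q(ℂ) be a unital completely positive map. Then there exist a positive integer n and an isometry v : ℂ^q → ℂ^n ⊗ ℂ^p (i.e., a matrix v of size np × q with v*v = 1_q) such that β(x) = v* (1_n ⊗ x) v for all x ∈ M_p(ℂ), where 1_n ⊗ x denotes the Kronecker product (block-diagonal n-fold amplification) of x. -/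
open scoped Kronecker

/-- Stinespring dilation for ucp maps between matrix algebras.  Any ucp map
`β : M_p(ℂ) → M_q(ℂ)` is of the form `β(x) = v* (1ₙ ⊗ x) v` for some `n ≥ 1` and some
isometry `v : ℂ^q → ℂ^n ⊗ ℂ^p`, where `1ₙ ⊗ x` is the `n`-fold amplification
(Kronecker product with the identity), realized as an `np × np` matrix via the canonical
identification `Fin n × Fin p ≃ Fin (n * p)`. -/
theorem stmt_6 {p q : ℕ}
    (β : Matrix (Fin p) (Fin p) ℂ →ₗ[ℂ] Matrix (Fin q) (Fin q) ℂ) (hβ : IsUcp β) :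
    ∃ (n : ℕ) (_ : 0 < n) (v : Matrix (Fin (n * p)) (Fin q) ℂ),
      v.conjTranspose * v = 1 ∧
      ∀ x : Matrix (Fin p) (Fin p) ℂ,
        β x = v.conjTranspose *
          (Matrix.reindex finProdFinEquiv finProdFinEquiv
            ((1 : Matrix (Fin n) (Fin n) ℂ) ⊗ₖ x)) * v := by
  obtain ⟨h1, hcp⟩ := hβ
  rcases Nat.eq_zero_or_pos q with rfl | hq
  · exact ⟨1, one_pos, 0, Subsingleton.elim _ _, fun x => Subsingleton.elim _ _⟩
  have hp : 0 < p := by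
    rcases Nat.eq_zero_or_pos p with rfl | hp
    · exfalso
      have h0 : (1 : Matrix (Fin 0) (Fin 0) ℂ) = 0 := Subsingleton.elim _ _
      rw [h0, map_zero] at h1
      have := congrFun (congrFun h1 ⟨0, hq⟩) ⟨0, hq⟩
      simp at this
    · exact hp
  obtain ⟨z, hz⟩ := hcp p (Matrix.of fun i j => Matrix.single i j (1 : ℂ))
    ⟨Matrix.of fun k j => if k = ⟨0, hp⟩ then Matrix.single ⟨0, hp⟩ j 1 else 0, by
      refine Matrix.ext fun i j => ?_
      rw [Matrix.mul_apply, Finset.sum_eq_single ⟨0, hp⟩]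
      · simp [Matrix.conjTranspose_apply, Matrix.star_eq_conjTranspose]
      · intro b _ hb
        simp [hb]
      · simp⟩
  have hE : ∀ i j a b, β (Matrix.single i j 1) a b
      = ∑ k, ∑ c, star (z k i c a) * z k j c b := by
    intro i j a b
    have h := congrFun (congrFun (congrFun (congrFun hz i) j) a) b
    rw [Matrix.map_apply, Matrix.of_apply, Matrix.mul_apply, Matrix.sum_apply] at h
    rw [h]
    rfl
  have hX : ∀ x a b, β x a b
      = ∑ k, ∑ c, ∑ i, ∑ j, star (z k i c a) * x i j * z k j c b := by
    intro x a b
    have hx : β x = ∑ i, ∑ j, x i j • β (Matrix.single i j 1) := by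
      conv_lhs => rw [Matrix.matrix_eq_sum_single x]
      simp only [map_sum]
      refine Finset.sum_congr rfl fun i _ => Finset.sum_congr rfl fun j _ => ?_
      rw [← map_smul, Matrix.smul_single, smul_eq_mul, mul_one]
    rw [hx]
    simp only [Matrix.sum_apply, Matrix.smul_apply, hE, smul_eq_mul, Finset.mul_sum]
    calc _ = ∑ i, ∑ k, ∑ c, ∑ j, x i j * (star (z k i c a) * z k j c b) := by
          refine Finset.sum_congr rfl fun i _ => ?_
          rw [Finset.sum_comm]
          exact Finset.sum_congr rfl fun k _ => Finset.sum_comm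
      _ = ∑ k, ∑ c, ∑ i, ∑ j, x i j * (star (z k i c a) * z k j c b) := by
          rw [Finset.sum_comm]
          exact Finset.sum_congr rfl fun k _ => Finset.sum_comm
      _ = _ := by
          refine Finset.sum_congr rfl fun k _ => Finset.sum_congr rfl fun c _ =>
            Finset.sum_congr rfl fun i _ => Finset.sum_congr rfl fun j _ => ?_
          ring
  let v : Matrix (Fin (p * q * p)) (Fin q) ℂ := Matrix.of fun r b =>
    z (finProdFinEquiv.symm (finProdFinEquiv.symm r).1).1 (finProdFinEquiv.symm r).2
      (finProdFinEquiv.symm (finProdFinEquiv.symm r).1).2 b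
  have key : ∀ x : Matrix (Fin p) (Fin p) ℂ,
      β x = v.conjTranspose *
        (Matrix.reindex finProdFinEquiv finProdFinEquiv
          ((1 : Matrix (Fin (p * q)) (Fin (p * q)) ℂ) ⊗ₖ x)) * v := by
    intro x
    ext a b
    rw [hX, Matrix.mul_assoc, Matrix.mul_apply, ← finProdFinEquiv.sum_comp, Fintype.sum_prod_type,
      ← finProdFinEquiv.sum_comp, Fintype.sum_prod_type]
    refine Finset.sum_congr rfl fun k _ => Finset.sum_congr rfl fun c _ =>
      Finset.sum_congr rfl fun i _ => ?_
    rw [Matrix.mul_apply, ← finProdFinEquiv.sum_comp, Fintype.sum_prod_type,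
      Finset.sum_eq_single (finProdFinEquiv (k, c))]
    · rw [Finset.mul_sum]
      refine Finset.sum_congr rfl fun j _ => ?_
      simp only [v, Matrix.of_apply, Matrix.conjTranspose_apply, Matrix.reindex_apply, Matrix.submatrix_apply,
        Equiv.symm_apply_apply, Matrix.kroneckerMap_apply, Matrix.one_apply_eq, one_mul, mul_assoc]
    · intro d _ hd
      refine Finset.sum_eq_zero fun j _ => ?_
      simp only [Matrix.reindex_apply, Matrix.submatrix_apply,
        Equiv.symm_apply_apply, Matrix.kroneckerMap_apply, Matrix.one_apply_ne hd.symm, zero_mul]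
    · simp
  refine ⟨p * q, Nat.mul_pos hp hq, v, ?_, key⟩
  have h := key 1
  rw [h1, Matrix.one_kronecker_one, Matrix.reindex_apply, Matrix.submatrix_one_equiv,
    Matrix.mul_one] at h
  exact h.symm
end

section
/- Let A be a separable C*-algebra whose cone CA = {f ∈ C([0,1], A) : f(1) = 0} is AF-embeddable. Suppose A is homotopically dominated by an AF-embeddable C*-algebra B, i.e., there exist *-homomorphisms φ : A → B and ψ : B → A and a family (γ_t)_{t∈[0,1]} of *-endomorphisms of A such that t ↦ γ_t(a) is norm-continuous for every a ∈ A, γ_0 = id_A, and γ_1 = ψ ∘ φ. Then A is AF-embeddable. -/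
/-- The data of an embedding of `A` into an AF-algebra: a C*-algebra `D` with an
increasing sequence of finite-dimensional `*`-subalgebras whose union is dense, together
with an injective `*`-homomorphism of `A` into `D`. -/
structure AFEmbedding (A : Type*) [NonUnitalRing A] [StarRing A] [Module ℂ A] where
  D : Type
  [instD : NonUnitalCStarAlgebra D]
  Dk : ℕ → NonUnitalStarSubalgebra ℂ D
  mono : Monotone Dk
  fd : ∀ k, FiniteDimensional ℂ (Dk k)
  dense : Dense (⋃ k, (Dk k : Set D))
  emb : A →⋆ₙₐ[ℂ] D
  inj : Function.Injective emb

/-- A C*-algebra is AF-embeddable if it embeds into an AF-algebra. -/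
def IsAFEmbeddable (A : Type*) [NonUnitalRing A] [StarRing A] [Module ℂ A] : Prop :=
  Nonempty (AFEmbedding A)

/-- The unit interval `[0,1]` as a subtype of `ℝ`. -/
abbrev I01 : Set ℝ := Set.Icc (0 : ℝ) 1

/-- The point `1 ∈ [0,1]`. -/
def onePt : I01 := ⟨1, by norm_num⟩

/-- The cone `CA = {f ∈ C([0,1], A) : f(1) = 0}` over `A`. -/
def coneAlg (A : Type*) [NonUnitalCStarAlgebra A] :
    NonUnitalStarSubalgebra ℂ C(I01, A) where
  carrier := {f | f onePt = 0}
  add_mem' := by intro f g hf hg; simp_all [Set.mem_setOf_eq]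
  zero_mem' := by simp [Set.mem_setOf_eq]
  mul_mem' := by intro f g hf hg; simp_all [Set.mem_setOf_eq]
  smul_mem' := by intro c f hf; simp_all [Set.mem_setOf_eq]
  star_mem' := by intro f hf; simp_all [Set.mem_setOf_eq]

section part1

open scoped ComplexOrder InnerProductSpace
open Complex

structure HRep (Q : Type) [CStarAlgebra Q] where
  H : Type
  [i1 : NormedAddCommGroup H]
  [i2 : InnerProductSpace ℂ H]
  [i3 : CompleteSpace H]
  π : Q →⋆ₐ[ℂ] (H →L[ℂ] H)

attribute [instance] HRep.i1 HRep.i2 HRep.i3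

/-- GNS with vector -/
theorem gns_vec {Q : Type} [CStarAlgebra Q] [PartialOrder Q] [StarOrderedRing Q]
    (f : Q →ₚ[ℂ] ℂ) : ∃ (r : HRep Q) (ξ : r.H), ∀ q, f q = ⟪ξ, r.π q ξ⟫_ℂ := by
  refine ⟨⟨f.GNS, f.gnsStarAlgHom⟩, ((f.toPreGNS 1 : f.PreGNS) : f.GNS), fun q => ?_⟩
  have : (f.gnsStarAlgHom q) ((f.toPreGNS 1 : f.PreGNS) : f.GNS)
     = ((f.toPreGNS q : f.PreGNS) : f.GNS) := by
    change f.gnsNonUnitalStarAlgHom q _ = _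
    rw [PositiveLinearMap.gnsNonUnitalStarAlgHom_apply_coe]
    simp
  change f q = ⟪((f.toPreGNS 1 : f.PreGNS) : f.GNS), (f.gnsStarAlgHom q) ((f.toPreGNS 1 : f.PreGNS) : f.GNS)⟫_ℂ
  rw [this, UniformSpace.Completion.inner_coe, PositiveLinearMap.preGNS_inner_def]
  simp

theorem nonneg_of_map_nonneg {B0 : Type*} {Q : Type*} [CStarAlgebra B0] [CStarAlgebra Q]
    [PartialOrder B0] [StarOrderedRing B0] [PartialOrder Q] [StarOrderedRing Q]
    (j : B0 →⋆ₐ[ℂ] Q) (hj : Function.Injective j) {z : B0} (hz : 0 ≤ j z) : 0 ≤ z := by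
  have hsa : IsSelfAdjoint z := by
    have := (IsSelfAdjoint.of_nonneg hz).star_eq
    rw [← map_star] at this
    exact hj this
  rw [StarOrderedRing.nonneg_iff_spectrum_nonneg (R := ℝ) z]
  rw [StarOrderedRing.nonneg_iff_spectrum_nonneg (R := ℝ) (j z), hsa.map_spectrum_real j hj] at hz
  exact hz

theorem exists_ext {B0 : Type*} {Q : Type} [CStarAlgebra B0] [CStarAlgebra Q]
    (j : B0 →⋆ₐ[ℂ] Q) (hj : Function.Injective j) (l : B0 →ₗ[ℂ] ℂ)
    (hl : ∀ z, 0 ≤ l (star z * z)) :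
    ∃ (r : HRep Q) (ξ : r.H), ∀ z, l z = ⟪ξ, r.π (j z) ξ⟫_ℂ := by
  let _ := CStarAlgebra.spectralOrder B0
  let _ := CStarAlgebra.spectralOrderedRing B0
  let _ := CStarAlgebra.spectralOrder Q
  let _ := CStarAlgebra.spectralOrderedRing Q
  have hl' : ∀ z, 0 ≤ z → 0 ≤ l z := by
    intro z hz
    obtain ⟨x, rfl⟩ := CStarAlgebra.nonneg_iff_eq_star_mul_self.mp hz
    exact hl x
  have hlp : ∃ lp : B0 →ₚ[ℂ] ℂ, ∀ z, lp z = l z :=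
    ⟨PositiveLinearMap.mk₀ l hl', fun z => rfl⟩
  have hlstar : ∀ z, l (star z) = star (l z) := by
    obtain ⟨lp, h⟩ := hlp
    intro z
    rw [← h, ← h, map_star]
  let s : PointedCone ℝ Q :=
    { carrier := {x | 0 ≤ x + star x}
      add_mem' := by
        intro a b ha hb
        simp only [Set.mem_ofPred_eq] at *
        have := add_nonneg ha hb
        rw [star_add]; convert this using 1; abel
      zero_mem' := by simp
      smul_mem' := by
        intro c x hx
        simp only [Set.mem_ofPred_eq] at *
        have : 0 ≤ (c : ℝ) • (x + star x) := smul_nonneg c.2 hx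
        rw [smul_add] at this
        convert this using 1
        change (c:ℝ) • x + star ((c:ℝ) • x) = _
        rw [star_smul]; simp }
  have hs : ∀ x, x ∈ s ↔ 0 ≤ x + star x := fun x => Iff.rfl
  let jr : B0 →ₗ[ℝ] Q := (j.toAlgHom.toLinearMap).restrictScalars ℝ
  have hjr : ∀ z, jr z = j z := fun z => rfl
  let e := LinearEquiv.ofInjective jr hj
  let f : Q →ₗ.[ℝ] ℝ := ⟨LinearMap.range jr, (Complex.reLm ∘ₗ l.restrictScalars ℝ) ∘ₗ e.symm.toLinearMap⟩
  have hf : ∀ z, f (e z) = (l z).re := by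
    intro z
    change (l (e.symm (e z))).re = _
    simp
  obtain ⟨g, hg1, hg2⟩ := riesz_extension s f (by
      intro x hx
      obtain ⟨z, rfl⟩ := e.surjective x
      rw [hf]
      rw [hs] at hx
      change 0 ≤ j z + star (j z) at hx
      rw [← map_star, ← map_add] at hx
      have h1 := hl' _ (nonneg_of_map_nonneg j hj hx)
      rw [map_add, hlstar] at h1
      have := (Complex.le_def.mp h1).1
      simp at this
      linarith) (by
      intro y
      refine ⟨e ((‖y + star y‖ : ℝ) • 1), ?_⟩
      rw [hs]
      change 0 ≤ j ((‖y + star y‖ : ℝ) • 1) + y + star (j ((‖y + star y‖ : ℝ) • 1) + y)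
      have h1 : j ((‖y + star y‖ : ℝ) • 1) = algebraMap ℝ Q ‖y + star y‖ := by
        rw [Algebra.algebraMap_eq_smul_one, ← map_one j]
        exact map_smul jr _ _
      rw [h1]
      have h2 := IsSelfAdjoint.neg_algebraMap_norm_le_self (a := y + star y) (by
        simp [IsSelfAdjoint, add_comm])
      have h3 : (0:Q) ≤ algebraMap ℝ Q ‖y + star y‖ := by
        rw [Algebra.algebraMap_eq_smul_one]
        exact smul_nonneg (norm_nonneg _) zero_le_one
      rw [star_add, ← algebraMap_star_comm]
      simp only [star_trivial]
      have h4 : 0 ≤ algebraMap ℝ Q ‖y + star y‖ + (y + star y) := by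
        have := neg_le_iff_add_nonneg.mp h2
        rwa [add_comm] at this
      convert add_nonneg h3 h4 using 1
      abel)
  have hgj : ∀ z, g (j z) = (l z).re := by
    intro z
    rw [← hf, ← hg1]; rfl
  let L : Q →ₗ[ℂ] ℂ := Module.Dual.extendRCLike (𝕜 := ℂ) g
  have hL : ∀ x, L x = (g x : ℂ) - I * (g (I • x) : ℂ) := fun x => rfl
  have hLpos : ∀ x, 0 ≤ x → 0 ≤ L x := by
    intro x hx
    have hxs : star x = x := (IsSelfAdjoint.of_nonneg hx).star_eq
    have h1 : 0 ≤ g x := hg2 _ (by rw [hs, hxs]; exact add_nonneg hx hx)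
    have h2 : 0 ≤ g (I • x) := hg2 _ (by rw [hs, star_smul, hxs]; simp)
    have h3 : 0 ≤ g (-(I • x)) := hg2 _ (by rw [hs, star_neg, star_smul, hxs]; simp)
    rw [map_neg] at h3
    have h4 : g (I • x) = 0 := by linarith
    rw [hL, h4]
    simpa using h1
  obtain ⟨r, ξ, hr⟩ := gns_vec (PositiveLinearMap.mk₀ L hLpos)
  refine ⟨r, ξ, fun z => ?_⟩
  rw [← hr]
  change _ = L _
  have h5 : I • j z = j (I • z) := (map_smul j _ _).symm
  rw [hL, h5, hgj, hgj, map_smul]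
  apply Complex.ext <;> simp

end part1

section part2

open scoped ComplexOrder InnerProductSpace
open Complex

theorem rep_separates {D : Type} [CStarAlgebra D] (d : D) (hd : d ≠ 0) :
    ∃ (r : HRep D) (ξ : r.H), r.π d ξ ≠ 0 := by
  have ha : IsSelfAdjoint (star d * d) := IsSelfAdjoint.star_mul_self d
  have hn : IsStarNormal (star d * d) := ha.isStarNormal
  have hne : star d * d ≠ 0 := by
    intro h; exact hd (CStarRing.star_mul_self_eq_zero_iff d |>.mp h)
  have : ∃ t ∈ spectrum ℂ (star d * d), t ≠ 0 := by
    by_contra! h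
    exact hne (CFC.eq_zero_of_spectrum_subset_zero (R := ℂ) (p := IsStarNormal) _ (fun x hx => h x hx))
  obtain ⟨t, ht, ht0⟩ := this
  obtain ⟨r, ξ, h⟩ := exists_ext (cfcHom (R := ℂ) hn) (cfcHom_injective hn)
    ({ toFun := fun f => f ⟨t, ht⟩, map_add' := by simp, map_smul' := by simp } :
      C(spectrum ℂ (star d * d), ℂ) →ₗ[ℂ] ℂ) (by
      intro z
      change 0 ≤ star (z ⟨t, ht⟩) * z ⟨t, ht⟩
      exact star_mul_self_nonneg _)
  refine ⟨r, ξ, fun h0 => ht0 ?_⟩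
  have h2 := h (.restrict (spectrum ℂ (star d * d)) (.id ℂ))
  rw [cfcHom_id hn, map_mul] at h2
  change t = _ at h2
  rw [h2, mul_apply_eq_comp, h0]
  simp

section dsum
variable {Q : Type} [CStarAlgebra Q] {ι : Type} (r : ι → HRep Q)

abbrev HSum : Type := lp (fun i => (r i).H) 2

noncomputable def sumOp (q : Q) : HSum r →L[ℂ] HSum r :=
  lp.mapCLM 2 (fun i => (r i).π q) (norm_nonneg q)
    (fun _ => NonUnitalStarAlgHom.norm_apply_le _ _)

theorem sumOp_apply (q : Q) (f : HSum r) (i : ι) : (sumOp r q f) i = (r i).π q (f i) := rfl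

theorem sumOp_star (a : Q) : sumOp r (star a) = star (sumOp r a) := by
  refine (ContinuousLinearMap.eq_adjoint_iff _ _).mpr ?_
  intro f g
  rw [lp.inner_eq_tsum, lp.inner_eq_tsum]
  congr 1; ext i
  rw [sumOp_apply, sumOp_apply, map_star]
  exact ContinuousLinearMap.adjoint_inner_left _ _ _

noncomputable def sumHom : Q →⋆ₐ[ℂ] (HSum r →L[ℂ] HSum r) where
  toFun := sumOp r
  map_one' := by ext f i; simp [sumOp_apply]
  map_mul' := by intro a b; ext f i; simp [sumOp_apply]
  map_zero' := by ext f i; simp [sumOp_apply]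
  map_add' := by intro a b; ext f i; simp [sumOp_apply]
  commutes' := by
    intro c; ext f i; rw [sumOp_apply]; simp [Algebra.algebraMap_eq_smul_one]
  map_star' := sumOp_star r

noncomputable def repSum : HRep Q := { H := HSum r, π := sumHom r }

open Classical in
noncomputable def sumJ (i : ι) : (r i).H →ₗᵢ[ℂ] HSum r :=
  { toFun := fun x => lp.single (E := fun i => (r i).H) 2 i x
    map_add' := fun x y => lp.single_add (E := fun i => (r i).H) 2 i x y
    map_smul' := fun c x => lp.single_smul (E := fun i => (r i).H) 2 i c x
    norm_map' := fun x => lp.norm_single (E := fun i => (r i).H) (p := 2) two_pos i x }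

open Classical in
theorem sumJ_apply (i : ι) (x) : sumJ r i x = lp.single (E := fun i => (r i).H) 2 i x := rfl

theorem sumOp_J (i q x) : sumOp r q (sumJ r i x) = sumJ r i ((r i).π q x) := by
  classical
  ext k
  rw [sumOp_apply, sumJ_apply, sumJ_apply]
  by_cases h : k = i
  · subst h; simp
  · simp [h]

theorem sumJ_inner (i j x y) (h : i ≠ j) : ⟪sumJ r i x, sumJ r j y⟫_ℂ = 0 := by
  classical
  rw [sumJ_apply, sumJ_apply, lp.inner_single_left, lp.single_apply_ne _ _ _ h, inner_zero_right]

theorem rep_directSum :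
    ∃ (R : HRep Q) (J : ∀ i, (r i).H →ₗᵢ[ℂ] R.H),
      (∀ i q x, R.π q (J i x) = J i ((r i).π q x)) ∧
      (∀ i j x y, i ≠ j → ⟪J i x, J j y⟫_ℂ = 0) :=
  ⟨repSum r, sumJ r, sumOp_J r, sumJ_inner r⟩
end dsum

theorem exists_faithful (D : Type) [CStarAlgebra D] :
    ∃ R : HRep D, ∀ V : Submodule ℂ D, FiniteDimensional ℂ V →
      ∃ v : R.H, ∀ d ∈ V, R.π d v = 0 → d = 0 := by
  classical
  choose r ξ hr using fun d : {d : D // d ≠ 0} => rep_separates d.1 d.2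
  obtain ⟨R, J, h1, h2⟩ := rep_directSum r
  refine ⟨R, fun V hV => ?_⟩
  have key : ∀ n : ℕ, ∀ W : Submodule ℂ D, FiniteDimensional ℂ W → Module.finrank ℂ W = n →
      ∃ s : Finset {d : D // d ≠ 0}, ∀ d ∈ W, (∀ i ∈ s, (r i).π d (ξ i) = 0) → d = 0 := by
    intro n
    induction n using Nat.strong_induction_on with
    | _ n ih =>
      intro W hW hn
      by_cases hbot : W = ⊥
      · exact ⟨∅, fun d hd _ => by simpa [hbot] using hd⟩
      · obtain ⟨d0, hd0, hne⟩ := Submodule.exists_mem_ne_zero_of_ne_bot hbot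
        let i0 : {d : D // d ≠ 0} := ⟨d0, hne⟩
        let ev : D →ₗ[ℂ] (r i0).H :=
          { toFun := fun d => (r i0).π d (ξ i0), map_add' := by simp, map_smul' := by simp }
        have hlt : W ⊓ LinearMap.ker ev < W := by
          refine lt_of_le_of_ne inf_le_left fun h => ?_
          have : d0 ∈ W ⊓ LinearMap.ker ev := by rw [h]; exact hd0
          exact hr i0 (LinearMap.mem_ker.mp this.2)
        have hfd : FiniteDimensional ℂ (W ⊓ LinearMap.ker ev : Submodule ℂ D) :=
          Submodule.finiteDimensional_of_le inf_le_left
        obtain ⟨s, hs⟩ := ih _ (hn ▸ Submodule.finrank_lt_finrank_of_lt hlt) _ hfd rfl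
        refine ⟨insert i0 s, fun d hd hall => hs d ⟨hd, ?_⟩ fun i hi => hall i (by simp [hi])⟩
        exact LinearMap.mem_ker.mpr (hall i0 (by simp))
  obtain ⟨s, hs⟩ := key _ V hV rfl
  refine ⟨∑ i ∈ s, J i (ξ i), fun d hd h0 => hs d hd fun i hi => ?_⟩
  have h3 : ⟪J i ((r i).π d (ξ i)), R.π d (∑ k ∈ s, J k (ξ k))⟫_ℂ = 0 := by rw [h0]; simp
  rw [map_sum, inner_sum, Finset.sum_eq_single i] at h3
  · rw [h1, LinearIsometry.inner_map_map] at h3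
    exact inner_self_eq_zero.mp h3
  · intro k hk hki
    rw [h1]; exact h2 _ _ _ _ (Ne.symm hki)
  · intro h; exact absurd hi h

end part2

section part3

open scoped ComplexOrder InnerProductSpace TensorProduct
open Complex
set_option linter.unusedSectionVars false

section tensor
variable (H K : Type) [NormedAddCommGroup H] [InnerProductSpace ℂ H] [CompleteSpace H]
  [NormedAddCommGroup K] [InnerProductSpace ℂ K] [CompleteSpace K]

abbrev HTen : Type := UniformSpace.Completion (H ⊗[ℂ] K)

variable {H K}

noncomputable def tn (h : H) (k : K) : HTen H K := ((h ⊗ₜ[ℂ] k : H ⊗[ℂ] K) : HTen H K)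

theorem tn_inner (h h' : H) (k k' : K) :
    ⟪tn h k, tn h' k'⟫_ℂ = ⟪h, h'⟫_ℂ * ⟪k, k'⟫_ℂ := by
  rw [tn, tn, UniformSpace.Completion.inner_coe, TensorProduct.inner_tmul]

theorem tn_norm (h : H) (k : K) : ‖tn h k‖ = ‖h‖ * ‖k‖ := by
  rw [tn, UniformSpace.Completion.norm_coe, TensorProduct.norm_tmul]

theorem tn_add_left (h h' : H) (k : K) : tn (h + h') k = tn h k + tn h' k := by
  rw [tn, TensorProduct.add_tmul, UniformSpace.Completion.coe_add]; rfl
theorem tn_add_right (h : H) (k k' : K) : tn h (k + k') = tn h k + tn h k' := by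
  rw [tn, TensorProduct.tmul_add, UniformSpace.Completion.coe_add]; rfl
theorem tn_smul_left (c : ℂ) (h : H) (k : K) : tn (c • h) k = c • tn h k := by
  rw [tn, ← TensorProduct.smul_tmul', UniformSpace.Completion.coe_smul]; rfl
theorem tn_smul_right (c : ℂ) (h : H) (k : K) : tn h (c • k) = c • tn h k := by
  rw [tn, TensorProduct.tmul_smul, UniformSpace.Completion.coe_smul]; rfl
theorem tn_zero_left (k : K) : tn (0 : H) k = 0 := by
  have := tn_smul_left 0 (0:H) k; simpa using this
theorem tn_zero_right (h : H) : tn h (0 : K) = 0 := by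
  have := tn_smul_right 0 h (0:K); simpa using this

theorem ten_ext {S T : HTen H K →L[ℂ] HTen H K} (hST : ∀ h k, S (tn h k) = T (tn h k)) :
    S = T := by
  ext x
  induction x using UniformSpace.Completion.induction_on with
  | hp => exact isClosed_eq S.continuous T.continuous
  | ih x =>
    induction x using TensorProduct.induction_on with
    | zero => rw [UniformSpace.Completion.coe_zero, map_zero]; simp
    | tmul h k => exact hST h k
    | add x y hx hy => rw [UniformSpace.Completion.coe_add, map_add, map_add, hx, hy]

theorem ten_ext_inner {S T : HTen H K →L[ℂ] HTen H K}
    (hST : ∀ h k h' k', ⟪S (tn h k), tn h' k'⟫_ℂ = ⟪tn h k, T (tn h' k')⟫_ℂ) :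
    S = star T := by
  refine (ContinuousLinearMap.eq_adjoint_iff _ _).mpr ?_
  intro x y
  induction x, y using UniformSpace.Completion.induction_on₂ with
  | hp => apply isClosed_eq <;> fun_prop
  | ih x y =>
    induction x using TensorProduct.induction_on with
    | zero => rw [UniformSpace.Completion.coe_zero, map_zero]; simp
    | add x x' hx hy =>
      rw [UniformSpace.Completion.coe_add, map_add, inner_add_left, inner_add_left, hx, hy]
    | tmul h k =>
      induction y using TensorProduct.induction_on with
      | zero => rw [UniformSpace.Completion.coe_zero, map_zero]; simp
      | add x x' hx hy =>
        rw [UniformSpace.Completion.coe_add, map_add, inner_add_right, inner_add_right, hx, hy]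
      | tmul h' k' => exact hST h k h' k'

noncomputable def opL (T : H →L[ℂ] H) : HTen H K →L[ℂ] HTen H K := (T.rTensor K).completion
noncomputable def opR (T : K →L[ℂ] K) : HTen H K →L[ℂ] HTen H K := (T.lTensor H).completion

@[simp] theorem opL_tn (T : H →L[ℂ] H) (h : H) (k : K) : opL T (tn h k) = tn (T h) k := by
  rw [tn, opL, ContinuousLinearMap.completion_apply_coe]; simp [tn]
@[simp] theorem opR_tn (T : K →L[ℂ] K) (h : H) (k : K) : opR T (tn h k) = tn h (T k) := by
  rw [tn, opR, ContinuousLinearMap.completion_apply_coe]; simp [tn]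

variable (H K) in
noncomputable def alphaT : (H →L[ℂ] H) →⋆ₐ[ℂ] (HTen H K →L[ℂ] HTen H K) where
  toFun := opL
  map_one' := ten_ext fun h k => by simp
  map_mul' a b := ten_ext fun h k => by simp
  map_zero' := ten_ext fun h k => by simp [tn_zero_left]
  map_add' a b := ten_ext fun h k => by simp [tn_add_left]
  commutes' c := ten_ext fun h k => by simp [Algebra.algebraMap_eq_smul_one, tn_smul_left]
  map_star' a := ten_ext_inner fun h k h' k' => by
    rw [opL_tn, opL_tn, tn_inner, tn_inner, ContinuousLinearMap.star_eq_adjoint,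
      ContinuousLinearMap.adjoint_inner_left]

variable (H K) in
noncomputable def betaT : (K →L[ℂ] K) →⋆ₐ[ℂ] (HTen H K →L[ℂ] HTen H K) where
  toFun := opR
  map_one' := ten_ext fun h k => by simp
  map_mul' a b := ten_ext fun h k => by simp
  map_zero' := ten_ext fun h k => by simp [tn_zero_right]
  map_add' a b := ten_ext fun h k => by simp [tn_add_right]
  commutes' c := ten_ext fun h k => by simp [Algebra.algebraMap_eq_smul_one, tn_smul_right]
  map_star' a := ten_ext_inner fun h k h' k' => by
    rw [opR_tn, opR_tn, tn_inner, tn_inner, ContinuousLinearMap.star_eq_adjoint,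
      ContinuousLinearMap.adjoint_inner_left]

@[simp] theorem alphaT_tn (T : H →L[ℂ] H) (h : H) (k : K) :
    alphaT H K T (tn h k) = tn (T h) k := opL_tn T h k
@[simp] theorem betaT_tn (T : K →L[ℂ] K) (h : H) (k : K) :
    betaT H K T (tn h k) = tn h (T k) := opR_tn T h k

theorem alpha_beta_comm (T : H →L[ℂ] H) (S : K →L[ℂ] K) :
    alphaT H K T * betaT H K S = betaT H K S * alphaT H K T :=
  ten_ext fun h k => by simp

theorem alphaT_norm_le (T : H →L[ℂ] H) : ‖alphaT H K T‖ ≤ ‖T‖ :=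
  NonUnitalStarAlgHom.norm_apply_le (A := H →L[ℂ] H) (B := HTen H K →L[ℂ] HTen H K) (alphaT H K) T
theorem betaT_norm_le (T : K →L[ℂ] K) : ‖betaT H K T‖ ≤ ‖T‖ :=
  NonUnitalStarAlgHom.norm_apply_le (A := K →L[ℂ] K) (B := HTen H K →L[ℂ] HTen H K) (betaT H K) T
end tensor

end part3

section part4

open scoped ComplexOrder InnerProductSpace TensorProduct
open Complex

theorem exists_inv_sqrt {D : Type} [CStarAlgebra D] (S : StarSubalgebra ℂ D)
    [FiniteDimensional ℂ S] [PartialOrder D] [StarOrderedRing D] (q : D) (hq : q ∈ S)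
    (hpos : 0 ≤ q) (hu : IsUnit q) :
    ∃ r ∈ S, star r = r ∧ q * (r * r) = 1 ∧ ∀ c, Commute q c → Commute r c := by
  have hcl : IsClosed (S : Set D) := (S.toSubalgebra.toSubmodule).closed_of_finiteDimensional
  have hsa : IsSelfAdjoint q := .of_nonneg hpos
  have hsp : ∀ x ∈ spectrum ℝ q, 0 < x := by
    intro x hx
    have h1 : 0 ≤ x := spectrum_nonneg_of_nonneg hpos hx
    refine lt_of_le_of_ne h1 fun h => ?_
    rw [← h] at hx
    exact spectrum.zero_notMem ℝ hu hx
  have hc : ContinuousOn (fun x : ℝ => (√x)⁻¹) (spectrum ℝ q) := by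
    apply ContinuousOn.inv₀ (by fun_prop)
    intro x hx
    exact (Real.sqrt_pos.mpr (hsp x hx)).ne'
  refine ⟨cfc (fun x : ℝ => (√x)⁻¹) q, cfc_mem (𝕜' := ℂ) _ hq, ?_, ?_, ?_⟩
  · exact (cfc_predicate (R := ℝ) (fun x : ℝ => (√x)⁻¹) q : IsSelfAdjoint _).star_eq
  · rw [← cfc_mul _ _ q hc hc]
    nth_rewrite 1 [← cfc_id ℝ q]
    rw [← cfc_mul (id : ℝ → ℝ) (fun x : ℝ => (√x)⁻¹ * (√x)⁻¹) q (by fun_prop) (hc.mul hc), ← cfc_one ℝ q]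
    apply cfc_congr
    intro x hx
    have := hsp x hx
    have h2 := Real.mul_self_sqrt this.le
    have h3 := (Real.sqrt_pos.mpr this).ne'
    simp only [id, Pi.one_apply]
    rw [← mul_inv, h2, mul_inv_cancel₀ this.ne']
  · intro c hcq
    exact Commute.cfc_real hcq _

theorem lemE {D : Type} [CStarAlgebra D] (R : HRep D) (hinj : Function.Injective R.π)
    (S : StarSubalgebra ℂ D) [FiniteDimensional ℂ S] (v : R.H)
    (hv : ∀ d ∈ S, R.π d v = 0 → d = 0) :
    ∃ (n : ℕ) (ζ : Fin n → R.H) (d : Fin n → D), (∀ j, d j ∈ S) ∧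
      (∀ c ∈ S, ∑ i, ∑ j, ⟪ζ i, R.π c (ζ j)⟫_ℂ • (star (d i) * d j) = c) ∧
      ∀ T : R.H →L[ℂ] R.H, ‖∑ i, ∑ j, ⟪ζ i, T (ζ j)⟫_ℂ • (star (d i) * d j)‖ ≤ ‖T‖ := by
  let _ := CStarAlgebra.spectralOrder D
  let _ := CStarAlgebra.spectralOrderedRing D
  let ev : D →ₗ[ℂ] R.H :=
    { toFun := fun d => R.π d v, map_add' := by simp, map_smul' := by simp }
  let SM : Submodule ℂ D := S.toSubalgebra.toSubmodule
  have hSM : FiniteDimensional ℂ SM := ‹_›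
  let W : Submodule ℂ R.H := SM.map ev
  have hW : FiniteDimensional ℂ W := inferInstance
  let b := stdOrthonormalBasis ℂ W
  have hg : ∀ j, ∃ g ∈ S, R.π g v = b j := by
    intro j
    obtain ⟨g, hg, h⟩ := (b j).2
    exact ⟨g, hg, h⟩
  choose g hgS hgv using hg
  have hexp : ∀ x ∈ W, ∑ i, ⟪(b i : R.H), x⟫_ℂ • (b i : R.H) = x := by
    intro x hx
    have := congrArg (Subtype.val) (b.sum_repr' ⟨x, hx⟩)
    simpa using this
  have hcg : ∀ c ∈ S, ∀ j, ∑ i, ⟪(b i : R.H), R.π c (b j)⟫_ℂ • g i = c * g j := by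
    intro c hc j
    rw [← sub_eq_zero]
    apply hv
    · exact sub_mem (sum_mem fun i _ => S.smul_mem (hgS i) _) (mul_mem hc (hgS j))
    · have h1 : R.π c (b j) ∈ W := by
        refine ⟨c * g j, (mul_mem hc (hgS j) : c * g j ∈ S), ?_⟩
        change R.π (c * g j) v = _
        rw [map_mul, mul_apply_eq_comp, hgv]
      have h2 := hexp _ h1
      rw [map_sub, map_mul, sub_apply, mul_apply_eq_comp, hgv, ← h2]
      rw [sub_eq_zero]
      simp only [map_sum, map_smul, sum_apply, smul_apply, hgv, h2]
  set q : D := ∑ j, g j * star (g j) with hq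
  have hqS : q ∈ S := sum_mem fun j _ => mul_mem (hgS j) (star_mem (hgS j))
  have hqsa : star q = q := by simp [hq]
  have hcq : ∀ c ∈ S, ∑ i, ∑ j, ⟪(b i : R.H), R.π c (b j)⟫_ℂ • (g i * star (g j)) = c * q := by
    intro c hc
    rw [Finset.sum_comm, hq, Finset.mul_sum]
    refine Finset.sum_congr rfl fun j _ => ?_
    rw [← mul_assoc, ← hcg c hc j, Finset.sum_mul]
    simp
  have hcomm : ∀ c ∈ S, c * q = q * c := by
    intro c hc
    have h1 := congrArg star (hcq (star c) (star_mem hc))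
    rw [star_mul, star_star, hqsa] at h1
    rw [← h1, ← hcq c hc, star_sum, Finset.sum_comm]
    refine Finset.sum_congr rfl fun i _ => ?_
    rw [star_sum]
    refine Finset.sum_congr rfl fun j _ => ?_
    rw [star_smul, star_mul, star_star]
    congr 1
    rw [map_star, ContinuousLinearMap.star_eq_adjoint, ContinuousLinearMap.adjoint_inner_right]
    exact (inner_conj_symm _ _).symm
  have hq0 : 0 ≤ q := Finset.sum_nonneg fun j _ => mul_star_self_nonneg _
  have hqinj : ∀ c ∈ S, q * c = 0 → c = 0 := by
    intro c hc h0
    have h1 : ∑ j, star (star (g j) * c) * (star (g j) * c) = 0 := by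
      have : ∑ j, star (star (g j) * c) * (star (g j) * c) = star c * (q * c) := by
        rw [hq, Finset.sum_mul, Finset.mul_sum]
        refine Finset.sum_congr rfl fun j _ => ?_
        rw [star_mul, star_star]; noncomm_ring
      rw [this, h0, mul_zero]
    rw [Finset.sum_eq_zero_iff_of_nonneg fun j _ => star_mul_self_nonneg _] at h1
    have h2 : ∀ j, star c * g j = 0 := by
      intro j
      have := (CStarRing.star_mul_self_eq_zero_iff _).mp (h1 j (Finset.mem_univ _))
      have := congrArg star this
      simpa using this
    have h3 : R.π (star c) v = 0 := by
      have hvW : v ∈ W := ⟨1, one_mem S, by simp [ev]⟩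
      rw [← hexp v hvW, map_sum]
      refine Finset.sum_eq_zero fun j _ => ?_
      rw [map_smul, ← hgv, ← mul_apply_eq_comp, ← map_mul, h2]
      simp
    have := hv _ (star_mem hc) h3
    simpa using this
  have hqu : IsUnit q := by
    let qS : S := ⟨q, hqS⟩
    have hinjS : Function.Injective (LinearMap.mulLeft ℂ qS) := by
      rw [← LinearMap.ker_eq_bot, LinearMap.ker_eq_bot']
      intro c hc
      apply Subtype.ext
      exact hqinj c c.2 (congrArg Subtype.val hc)
    have hsurj := LinearMap.injective_iff_surjective.mp hinjS
    obtain ⟨x, hx⟩ := hsurj 1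
    have hx' : q * (x : D) = 1 := congrArg Subtype.val hx
    exact ⟨⟨q, x, hx', by rw [hcomm _ x.2, hx']⟩, rfl⟩
  obtain ⟨r, hrS, hrsa, hr1, hrc⟩ := exists_inv_sqrt S q hqS hq0 hqu
  let d : Fin _ → D := fun j => star (g j) * r
  let ζ : Fin _ → R.H := fun j => b j
  have hE : ∀ c ∈ S, ∑ i, ∑ j, ⟪ζ i, R.π c (ζ j)⟫_ℂ • (star (d i) * d j) = c := by
    intro c hc
    have h1 : ∑ i, ∑ j, ⟪ζ i, R.π c (ζ j)⟫_ℂ • (star (d i) * d j) = r * (c * q) * r := by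
      rw [← hcq c hc, Finset.mul_sum, Finset.sum_mul]
      refine Finset.sum_congr rfl fun i _ => ?_
      rw [Finset.mul_sum, Finset.sum_mul]
      refine Finset.sum_congr rfl fun j _ => ?_
      simp only [d, star_mul, star_star, hrsa, mul_smul_comm, smul_mul_assoc, mul_assoc, ζ]
    have h2 : r * c = c * r := (hrc c (hcomm c hc).symm)
    have h3 : r * q = q * r := (hrc q (Commute.refl q))
    rw [h1, ← mul_assoc, h2, mul_assoc c r q, h3, mul_assoc, mul_assoc, hr1, mul_one]
  refine ⟨_, ζ, d, fun j => mul_mem (star_mem (hgS j)) hrS, hE, fun T => ?_⟩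
  have hON : Orthonormal ℂ ζ := b.orthonormal.comp_linearIsometry W.subtypeₗᵢ
  have hd1 : ∑ i, star (d i) * d i = 1 := by
    rw [← hE 1 (one_mem S)]
    refine Finset.sum_congr rfl fun i _ => ?_
    rw [Finset.sum_eq_single i]
    · simp [hON.1 i, inner_self_eq_norm_sq_to_K]
    · intro j _ hj
      simp [hON.2 (Ne.symm hj)]
    · simp
  let u : R.H → HTen R.H R.H := fun k => ∑ i, tn (ζ i) (R.π (d i) k)
  have hu : ∀ T : R.H →L[ℂ] R.H, ∀ k k', ⟪u k, alphaT R.H R.H T (u k')⟫_ℂ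
      = ⟪k, R.π (∑ i, ∑ j, ⟪ζ i, T (ζ j)⟫_ℂ • (star (d i) * d j)) k'⟫_ℂ := by
    intro T k k'
    simp only [u, map_sum, sum_inner, inner_sum, alphaT_tn, tn_inner, sum_apply,
      map_smul, smul_apply, inner_smul_right, map_mul, mul_apply_eq_comp]
    rw [Finset.sum_comm]
    refine Finset.sum_congr rfl fun i _ => Finset.sum_congr rfl fun j _ => ?_
    rw [map_star, ContinuousLinearMap.star_eq_adjoint, ContinuousLinearMap.adjoint_inner_right]
  have hun : ∀ k, ‖u k‖ = ‖k‖ := by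
    intro k
    have h1 := hu 1 k k
    have h2 := hE 1 (one_mem S)
    rw [map_one] at h2 h1
    rw [h2, map_one, one_apply_eq_self, one_apply_eq_self, inner_self_eq_norm_sq_to_K, inner_self_eq_norm_sq_to_K] at h1
    have h3 : ‖u k‖ ^ 2 = ‖k‖ ^ 2 := by exact_mod_cast h1
    exact (sq_eq_sq₀ (norm_nonneg _) (norm_nonneg _)).mp h3
  rw [← NonUnitalStarAlgHom.norm_map R.π hinj]
  refine ContinuousLinearMap.opNorm_le_bound _ (norm_nonneg _) fun k => ?_
  set X := R.π (∑ i, ∑ j, ⟪ζ i, T (ζ j)⟫_ℂ • (star (d i) * d j)) with hX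
  have h1 := hu T (X k) k
  rw [← hX, inner_self_eq_norm_sq_to_K] at h1
  have h2 : ‖X k‖ ^ 2 ≤ ‖X k‖ * (‖T‖ * ‖k‖) := by
    have h3 : ‖⟪u (X k), alphaT R.H R.H T (u k)⟫_ℂ‖ = ‖X k‖ ^ 2 := by rw [h1]; simp
    rw [← h3]
    refine (norm_inner_le_norm _ _).trans ?_
    rw [hun]
    gcongr
    refine (ContinuousLinearMap.le_opNorm _ _).trans ?_
    rw [hun]
    gcongr
    exact alphaT_norm_le T
  by_cases h0 : ‖X k‖ = 0
  · rw [h0]; positivity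
  · have : 0 < ‖X k‖ := lt_of_le_of_ne (norm_nonneg _) (Ne.symm h0)
    rw [sq] at h2
    exact le_of_mul_le_mul_left h2 this

end part4

section part5

open scoped ComplexOrder InnerProductSpace TensorProduct
open Complex

section mats
variable {n : ℕ}

noncomputable def matHom (n : ℕ) {B Q : Type*} [CStarAlgebra B] [CStarAlgebra Q] (j : B →⋆ₐ[ℂ] Q) :
    CStarMatrix (Fin n) (Fin n) B →⋆ₐ[ℂ] CStarMatrix (Fin n) (Fin n) Q where
  toFun M := M.map j
  map_one' := by ext i k; by_cases h : i = k <;> simp [CStarMatrix.one_apply, h]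
  map_zero' := by ext i k; simp
  map_add' M N := by ext i k; simp
  map_mul' M N := by ext i k; simp [CStarMatrix.mul_apply]
  map_star' M := by
    ext i k
    change j (star (M k i)) = star (j (M k i))
    exact map_star j _
  commutes' c := by
    ext i k
    by_cases h : i = k
    · simp only [CStarMatrix.algebraMap_apply, CStarMatrix.map_apply, h, if_true]
      exact AlgHomClass.commutes j c
    · simp [CStarMatrix.algebraMap_apply, h]

noncomputable def dgM (n : ℕ) {Q : Type*} [CStarAlgebra Q] (q : Q) :
    CStarMatrix (Fin n) (Fin n) Q :=
  CStarMatrix.ofMatrix (fun i k => if i = k then q else 0)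

theorem dgM_apply {Q : Type*} [CStarAlgebra Q] (q : Q) (a b) :
    dgM n q a b = if a = b then q else 0 := rfl

noncomputable def diagHom (n : ℕ) (Q : Type*) [CStarAlgebra Q] :
    Q →⋆ₐ[ℂ] CStarMatrix (Fin n) (Fin n) Q where
  toFun q := dgM n q
  map_one' := by ext i k; simp [CStarMatrix.one_apply, dgM_apply]
  map_zero' := by ext i k; simp [dgM_apply]
  map_add' M N := by ext i k; by_cases h : i = k <;> simp [h, dgM_apply]
  map_mul' M N := by
    ext i k; by_cases h : i = k <;> simp [CStarMatrix.mul_apply, h, dgM_apply]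
  map_star' M := by
    ext i k
    rw [CStarMatrix.star_apply, dgM_apply, dgM_apply]
    by_cases h : i = k
    · simp [h]
    · simp [h, Ne.symm h]
  commutes' c := by
    ext i k; simp [CStarMatrix.algebraMap_apply, dgM_apply]

noncomputable def unitM {Q : Type*} [CStarAlgebra Q] (i k : Fin n) (q : Q) :
    CStarMatrix (Fin n) (Fin n) Q :=
  CStarMatrix.ofMatrix (fun a b => if a = i ∧ b = k then q else 0)

theorem unitM_apply {Q : Type*} [CStarAlgebra Q] (i k : Fin n) (q : Q) (a b) :
    unitM i k q a b = if a = i ∧ b = k then q else 0 := rfl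

theorem diagHom_apply {Q : Type*} [CStarAlgebra Q] (q : Q) (a b) :
    diagHom n Q q a b = if a = b then q else 0 := rfl

theorem matHom_unitM {B Q : Type*} [CStarAlgebra B] [CStarAlgebra Q] (j : B →⋆ₐ[ℂ] Q)
    (i k : Fin n) (b : B) : matHom n j (unitM i k b) = unitM i k (j b) := by
  ext a c
  change j (unitM i k b a c) = _
  rw [unitM_apply, unitM_apply]
  by_cases h : a = i ∧ c = k <;> simp [h]

theorem unitM_conj {Q : Type*} [CStarAlgebra Q] (i0 i k : Fin n) (q : Q) :
    star (unitM i0 i (1 : Q)) * (diagHom n Q q * unitM i0 k 1) = unitM i k q := by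
  ext a b
  simp only [CStarMatrix.mul_apply, CStarMatrix.star_apply, unitM_apply, diagHom_apply]
  rw [Finset.sum_eq_single i0]
  · rw [Finset.sum_eq_single i0]
    · by_cases h1 : a = i <;> by_cases h2 : b = k <;> simp [h1, h2]
    · intro c _ hc; simp [hc]
    · simp
  · intro c _ hc; simp [hc]
  · simp

end mats

theorem lemDil {Bu : Type*} {P D : Type} [CStarAlgebra Bu] [CStarAlgebra P] [CStarAlgebra D]
    [Nontrivial D] (j : Bu →⋆ₐ[ℂ] P) (hj : Function.Injective j) (m : Bu →ₗ[ℂ] D)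
    (hm : ∀ z z', star (m z) * m z' = star (m 1) * m (star z * z'))
    (R : HRep D) (hinj : Function.Injective R.π)
    (S : StarSubalgebra ℂ D) [FiniteDimensional ℂ S] (v : R.H)
    (hv : ∀ d ∈ S, R.π d v = 0 → d = 0) :
    ∃ (r : HRep P) (n : ℕ) (ξ : Fin n → r.H) (d : Fin n → D), (∀ i, d i ∈ S) ∧
      ∀ z, ∀ c ∈ S, ‖(∑ i, ∑ k, ⟪ξ i, r.π (j z) (ξ k)⟫_ℂ • (star (d i) * d k))
        - star (m 1) * m z‖ ≤ 2 * ‖star (m 1) * m z - c‖ := by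
  let _ := CStarAlgebra.spectralOrder Bu
  let _ := CStarAlgebra.spectralOrderedRing Bu
  let _ := CStarAlgebra.spectralOrder P
  let _ := CStarAlgebra.spectralOrderedRing P
  obtain ⟨n, ζ, d, hdS, hE, hT⟩ := lemE R hinj S v hv
  have hn : Nonempty (Fin n) := by
    by_contra h
    rw [not_nonempty_iff] at h
    have := hE 1 (one_mem S)
    simp at this
  obtain ⟨i0⟩ := hn
  let lam : CStarMatrix (Fin n) (Fin n) Bu →ₗ[ℂ] ℂ :=
    { toFun := fun b => ∑ i, ∑ k, ⟪ζ i, R.π (star (m 1) * m (b i k)) (ζ k)⟫_ℂ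
      map_add' := by
        intro a b
        simp only [CStarMatrix.add_apply, map_add, mul_add, add_apply, inner_add_right,
          Finset.sum_add_distrib]
      map_smul' := by
        intro c b
        simp only [CStarMatrix.smul_apply, map_smul, mul_smul_comm, smul_apply, inner_smul_right,
          Finset.mul_sum, RingHom.id_apply, smul_eq_mul] }
  have hlam : ∀ b, lam b = ∑ i, ∑ k, ⟪ζ i, R.π (star (m 1) * m (b i k)) (ζ k)⟫_ℂ := fun _ => rfl
  have hpos : ∀ Z, 0 ≤ lam (star Z * Z) := by
    intro Z
    have h1 : lam (star Z * Z) = ∑ l, ⟪∑ i, R.π (m (Z l i)) (ζ i), ∑ k, R.π (m (Z l k)) (ζ k)⟫_ℂ := by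
      rw [hlam]
      simp only [CStarMatrix.mul_apply, CStarMatrix.star_apply, map_sum, Finset.mul_sum, ← hm,
        sum_apply, inner_sum, sum_inner, map_mul, mul_apply_eq_comp]
      rw [Finset.sum_congr rfl fun i _ => Finset.sum_comm, Finset.sum_comm]
      refine Finset.sum_congr rfl fun l _ => ?_
      rw [Finset.sum_comm]
      refine Finset.sum_congr rfl fun i _ => Finset.sum_congr rfl fun k _ => ?_
      rw [map_star, ContinuousLinearMap.star_eq_adjoint, ContinuousLinearMap.adjoint_inner_right]
    rw [h1]
    refine Finset.sum_nonneg fun l _ => ?_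
    rw [inner_self_eq_norm_sq_to_K]
    have h3 : (0 : ℝ) ≤ ‖∑ i, R.π (m (Z l i)) (ζ i)‖ ^ 2 := sq_nonneg _
    have h4 := Complex.zero_le_real.mpr h3
    rw [Complex.ofReal_pow] at h4
    exact h4
  have hjM : Function.Injective (matHom n j) := CStarMatrix.map_injective hj
  obtain ⟨r0, ξ0, h0⟩ := exists_ext (matHom n j) hjM lam hpos
  let r : HRep P := ⟨r0.H, r0.π.comp (diagHom n P)⟩
  let ξ : Fin n → r0.H := fun k => r0.π (unitM i0 k 1) ξ0
  have hξ : ∀ i k z, ⟪ξ i, r0.π (diagHom n P (j z)) (ξ k)⟫_ℂ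
      = ⟪ζ i, R.π (star (m 1) * m z) (ζ k)⟫_ℂ := by
    intro i k z
    have h1 := h0 (unitM i k z)
    have h2 : r0.π (unitM i k (j z)) = star (r0.π (unitM i0 i 1)) *
        (r0.π (diagHom n P (j z)) * r0.π (unitM i0 k 1)) := by
      rw [← unitM_conj i0, map_mul, map_mul, map_star]
    rw [matHom_unitM, h2, mul_apply_eq_comp,
      ContinuousLinearMap.star_eq_adjoint, ContinuousLinearMap.adjoint_inner_right,
      mul_apply_eq_comp] at h1
    rw [← h1, hlam, Finset.sum_eq_single i, Finset.sum_eq_single k]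
    · simp [unitM_apply]
    · intro b _ hb; simp [unitM_apply, hb]
    · simp
    · intro b _ hb; simp [unitM_apply, hb]
    · simp
  refine ⟨r, n, ξ, d, hdS, fun z c hc => ?_⟩
  have h2 : ∑ i, ∑ k, ⟪ξ i, r.π (j z) (ξ k)⟫_ℂ • (star (d i) * d k)
      = ∑ i, ∑ k, ⟪ζ i, R.π (star (m 1) * m z - c) (ζ k)⟫_ℂ • (star (d i) * d k) + c := by
    conv_rhs => rhs; rw [← hE c hc]
    rw [← Finset.sum_add_distrib]
    refine Finset.sum_congr rfl fun i _ => ?_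
    rw [← Finset.sum_add_distrib]
    refine Finset.sum_congr rfl fun k _ => ?_
    rw [← add_smul]
    congr 1
    refine (hξ i k z).trans ?_
    rw [map_sub, sub_apply, inner_sub_right, sub_add_cancel]
  rw [h2, add_sub_assoc]
  refine (norm_add_le _ _).trans ?_
  rw [two_mul, norm_sub_rev c]
  gcongr
  exact (hT _).trans (NonUnitalStarAlgHom.norm_apply_le R.π _)

end part5

section part6

open Filter Topology Asymptotics

section core

theorem af_of_embedding {A : Type*} [NonUnitalCStarAlgebra A] {M : Type} [NonUnitalCStarAlgebra M]
    (L : ℕ → NonUnitalStarSubalgebra ℂ M) (hL : Monotone L)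
    (hfd : ∀ n, FiniteDimensional ℂ (L n)) (f : A →⋆ₙₐ[ℂ] M) (hf : Function.Injective f)
    (hmem : ∀ a, f a ∈ closure (⋃ n, (L n : Set M))) : IsAFEmbeddable A := by
  have hN0 : (((⨆ n, L n : NonUnitalStarSubalgebra ℂ M)) : Set M) = ⋃ n, (L n : Set M) :=
    NonUnitalStarSubalgebra.coe_iSup_of_directed hL.directed_le
  obtain ⟨N, hN⟩ : ∃ N : NonUnitalStarSubalgebra ℂ M, (N : Set M) = closure (⋃ n, (L n : Set M)) :=
    ⟨(⨆ n, L n : NonUnitalStarSubalgebra ℂ M).topologicalClosure, by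
      rw [← hN0]; rfl⟩
  have hcl : IsClosed (N : Set M) := by rw [hN]; exact isClosed_closure
  have hLN : ∀ n x, x ∈ L n → x ∈ N := by
    intro n x hx
    rw [← SetLike.mem_coe, hN]
    exact subset_closure (Set.mem_iUnion.2 ⟨n, hx⟩)
  refine ⟨{ D := N
            Dk := fun n => (L n).comap (NonUnitalStarSubalgebraClass.subtype N)
            mono := fun a b hab x hx => hL hab hx
            fd := ?_
            dense := ?_
            emb := NonUnitalStarAlgHom.codRestrict f N (fun a => by
              rw [← SetLike.mem_coe, hN]; exact hmem a)
            inj := ?_ }⟩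
  · intro k
    let g : ((L k).comap (NonUnitalStarSubalgebraClass.subtype N)) →ₗ[ℂ] L k :=
      { toFun := fun x => ⟨x.1.1, x.2⟩
        map_add' := fun _ _ => rfl
        map_smul' := fun _ _ => rfl }
    have := hfd k
    refine FiniteDimensional.of_injective g ?_
    intro x y hxy
    exact Subtype.ext (Subtype.ext (congrArg (fun z : L k => (z : M)) hxy))
  · intro x
    rw [Metric.mem_closure_iff]
    intro ε hε
    have hx : (x : M) ∈ closure (⋃ n, (L n : Set M)) := by rw [← hN]; exact x.2
    obtain ⟨y, hy, hxy⟩ := Metric.mem_closure_iff.1 hx ε hε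
    obtain ⟨n, hn⟩ := Set.mem_iUnion.1 hy
    exact ⟨⟨y, hLN n y hn⟩, Set.mem_iUnion.2 ⟨n, hn⟩, hxy⟩
  · intro a b hab
    exact hf (congrArg (fun z : N => (z : M)) hab)

noncomputable def Vseq {M : Type} [CStarAlgebra M] (U : ℕ → M) : ℕ → M
  | 0 => 1
  | n + 1 => U n * Vseq U n

theorem core {A : Type*} [NonUnitalCStarAlgebra A] {M : Type} [CStarAlgebra M]
    (L : ℕ → StarSubalgebra ℂ M) (hL : Monotone L) (hfd : ∀ n, FiniteDimensional ℂ (L n))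
    (θ : ℕ → A →ₗ[ℂ] M) (hstar : ∀ n a, θ n (star a) = star (θ n a))
    (K : ℝ) (hK : ∀ n a, ‖θ n a‖ ≤ K * ‖a‖)
    (S : Set A) (hS : Dense S)
    (hmul : ∀ a ∈ S, ∀ b ∈ S, Tendsto (fun n => θ n a * θ n b - θ n (a * b)) atTop (𝓝 0))
    (U : ℕ → M) (hU : ∀ n, U n ∈ unitary M) (hUL : ∀ n, U n ∈ L (n + 1))
    (hcomm : ∀ a ∈ S, (fun n => U n * θ n a - θ (n + 1) a * U n) =O[atTop]
      fun n => (1 / 2 : ℝ) ^ n)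
    (hdist : ∀ a ∈ S, ∃ l : ℕ → M, (∀ n, l n ∈ L n) ∧
      Tendsto (fun n => θ n a - l n) atTop (𝓝 0))
    (hinj : ∀ a, Tendsto (fun n => θ n a) atTop (𝓝 0) → a = 0) : IsAFEmbeddable A := by
  set V := Vseq U with hVdef
  have hVs : ∀ n, V (n + 1) = U n * V n := fun n => rfl
  have hV : ∀ n, V n ∈ unitary M := by
    intro n
    induction n with
    | zero => exact one_mem _
    | succ n ih => rw [hVs]; exact mul_mem (hU n) ih
  have hVL : ∀ n, V n ∈ L n := by
    intro n
    induction n with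
    | zero => exact one_mem _
    | succ n ih => rw [hVs]; exact mul_mem (hUL n) (hL (Nat.le_succ n) ih)
  have hconj : ∀ n (x : M), ‖star (V n) * x * V n‖ = ‖x‖ := by
    intro n x
    rw [CStarRing.norm_mul_mem_unitary _ (hV n),
      CStarRing.norm_mem_unitary_mul _ (Unitary.star_mem (hV n))]
  let T : ℕ → A →ₗ[ℂ] M := fun n =>
    { toFun := fun a => star (V n) * θ n a * V n
      map_add' := fun a b => by rw [map_add, mul_add, add_mul]
      map_smul' := fun c a => by simp }
  have hT : ∀ n a, T n a = star (V n) * θ n a * V n := fun n a => rfl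
  have hTn : ∀ n a, ‖T n a‖ = ‖θ n a‖ := fun n a => hconj n _
  have hTK : ∀ n a, ‖T n a‖ ≤ K * ‖a‖ := fun n a => (hTn n a).trans_le (hK n a)
  have hcS : ∀ a ∈ S, CauchySeq fun n => T n a := by
    intro a ha
    refine cauchySeq_of_summable_dist ?_
    have hs : Summable fun n : ℕ => (1 / 2 : ℝ) ^ n := summable_geometric_two
    refine summable_of_isBigO_nat hs ?_
    refine IsBigO.trans (IsBigO.of_bound 1 (Eventually.of_forall fun n => ?_)) (hcomm a ha)
    rw [one_mul, Real.norm_of_nonneg dist_nonneg, dist_comm, dist_eq_norm]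
    have e1 : T (n + 1) a - T n a =
        star (V (n + 1)) * (θ (n + 1) a * U n - U n * θ n a) * V n := by
      have hu : star (U n) * U n = 1 := Unitary.star_mul_self_of_mem (hU n)
      rw [hT, hT, hVs, star_mul]
      simp only [mul_sub, sub_mul, mul_assoc]
      rw [← mul_assoc (star (U n)) (U n), hu, one_mul]
    rw [e1, CStarRing.norm_mul_mem_unitary _ (hV n),
      CStarRing.norm_mem_unitary_mul _ (Unitary.star_mem (hV (n+1))), norm_sub_rev]
  have hc : ∀ a, CauchySeq fun n => T n a := by
    intro a
    rw [Metric.cauchySeq_iff]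
    intro ε hε
    have hK1 : 0 < |K| + 1 := by positivity
    obtain ⟨b, hb, hab⟩ := Metric.mem_closure_iff.1 (hS a) (ε / (3 * (|K| + 1))) (by positivity)
    obtain ⟨N, hN⟩ := Metric.cauchySeq_iff.1 (hcS b hb) (ε / 3) (by positivity)
    have hd : ∀ n, dist (T n a) (T n b) < ε / 3 := by
      intro n
      rw [dist_eq_norm, ← map_sub]
      rw [dist_eq_norm, lt_div_iff₀ (by positivity)] at hab
      have h1 := hTK n (a - b)
      have h2 : K * ‖a - b‖ ≤ |K| * ‖a - b‖ := by gcongr; exact le_abs_self K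
      nlinarith [norm_nonneg (a - b)]
    refine ⟨N, fun m hm n hn => ?_⟩
    have h1 := hd m
    have h2 := hd n
    rw [dist_comm] at h2
    have h3 := hN m hm n hn
    have h4 := dist_triangle4 (T m a) (T m b) (T n b) (T n a)
    linarith
  choose Θ hΘ using fun a => cauchySeq_tendsto_of_complete (hc a)
  have hΘK : ∀ a, ‖Θ a‖ ≤ K * ‖a‖ := fun a =>
    le_of_tendsto (hΘ a).norm (Eventually.of_forall fun n => hTK n a)
  let Θl : A →ₗ[ℂ] M :=
    { toFun := Θ
      map_add' := fun a b => tendsto_nhds_unique (hΘ (a + b)) (by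
        simpa only [map_add] using (hΘ a).add (hΘ b))
      map_smul' := fun c a => tendsto_nhds_unique (hΘ (c • a)) (by
        simpa only [map_smul, RingHom.id_apply] using (hΘ a).const_smul c) }
  have hΘc : Continuous Θ := (Θl.mkContinuous K hΘK).continuous
  have hmulS : ∀ a ∈ S, ∀ b ∈ S, Θ (a * b) = Θ a * Θ b := by
    intro a ha b hb
    have h1 := (hΘ a).mul (hΘ b)
    have h2 : Tendsto (fun n => T n a * T n b - T n (a * b)) atTop (𝓝 0) := by
      rw [tendsto_zero_iff_norm_tendsto_zero]
      have := (hmul a ha b hb).norm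
      rw [norm_zero] at this
      refine this.congr fun n => ?_
      rw [← hconj n]
      congr 1
      have hv : V n * star (V n) = 1 := Unitary.mul_star_self_of_mem (hV n)
      simp only [hT, mul_sub, sub_mul]
      congr 1
      simp only [mul_assoc]
      rw [← mul_assoc (V n) (star (V n)), hv, one_mul]
    have h3 := h1.sub (hΘ (a * b))
    exact (sub_eq_zero.1 (tendsto_nhds_unique h3 h2)).symm
  have hmul2 : ∀ b ∈ S, ∀ a, Θ (a * b) = Θ a * Θ b := by
    intro b hb a
    have : (fun a => Θ (a * b)) = fun a => Θ a * Θ b :=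
      Continuous.ext_on hS (by fun_prop) (by fun_prop) (fun a ha => hmulS a ha b hb)
    exact congrFun this a
  have hmul3 : ∀ a b, Θ (a * b) = Θ a * Θ b := by
    intro a b
    have : (fun b => Θ (a * b)) = fun b => Θ a * Θ b :=
      Continuous.ext_on hS (by fun_prop) (by fun_prop) (fun b hb => hmul2 b hb a)
    exact congrFun this b
  let F : A →⋆ₙₐ[ℂ] M :=
    { toFun := Θ
      map_smul' := Θl.map_smul'
      map_zero' := Θl.map_zero
      map_add' := Θl.map_add'
      map_mul' := hmul3
      map_star' := fun a => tendsto_nhds_unique (hΘ (star a)) (by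
        have := (hΘ a).star
        refine this.congr fun n => ?_
        simp only [hT, hstar, star_mul, star_star, mul_assoc]) }
  refine af_of_embedding (fun n => (L n).toNonUnitalStarSubalgebra) (fun a b h x hx => hL h hx)
    hfd F ?_ ?_
  · rw [injective_iff_map_eq_zero]
    intro a ha
    refine hinj a ?_
    rw [tendsto_zero_iff_norm_tendsto_zero]
    have h1 := (hΘ a).norm
    have h2 : Θ a = 0 := ha
    rw [h2, norm_zero] at h1
    exact h1.congr fun n => hTn n a
  · have hcl : IsClosed {a | Θ a ∈ closure (⋃ n, (L n : Set M))} :=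
      isClosed_closure.preimage hΘc
    have hsub : S ⊆ {a | Θ a ∈ closure (⋃ n, (L n : Set M))} := by
      intro a ha
      obtain ⟨l, hl, hlim⟩ := hdist a ha
      have h1 : Tendsto (fun n => star (V n) * l n * V n) atTop (𝓝 (Θ a)) := by
        have h2 : Tendsto (fun n => T n a - star (V n) * l n * V n) atTop (𝓝 0) := by
          rw [tendsto_zero_iff_norm_tendsto_zero]
          have := hlim.norm
          rw [norm_zero] at this
          refine this.congr fun n => ?_
          rw [← hconj n, hT, mul_sub, sub_mul]
        simpa using (hΘ a).sub h2
      refine mem_closure_of_tendsto h1 (Eventually.of_forall fun n => ?_)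
      exact Set.mem_iUnion.2 ⟨n, mul_mem (mul_mem (star_mem (hVL n)) (hl n)) (hVL n)⟩
    intro a
    have : a ∈ closure S := hS a
    exact (closure_minimal hsub hcl) this

end core

end part6

section part7

open scoped InnerProductSpace TensorProduct
open InnerProductSpace

section asm

section TK
variable {H : Type*} [NormedAddCommGroup H] [InnerProductSpace ℂ H] [CompleteSpace H]

theorem star_ro (x y : H) : star (rankOne ℂ x y) = rankOne ℂ y x := by
  rw [ContinuousLinearMap.star_eq_adjoint, adjoint_rankOne]

theorem mul_ro (T : H →L[ℂ] H) (x y : H) : T * rankOne ℂ x y = rankOne ℂ (T x) y := by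
  ext z; simp

theorem ro_mul_ro (x y z w : H) : rankOne ℂ x y * rankOne ℂ z w = ⟪y, z⟫_ℂ • rankOne ℂ x w := by
  rw [mul_ro]; ext u; simp [smul_smul, mul_comm]

def TK (K : Submodule ℂ H) : Submodule ℂ (H →L[ℂ] H) where
  carrier := {T | (∀ h, T h ∈ K) ∧ ∀ h, star T h ∈ K}
  add_mem' := by
    rintro a b ⟨h1, h2⟩ ⟨h3, h4⟩
    exact ⟨fun h => by simpa using K.add_mem (h1 h) (h3 h), fun h => by
      simpa using K.add_mem (h2 h) (h4 h)⟩
  zero_mem' := ⟨fun h => by simp, fun h => by simp⟩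
  smul_mem' := by
    rintro c a ⟨h1, h2⟩
    exact ⟨fun h => by simpa using K.smul_mem _ (h1 h), fun h => by
      simpa using K.smul_mem _ (h2 h)⟩

theorem TK_fd (K : Submodule ℂ H) [FiniteDimensional ℂ K] : FiniteDimensional ℂ (TK K) := by
  let g : TK K →ₗ[ℂ] (K →ₗ[ℂ] K) :=
    { toFun := fun T =>
        { toFun := fun k => ⟨T.1 k, T.2.1 _⟩
          map_add' := fun a b => Subtype.ext (by simp)
          map_smul' := fun a b => Subtype.ext (by simp) }
      map_add' := fun a b => by ext; simp
      map_smul' := fun a b => by ext; simp }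
  refine FiniteDimensional.of_injective g ?_
  rw [injective_iff_map_eq_zero]
  intro T hT
  have h0 : ∀ k ∈ K, T.1 k = 0 := fun k hk =>
    congrArg Subtype.val (LinearMap.congr_fun hT ⟨k, hk⟩)
  have h1 : ∀ k ∈ Kᗮ, T.1 k = 0 := by
    intro k hk
    have : ⟪T.1 k, T.1 k⟫_ℂ = 0 := by
      rw [← ContinuousLinearMap.adjoint_inner_right, ← ContinuousLinearMap.star_eq_adjoint]
      exact (Submodule.mem_orthogonal' K k).1 hk _ (T.2.2 _)
    exact inner_self_eq_zero.1 this
  refine Subtype.ext (ContinuousLinearMap.ext fun h => ?_)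
  obtain ⟨a, ha, b, hb, rfl⟩ := K.exists_add_mem_mem_orthogonal h
  simp [h0 a ha, h1 b hb]

theorem TK_mono {K K' : Submodule ℂ H} (h : K ≤ K') : TK K ≤ TK K' :=
  fun _ hT => ⟨fun x => h (hT.1 x), fun x => h (hT.2 x)⟩

theorem TK_star {K : Submodule ℂ H} {T} (h : T ∈ TK K) : star T ∈ TK K :=
  ⟨h.2, fun x => by rw [star_star]; exact h.1 x⟩

theorem TK_mul_left {K : Submodule ℂ H} {T S : H →L[ℂ] H} (h : T ∈ TK K)
    (hS : ∀ x ∈ K, S x ∈ K) : S * T ∈ TK K :=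
  ⟨fun x => hS _ (h.1 x), fun x => by rw [star_mul]; exact h.2 _⟩

theorem TK_mul_right {K : Submodule ℂ H} {T S : H →L[ℂ] H} (h : T ∈ TK K)
    (hS : ∀ x ∈ K, star S x ∈ K) : T * S ∈ TK K := by
  have := TK_star (TK_mul_left (TK_star h) hS)
  rwa [star_mul, star_star, star_star] at this

theorem TK_ro {K : Submodule ℂ H} {x y : H} (hx : x ∈ K) (hy : y ∈ K) : rankOne ℂ x y ∈ TK K :=
  ⟨fun h => by simpa using K.smul_mem _ hx, fun h => by
    rw [star_ro]; simpa using K.smul_mem _ hy⟩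
end TK

def LAlg {M : Type*} [CStarAlgebra M] (C : Submodule ℂ M) (Q : StarSubalgebra ℂ M)
    (hC : ∀ a ∈ C, ∀ b ∈ C, a * b ∈ C) (hs : ∀ a ∈ C, star a ∈ C)
    (hl : ∀ q ∈ Q, ∀ a ∈ C, q * a ∈ C) (hr : ∀ q ∈ Q, ∀ a ∈ C, a * q ∈ C) :
    StarSubalgebra ℂ M where
  carrier := {x | x ∈ C ⊔ Subalgebra.toSubmodule Q.toSubalgebra}
  mul_mem' := by
    intro x y hx hy
    obtain ⟨a, ha, p, hp, rfl⟩ := Submodule.mem_sup.1 hx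
    obtain ⟨b, hb, q, hq, rfl⟩ := Submodule.mem_sup.1 hy
    refine Submodule.mem_sup.2 ⟨a * b + a * q + p * b, ?_, p * q, mul_mem (S := StarSubalgebra ℂ M)
      (s := Q) hp hq, by noncomm_ring⟩
    exact add_mem (add_mem (hC _ ha _ hb) (hr _ hq _ ha)) (hl _ hp _ hb)
  add_mem' := fun hx hy => Submodule.add_mem (C ⊔ Subalgebra.toSubmodule Q.toSubalgebra) hx hy
  algebraMap_mem' := fun c => Submodule.mem_sup_right (Q.algebraMap_mem' c)
  star_mem' := by
    intro x hx
    obtain ⟨a, ha, p, hp, rfl⟩ := Submodule.mem_sup.1 hx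
    exact Submodule.mem_sup.2 ⟨star a, hs a ha, star p, Q.star_mem' hp, (star_add _ _).symm⟩

theorem exists_asm {P D : Type} [CStarAlgebra P] [CStarAlgebra D] [Nontrivial D] [Nontrivial P]
    (Dk : ℕ → StarSubalgebra ℂ D) (hDm : Monotone Dk) (hDf : ∀ k, FiniteDimensional ℂ (Dk k))
    (F : ℕ → StarSubalgebra ℂ P) (hFm : Monotone F) (hFf : ∀ k, FiniteDimensional ℂ (F k))
    (r : ℕ → HRep P) (N : ℕ → ℕ) (ξ : ∀ n, Fin (N n) → (r n).H) (d : ∀ n, Fin (N n) → D)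
    (hd : ∀ n, ∃ k, ∀ i, d n i ∈ Dk k) (c : ℕ → D) (hc : ∀ n, ∃ k, c n ∈ Dk k) :
    ∃ (M : Type) (_ : CStarAlgebra M) (β : D →⋆ₐ[ℂ] M) (π : P →⋆ₐ[ℂ] M) (e : M) (w : ℕ → M)
      (L : ℕ → StarSubalgebra ℂ M),
      star e = e ∧ (∀ x, β x * e = e * β x) ∧ (∀ x, e * β x = 0 → x = 0) ∧
      (∀ n, w n * e = w n) ∧ (∀ n m, n ≠ m → star (w n) * w m = 0) ∧
      (∀ n p, star (w n) * π p * w n =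
        e * β (∑ i, ∑ k, ⟪ξ n i, (r n).π p (ξ n k)⟫_ℂ • (star (d n i) * d n k))) ∧
      Monotone L ∧ (∀ n, FiniteDimensional ℂ (L n)) ∧
      (∀ n, ∀ x ∈ Dk n, ∀ p ∈ F n, w n * β x * star (w n) + π p ∈ L n) ∧
      (∀ n, w n * β (c n) * star (w (n + 1)) ∈ L (n + 1)) ∧
      (∀ n T p, ‖p‖ ≤ ‖w n * T * star (w n) + π p‖) := by
  classical
  obtain ⟨R, hR⟩ := exists_faithful D
  obtain ⟨R0, hR0⟩ := exists_faithful P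
  have nz : ∀ {Q : Type} [CStarAlgebra Q] [Nontrivial Q] (R : HRep Q)
      (h : ∀ V : Submodule ℂ Q, FiniteDimensional ℂ V → ∃ v : R.H, ∀ d ∈ V, R.π d v = 0 → d = 0),
      (∃ v : R.H, ‖v‖ = 1) ∧ Function.Injective R.π := by
    intro Q _ _ R h
    constructor
    · obtain ⟨v, hv⟩ := h (ℂ ∙ (1 : Q)) inferInstance
      have hv0 : v ≠ 0 := by
        rintro rfl
        exact one_ne_zero (hv 1 (Submodule.mem_span_singleton_self _) (map_zero _))
      exact ⟨(‖v‖⁻¹ : ℂ) • v, norm_smul_inv_norm hv0⟩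
    · rw [injective_iff_map_eq_zero]
      intro a ha
      obtain ⟨v, hv⟩ := h (ℂ ∙ a) inferInstance
      exact hv a (Submodule.mem_span_singleton_self _) (by rw [ha]; rfl)
  obtain ⟨⟨k0, hk0⟩, hRi⟩ := nz R hR
  obtain ⟨⟨x0, hx0⟩, hR0i⟩ := nz R0 hR0
  obtain ⟨G, J, hJ, hJo⟩ := rep_directSum (fun o : Option ℕ => o.elim R0 r)
  let J0 : R0.H →ₗᵢ[ℂ] G.H := J none
  let Jn : ∀ n, (r n).H →ₗᵢ[ℂ] G.H := fun n => J (some n)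
  have hJ0 : ∀ q x, G.π q (J0 x) = J0 (R0.π q x) := hJ none
  have hJn : ∀ n q x, G.π q (Jn n x) = Jn n ((r n).π q x) := fun n => hJ (some n)
  have hJ0n : ∀ n x y, ⟪Jn n x, J0 y⟫_ℂ = 0 := fun n x y => hJo (some n) none x y (by simp)
  have hJnn : ∀ n m x y, n ≠ m → ⟪Jn n x, Jn m y⟫_ℂ = 0 := fun n m x y h =>
    hJo (some n) (some m) x y (by simpa using h)
  clear_value J0 Jn
  let xi0 : G.H := J0 x0
  have hxi0 : ⟪xi0, xi0⟫_ℂ = 1 := by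
    rw [inner_self_eq_norm_sq_to_K, LinearIsometry.norm_map, hx0]; simp
  obtain ⟨M, _, a, β, hβa, hea, han⟩ : ∃ (M : Type) (_ : CStarAlgebra M)
      (a : (G.H →L[ℂ] G.H) →⋆ₐ[ℂ] M) (β : D →⋆ₐ[ℂ] M), (∀ x T, β x * a T = a T * β x) ∧
      (∀ x, a (rankOne ℂ xi0 xi0) * β x = 0 → x = 0) ∧ (∀ T, ‖a T‖ = ‖T‖) := by
    refine ⟨HTen G.H R.H →L[ℂ] HTen G.H R.H, inferInstance, alphaT G.H R.H,
      (betaT G.H R.H).comp R.π, fun x T => (alpha_beta_comm T _).symm, ?_, ?_⟩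
    · intro x hx
      refine (injective_iff_map_eq_zero _).1 hRi x ?_
      ext k
      have h1 : (alphaT G.H R.H (rankOne ℂ xi0 xi0) * betaT G.H R.H (R.π x)) (tn xi0 k) = 0 := by
        change (alphaT G.H R.H (rankOne ℂ xi0 xi0) * ((betaT G.H R.H).comp R.π) x) (tn xi0 k) = 0
        rw [hx]; rfl
      rw [mul_apply_eq_comp, betaT_tn, alphaT_tn, rankOne_apply, hxi0, one_smul,
        ← norm_eq_zero, tn_norm] at h1
      have h3 : ‖xi0‖ = 1 := by simp only [xi0, LinearIsometry.norm_map, hx0]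
      rw [h3, one_mul, norm_eq_zero] at h1
      exact h1
    · intro T
      refine NonUnitalStarAlgHom.norm_map (A := G.H →L[ℂ] G.H)
        (B := HTen G.H R.H →L[ℂ] HTen G.H R.H) (alphaT G.H R.H) ?_ T
      rw [injective_iff_map_eq_zero]
      intro T hT
      ext h
      have h1 : alphaT G.H R.H T (tn h k0) = 0 := by rw [hT]; rfl
      rw [alphaT_tn, ← norm_eq_zero, tn_norm, hk0, mul_one, norm_eq_zero] at h1
      exact h1
  let π : P →⋆ₐ[ℂ] M := a.comp G.π
  let e : M := a (rankOne ℂ xi0 xi0)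
  let w : ℕ → M := fun n => ∑ i, a (rankOne ℂ (Jn n (ξ n i)) xi0) * β (d n i)
  have hws : ∀ n, star (w n) = ∑ i, a (rankOne ℂ xi0 (Jn n (ξ n i))) * β (star (d n i)) := by
    intro n
    simp only [w, star_sum, star_mul, ← map_star, star_ro, hβa]
  have hwTw : ∀ n m (T : G.H →L[ℂ] G.H), star (w n) * a T * w m = e * β (∑ i, ∑ k,
      ⟪Jn n (ξ n i), T (Jn m (ξ m k))⟫_ℂ • (star (d n i) * d m k)) := by
    intro n m T
    rw [hws]
    simp only [w, Finset.sum_mul, Finset.mul_sum, map_sum]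
    rw [Finset.sum_comm]
    refine Finset.sum_congr rfl fun i _ => Finset.sum_congr rfl fun k _ => ?_
    have e1 : rankOne ℂ xi0 (Jn n (ξ n i)) * (T * rankOne ℂ (Jn m (ξ m k)) xi0) =
        ⟪Jn n (ξ n i), T (Jn m (ξ m k))⟫_ℂ • rankOne ℂ xi0 xi0 := by
      rw [mul_ro, ro_mul_ro]
    calc _ = a (rankOne ℂ xi0 (Jn n (ξ n i))) * (β (star (d n i)) * a (T * rankOne ℂ (Jn m (ξ m k)) xi0)) * β (d m k) := by
          rw [map_mul]; simp only [mul_assoc]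
      _ = a (rankOne ℂ xi0 (Jn n (ξ n i)) * (T * rankOne ℂ (Jn m (ξ m k)) xi0)) * (β (star (d n i)) * β (d m k)) := by
          rw [hβa, map_mul a (rankOne ℂ xi0 _)]; simp only [mul_assoc]
      _ = _ := by
          rw [e1, map_smul, map_smul, map_mul, smul_mul_assoc, mul_smul_comm]
  -- the finite-dimensional algebras
  choose kd hkd using hd
  choose kc hkc using hc
  let kk : ℕ → ℕ := fun n => n + ∑ i ∈ Finset.range (n + 1), (kd i + kc i)
  have hkk : Monotone kk := by
    intro n m h
    refine add_le_add h (Finset.sum_le_sum_of_subset ?_)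
    intro i; simp only [Finset.mem_range]; omega
  have hkkn : ∀ n, n ≤ kk n := fun n => Nat.le_add_right _ _
  have hkkd : ∀ n, kd n + kc n ≤ kk n := fun n => by
    have : kd n + kc n ≤ ∑ i ∈ Finset.range (n + 1), (kd i + kc i) :=
      Finset.single_le_sum (f := fun i => kd i + kc i) (fun _ _ => Nat.zero_le _)
        (Finset.self_mem_range_succ n)
    exact this.trans (Nat.le_add_left _ _)
  let Xi : ℕ → Set G.H := fun n => {xi0} ∪ ⋃ m ∈ Finset.range (n + 1), Set.range fun i => Jn m (ξ m i)
  have hXif : ∀ n, (Xi n).Finite := fun n =>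
    (Set.finite_singleton _).union ((Finset.finite_toSet _).biUnion fun m _ => Set.finite_range _)
  have hXim : Monotone Xi := by
    intro n m h
    refine Set.union_subset_union_right _ (Set.biUnion_subset_biUnion_left ?_)
    intro i; simp only [Finset.mem_range, SetLike.mem_coe]; omega
  let ev : P →ₗ[ℂ] G.H →ₗ[ℂ] G.H :=
    { toFun := fun p => (G.π p).toLinearMap
      map_add' := fun p q => by rw [map_add]; rfl
      map_smul' := fun p q => by rw [map_smul]; rfl }
  let Kn : ℕ → Submodule ℂ G.H := fun n =>
    Submodule.map₂ ev (Subalgebra.toSubmodule (F n).toSubalgebra) (Submodule.span ℂ (Xi n))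
  have hKf : ∀ n, FiniteDimensional ℂ (Kn n) := by
    intro n
    have := hFf n
    refine Module.Finite.iff_fg.2 ?_
    refine Submodule.FG.map₂ _ ?_ (Submodule.fg_span (hXif n))
    exact Module.Finite.iff_fg.1 (hFf n)
  have hKm : Monotone Kn := fun n m h =>
    Submodule.map₂_le_map₂ (fun x hx => hFm h hx) (Submodule.span_mono (hXim h))
  have hKi : ∀ n, ∀ p ∈ F n, ∀ x ∈ Kn n, G.π p x ∈ Kn n := by
    intro n p hp
    have : Kn n ≤ (Kn n).comap (G.π p).toLinearMap := by
      refine Submodule.map₂_le.2 fun q hq x hx => ?_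
      have h1 : G.π p (G.π q x) = ev (p * q) x := by
        change _ = G.π (p * q) x
        rw [map_mul]; rfl
      change G.π p (G.π q x) ∈ Kn n
      rw [h1]
      exact Submodule.apply_mem_map₂ _ (mul_mem (S := StarSubalgebra ℂ P) (s := F n) hp hq) hx
    exact this
  have hXK : ∀ n, ∀ x ∈ Xi n, x ∈ Kn n := by
    intro n x hx
    have h1 : x = ev 1 x := by change x = G.π 1 x; rw [map_one]; rfl
    rw [h1]
    exact Submodule.apply_mem_map₂ _ (one_mem (F n)) (Submodule.subset_span hx)
  let C : ℕ → Submodule ℂ M := fun n =>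
    (TK (Kn n)).map a.toAlgHom.toLinearMap *
      (Subalgebra.toSubmodule (Dk (kk n)).toSubalgebra).map β.toAlgHom.toLinearMap
  have hCmem : ∀ n T x, T ∈ TK (Kn n) → x ∈ Dk (kk n) → a T * β x ∈ C n := fun n T x hT hx =>
    Submodule.mul_mem_mul (Submodule.mem_map_of_mem hT) (Submodule.mem_map_of_mem (p :=
      Subalgebra.toSubmodule (Dk (kk n)).toSubalgebra) hx)
  have hCind : ∀ n (Y : Submodule ℂ M), (∀ T x, T ∈ TK (Kn n) → x ∈ Dk (kk n) → a T * β x ∈ Y) →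
      C n ≤ Y := by
    intro n Y h
    refine Submodule.mul_le.2 ?_
    rintro _ ⟨T, hT, rfl⟩ _ ⟨x, hx, rfl⟩
    exact h T x hT hx
  have hCf : ∀ n, FiniteDimensional ℂ (C n) := by
    intro n
    have h1 := TK_fd (Kn n)
    refine Module.Finite.iff_fg.2 (Submodule.FG.mul ?_ ?_)
    · exact Submodule.FG.map _ (Module.Finite.iff_fg.1 h1)
    · exact Submodule.FG.map _ (Module.Finite.iff_fg.1 (hDf (kk n)))
  have hCm : Monotone C := fun n m h => hCind n _ fun T x hT hx =>
    hCmem m T x (TK_mono (hKm h) hT) (hDm (hkk h) hx)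
  have hCmulr : ∀ n T x, T ∈ TK (Kn n) → x ∈ Dk (kk n) → ∀ y ∈ C n, y * (a T * β x) ∈ C n := by
    intro n T x hT hx
    refine hCind n ((C n).comap (LinearMap.mulRight ℂ (a T * β x))) fun S z hS hz => ?_
    change a S * β z * (a T * β x) ∈ C n
    have : a S * β z * (a T * β x) = a (S * T) * β (z * x) := by
      rw [mul_assoc, ← mul_assoc (β z), hβa, map_mul, map_mul]; simp only [mul_assoc]
    rw [this]
    exact hCmem n _ _ (TK_mul_left hT fun x _ => hS.1 x) (mul_mem hz hx)
  have hCmul : ∀ n, ∀ y ∈ C n, ∀ z ∈ C n, y * z ∈ C n := by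
    intro n y hy
    exact hCind n ((C n).comap (LinearMap.mulLeft ℂ y)) fun T x hT hx => hCmulr n T x hT hx y hy
  have hCs : ∀ n, ∀ y ∈ C n, star y ∈ C n := by
    intro n y hy
    refine Submodule.mul_induction_on (C := fun y => star y ∈ C n) hy ?_ ?_
    · rintro _ ⟨T, hT, rfl⟩ _ ⟨x, hx, rfl⟩
      change star (a T * β x) ∈ C n
      rw [star_mul, ← map_star, ← map_star, hβa]
      exact hCmem n _ _ (TK_star hT) (star_mem hx)
    · intro x y hx hy
      rw [star_add]; exact add_mem hx hy
  have hCl : ∀ n, ∀ q ∈ (F n).map π, ∀ y ∈ C n, q * y ∈ C n := by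
    rintro n q ⟨p, hp, rfl⟩
    refine hCind n ((C n).comap (LinearMap.mulLeft ℂ (π p))) fun T x hT hx => ?_
    change a (G.π p) * (a T * β x) ∈ C n
    rw [← mul_assoc, ← map_mul]
    exact hCmem n _ _ (TK_mul_left hT (hKi n p hp)) hx
  have hCr : ∀ n, ∀ q ∈ (F n).map π, ∀ y ∈ C n, y * q ∈ C n := by
    intro n q hq y hy
    have := hCs n _ (hCl n (star q) (star_mem hq) (star y) (hCs n y hy))
    rwa [star_mul, star_star, star_star] at this
  have hCβ : ∀ n, ∀ z ∈ Dk (kk n), ∀ y ∈ C n, y * β z ∈ C n := by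
    intro n z hz
    refine hCind n ((C n).comap (LinearMap.mulRight ℂ (β z))) fun T x hT hx => ?_
    change a T * β x * β z ∈ C n
    rw [mul_assoc, ← map_mul]
    exact hCmem n _ _ hT (mul_mem hx hz)
  have hwC : ∀ n, w n ∈ C n := by
    intro n
    refine Submodule.sum_mem _ fun i _ => hCmem n _ _ (TK_ro (hXK n _ ?_) (hXK n _ ?_)) ?_
    · exact Or.inr (Set.mem_biUnion (Finset.self_mem_range_succ n) ⟨i, rfl⟩)
    · exact Or.inl rfl
    · exact hDm ((Nat.le_add_right _ _).trans (hkkd n)) (hkd n i)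
  let L : ℕ → StarSubalgebra ℂ M := fun n => LAlg (C n) ((F n).map π) (hCmul n) (hCs n) (hCl n) (hCr n)
  have hLmem : ∀ n x, x ∈ L n ↔ x ∈ C n ⊔ Subalgebra.toSubmodule ((F n).map π).toSubalgebra :=
    fun n x => Iff.rfl
  refine ⟨M, inferInstance, β, π, e, w, L, ?_, ?_, ?_, ?_, ?_, ?_, ?_, ?_, ?_, ?_, ?_⟩
  · rw [← map_star, star_ro]
  · intro x; exact hβa x _
  · exact hea
  · intro n
    simp only [w, Finset.sum_mul]
    refine Finset.sum_congr rfl fun i _ => ?_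
    rw [mul_assoc, hβa, ← mul_assoc, ← map_mul, ro_mul_ro, hxi0, one_smul]
  · intro n m h
    have := hwTw n m 1
    rw [map_one, mul_one] at this
    rw [this]
    simp [hJnn n m _ _ h]
  · intro n p
    refine (hwTw n n (G.π p)).trans ?_
    simp only [hJn, LinearIsometry.inner_map_map]
  · intro n m h x hx
    rw [hLmem] at hx ⊢
    refine (sup_le_sup (hCm h) ?_) hx
    rintro _ ⟨p, hp, rfl⟩
    exact ⟨p, hFm h hp, rfl⟩
  · intro n
    have h1 := hCf n
    have h2 : FiniteDimensional ℂ (Subalgebra.toSubmodule ((F n).map π).toSubalgebra) := by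
      refine Module.Finite.iff_fg.2 ?_
      exact Submodule.FG.map π.toAlgHom.toLinearMap (N := Subalgebra.toSubmodule (F n).toSubalgebra) (Module.Finite.iff_fg.1 (hFf n))
    exact Submodule.finiteDimensional_sup (C n) (Subalgebra.toSubmodule ((F n).map π).toSubalgebra)
  · intro n x hx p hp
    rw [hLmem]
    refine Submodule.mem_sup.2 ⟨_, ?_, _, ⟨p, hp, rfl⟩, rfl⟩
    exact hCmul n _ (hCβ n _ (hDm (hkkn n) hx) _ (hwC n)) _ (hCs n _ (hwC n))
  · intro n
    rw [hLmem]
    refine Submodule.mem_sup_left ?_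
    refine hCmul _ _ (hCm (Nat.le_succ n) (hCβ n _ ?_ _ (hwC n))) _ (hCs _ _ (hwC _))
    exact hDm ((Nat.le_add_left _ _).trans (hkkd n)) (hkc n)
  · intro n T p
    have hn : ‖R0.π p‖ = ‖p‖ := NonUnitalStarAlgHom.norm_map R0.π hR0i p
    rw [← hn]
    refine ContinuousLinearMap.opNorm_le_bound _ (norm_nonneg _) fun h => ?_
    by_cases hh : h = 0
    · simp [hh]
    have h1 : (w n * T * star (w n) + π p) * a (rankOne ℂ (J0 h) (J0 h)) =
        a (rankOne ℂ (J0 (R0.π p h)) (J0 h)) := by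
      have h2 : star (w n) * a (rankOne ℂ (J0 h) (J0 h)) = 0 := by
        rw [hws, Finset.sum_mul]
        refine Finset.sum_eq_zero fun i _ => ?_
        rw [mul_assoc, hβa, ← mul_assoc, ← map_mul, ro_mul_ro, hJ0n, zero_smul, map_zero, zero_mul]
      rw [add_mul, mul_assoc, h2, mul_zero, zero_add]
      change a (G.π p) * _ = _
      rw [← map_mul, mul_ro, hJ0]
    have h3 := norm_mul_le (w n * T * star (w n) + π p) (a (rankOne ℂ (J0 h) (J0 h)))
    rw [h1, han, han, norm_rankOne, norm_rankOne, LinearIsometry.norm_map,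
      LinearIsometry.norm_map, ← mul_assoc] at h3
    exact le_of_mul_le_mul_right h3 (norm_pos_iff.2 hh)

end asm

end part7

section part8

open Filter Topology Asymptotics

section calc8

def Sm {E : Type*} [NormedRing E] (r : ℝ) (f : ℕ → E) : Prop := f =O[atTop] fun n => r ^ n
def Bd {E : Type*} [NormedRing E] (f : ℕ → E) : Prop := f =O[atTop] fun _ => (1 : ℝ)
/-- asymptotic equality at rate `r ^ n` -/
def AE {E : Type*} [NormedRing E] (r : ℝ) (f g : ℕ → E) : Prop := Sm r (f - g)

variable {E E' : Type*} [NormedRing E] [NormedRing E'] {r : ℝ} {f g h k : ℕ → E}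

theorem Sm.add (hf : Sm r f) (hg : Sm r g) : Sm r (f + g) := IsBigO.add hf hg
theorem Sm.sub (hf : Sm r f) (hg : Sm r g) : Sm r (f - g) := IsBigO.sub hf hg
theorem Sm.neg (hf : Sm r f) : Sm r (-f) := IsBigO.neg_left hf
theorem Sm.zero : Sm r (0 : ℕ → E) := isBigO_zero _ _
theorem Sm.mul_bd (hf : Sm r f) (hg : Bd g) : Sm r (f * g) := by
  have := IsBigO.mul hf hg; simp only [mul_one] at this; exact this
theorem Sm.bd_mul (hf : Sm r f) (hg : Bd g) : Sm r (g * f) := by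
  have := IsBigO.mul hg hf; simp only [one_mul] at this; exact this
theorem Bd.mul (hf : Bd f) (hg : Bd g) : Bd (f * g) := by
  have := IsBigO.mul hf hg; simp only [one_mul] at this; exact this
theorem Bd.add (hf : Bd f) (hg : Bd g) : Bd (f + g) := IsBigO.add hf hg
theorem Bd.sub (hf : Bd f) (hg : Bd g) : Bd (f - g) := IsBigO.sub hf hg
theorem Bd.const (x : E) : Bd (fun _ => x) := isBigO_const_const x one_ne_zero _
theorem Bd.of_le (C : ℝ) (hf : ∀ n, ‖f n‖ ≤ C) : Bd f :=
  IsBigO.of_bound C (Eventually.of_forall fun n => by simpa using hf n)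
theorem Sm.bd (h0 : 0 ≤ r) (h1 : r ≤ 1) (hf : Sm r f) : Bd f :=
  hf.trans (IsBigO.of_bound 1 (Eventually.of_forall fun n => by
    simpa [abs_of_nonneg h0] using pow_le_one₀ h0 h1))
theorem Sm.str [StarRing E] [NormedStarGroup E] (hf : Sm r f) : Sm r (star f) := by
  refine IsBigO.trans (IsBigO.of_norm_left ?_) hf
  simpa only [Pi.star_apply, norm_star] using (isBigO_refl f atTop).norm_left
theorem Bd.str [StarRing E] [NormedStarGroup E] (hf : Bd f) : Bd (star f) := by
  refine IsBigO.trans (IsBigO.of_norm_left ?_) hf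
  simpa only [Pi.star_apply, norm_star] using (isBigO_refl f atTop).norm_left
theorem Sm.shift (hf : Sm r f) : Sm r (fun n => f (n + 1)) := by
  have h1 := hf.comp_tendsto (tendsto_add_atTop_nat 1)
  refine h1.trans (IsBigO.of_bound |r| (Eventually.of_forall fun n => ?_))
  simp [pow_succ, mul_comm]
theorem Bd.shift (hf : Bd f) : Bd (fun n => f (n + 1)) :=
  hf.comp_tendsto (tendsto_add_atTop_nat 1)
theorem Sm.mono (hf : Sm (1 / 4) f) : Sm (1 / 2) f := by
  refine IsBigO.trans hf (IsBigO.of_bound 1 (Eventually.of_forall fun n => ?_))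
  rw [one_mul, Real.norm_of_nonneg (by positivity), Real.norm_of_nonneg (by positivity)]
  gcongr; norm_num
theorem Sm.tendsto (hf : Sm (1 / 2) f) : Tendsto f atTop (𝓝 0) :=
  IsBigO.trans_tendsto hf (tendsto_pow_atTop_nhds_zero_of_lt_one (by norm_num) (by norm_num))
theorem Sm.of_le (C : ℝ) (hf : ∀ᶠ n in atTop, ‖f n‖ ≤ C * r ^ n) (h0 : 0 ≤ r) : Sm r f :=
  IsBigO.of_bound C (hf.mono fun n hn => by rwa [Real.norm_of_nonneg (by positivity)])
theorem Sm.norm_le {f' : ℕ → E'} (hf : Sm r f) (hn : ∀ n, ‖f' n‖ ≤ ‖f n‖) : Sm r f' :=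
  IsBigO.trans (IsBigO.of_bound 1 (Eventually.of_forall fun n => by simpa using hn n)) hf
theorem Bd.norm_le {f' : ℕ → E'} (hf : Bd f) (hn : ∀ n, ‖f' n‖ ≤ ‖f n‖) : Bd f' :=
  IsBigO.trans (IsBigO.of_bound 1 (Eventually.of_forall fun n => by simpa using hn n)) hf
theorem Bd.of_star_mul [StarRing E] [CStarRing E] (hf : Bd (star f * f)) : Bd f := by
  obtain ⟨C, hC⟩ := hf.bound
  refine IsBigO.of_bound (|C| + 1) (hC.mono fun n hn => ?_)
  simp only [Pi.mul_apply, Pi.star_apply, CStarRing.norm_star_mul_self, norm_one, mul_one] at hn ⊢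
  have := le_abs_self C
  nlinarith [norm_nonneg (f n), abs_nonneg C]
theorem Sm.of_star_mul [StarRing E] [CStarRing E] (hf : Sm (1 / 4) (star f * f)) : Sm (1 / 2) f := by
  obtain ⟨C, hC⟩ := hf.bound
  refine IsBigO.of_bound (|C| + 1) (hC.mono fun n hn => ?_)
  simp only [Pi.mul_apply, Pi.star_apply, CStarRing.norm_star_mul_self] at hn ⊢
  have h4 : ((1 / 4 : ℝ)) ^ n = ((1 / 2 : ℝ) ^ n) * ((1 / 2 : ℝ) ^ n) := by
    rw [← mul_pow]; norm_num
  have hp : 0 < (1 / 2 : ℝ) ^ n := by positivity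
  rw [Real.norm_of_nonneg (by positivity), h4] at hn
  rw [Real.norm_of_nonneg hp.le]
  set t := (1 / 2 : ℝ) ^ n
  have := le_abs_self C
  have h5 : ‖f n‖ * ‖f n‖ ≤ ((|C| + 1) * t) * ((|C| + 1) * t) := by
    have : C ≤ (|C| + 1) * (|C| + 1) := by nlinarith [abs_nonneg C]
    calc _ ≤ C * (t * t) := hn
      _ ≤ (|C| + 1) * (|C| + 1) * (t * t) := by gcongr
      _ = _ := by ring
  exact (mul_self_le_mul_self_iff (norm_nonneg _) (by positivity)).2 h5

theorem AE.refl (f : ℕ → E) : AE r f f := by rw [AE, sub_self]; exact Sm.zero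
theorem AE.of_eq (h : f = g) : AE r f g := h ▸ AE.refl f
theorem AE.symm (h : AE r f g) : AE r g f := by
  have := Sm.neg h; rwa [neg_sub] at this
theorem AE.trans (h1 : AE r f g) (h2 : AE r g h) : AE r f h := by
  have := Sm.add h1 h2; rwa [sub_add_sub_cancel] at this
theorem AE.add (h1 : AE r f g) (h2 : AE r h k) : AE r (f + h) (g + k) := by
  have := Sm.add h1 h2; rwa [sub_add_sub_comm] at this
theorem AE.sub (h1 : AE r f g) (h2 : AE r h k) : AE r (f - h) (g - k) := by
  have := Sm.sub h1 h2; rwa [sub_sub_sub_comm] at this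
theorem AE.mul_left (h1 : AE r f g) (hb : Bd h) : AE r (h * f) (h * g) := by
  have := Sm.bd_mul h1 hb; rwa [mul_sub] at this
theorem AE.mul_right (h1 : AE r f g) (hb : Bd h) : AE r (f * h) (g * h) := by
  have := Sm.mul_bd h1 hb; rwa [sub_mul] at this
theorem AE.str [StarRing E] [NormedStarGroup E] (h1 : AE r f g) : AE r (star f) (star g) := by
  have := Sm.str h1; rwa [star_sub] at this
theorem AE.mono (h1 : AE (1 / 4) f g) : AE (1 / 2) f g := Sm.mono h1
theorem AE.shift (h1 : AE r f g) : AE r (fun n => f (n + 1)) (fun n => g (n + 1)) := Sm.shift h1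
instance : Trans (AE (E := E) r) (AE r) (AE r) := ⟨AE.trans⟩

end calc8

section cayley
theorem cayley {M : Type*} [CStarAlgebra M] (L : StarSubalgebra ℂ M) [FiniteDimensional ℂ L]
    (R : M) (hR : R ∈ L) (hs : star R = R) :
    ∃ Z : M, (1 - Complex.I • R) * Z = 1 ∧ Z * (1 - Complex.I • R) = 1 ∧ ‖Z‖ ≤ 1 ∧
      (1 + Complex.I • R) * Z ∈ unitary M ∧ (1 + Complex.I • R) * Z ∈ L := by
  have hu : IsUnit (1 - Complex.I • R) := by
    have hsa : IsSelfAdjoint R := hs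
    have h1 : -Complex.I ∉ spectrum ℂ R := by
      intro h
      have := hsa.im_eq_zero_of_mem_spectrum h
      simp at this
    rw [spectrum.notMem_iff] at h1
    have h2 : 1 - Complex.I • R = Complex.I • (algebraMap ℂ M (-Complex.I) - R) := by
      rw [smul_sub, Algebra.algebraMap_eq_smul_one, smul_smul]; simp
    rw [h2]
    exact h1.smul (Units.mk0 Complex.I Complex.I_ne_zero)
  obtain ⟨u, hu'⟩ := hu
  obtain ⟨Z, hZ⟩ : ∃ Z, Z = (↑u⁻¹ : M) := ⟨_, rfl⟩
  have h1 : (1 - Complex.I • R) * Z = 1 := by rw [hZ, ← hu']; simp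
  have h2 : Z * (1 - Complex.I • R) = 1 := by rw [hZ, ← hu']; simp
  have hcomm : (1 + Complex.I • R) * Z = Z * (1 + Complex.I • R) := by
    have h3 : (1 + Complex.I • R) = 2 - (1 - Complex.I • R) := by
      rw [← one_add_one_eq_two]; abel
    rw [h3, sub_mul, mul_sub, h1, h2]
    simp [two_mul, mul_two]
  have hsm : star (1 - Complex.I • R) = 1 + Complex.I • R := by
    simp [star_sub, star_smul, hs]
  have hsp : star (1 + Complex.I • R) = 1 - Complex.I • R := by rw [← hsm, star_star]
  have h1s : star Z * (1 + Complex.I • R) = 1 := by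
    rw [← hsm, ← star_mul, h1, star_one]
  have h2s : (1 + Complex.I • R) * star Z = 1 := by
    rw [← hsm, ← star_mul, h2, star_one]
  have hun : (1 + Complex.I • R) * Z ∈ unitary M := by
    constructor
    · rw [star_mul, hsp]
      rw [hcomm, mul_assoc, ← mul_assoc _ Z, h1, one_mul, h1s]
    · rw [star_mul, hsp]
      rw [mul_assoc]
      have : Z * (star Z * (1 - Complex.I • R)) = star Z := by
        have h5 : star Z * (1 - Complex.I • R) = (1 - Complex.I • R) * star Z := by
          have := congrArg star hcomm
          rw [star_mul, star_mul, hsp] at this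
          exact this
        rw [h5, ← mul_assoc, h2, one_mul]
      rw [this, h2s]
  have hZ2 : (2 : ℂ) • Z = 1 + (1 + Complex.I • R) * Z := by
    have : (1 - Complex.I • R + (1 + Complex.I • R)) = (2 : ℂ) • (1 : M) := by
      rw [two_smul]; abel
    have h6 := congrArg (· * Z) this
    simp only [add_mul _ _ Z, smul_mul_assoc, one_mul] at h6
    rw [sub_mul, one_mul] at h1
    rw [sub_mul, one_mul, smul_mul_assoc] at h6
    rw [smul_mul_assoc] at h1
    rw [h1] at h6
    rw [← h6, add_mul, one_mul, smul_mul_assoc]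
  have hZn : ‖Z‖ ≤ 1 := by
    rcases subsingleton_or_nontrivial M with hM | hM
    · rw [Subsingleton.elim Z 0]; simp
    · have h3 : ‖(2 : ℂ) • Z‖ ≤ 1 + 1 := by
        rw [hZ2]
        refine (norm_add_le _ _).trans ?_
        rw [CStarRing.norm_one, CStarRing.norm_of_mem_unitary hun]
      rw [norm_smul] at h3
      norm_num at h3
      linarith
  have hmL : ∀ c : ℂ, 1 + c • R ∈ L := fun c => add_mem (one_mem L) (L.smul_mem hR c)
  haveI hcl : IsClosed (L : Set M) :=
    Submodule.closed_of_finiteDimensional (Subalgebra.toSubmodule L.toSubalgebra)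
  have hZL : Z ∈ L := by
    have h4 : (1 - Complex.I • R) ∈ L := sub_mem (one_mem L) (L.smul_mem hR _)
    have h5 : IsUnit (1 - Complex.I • R) := ⟨u, hu'⟩
    have h6 : IsUnit (⟨_, h4⟩ : L) := (StarSubalgebra.coe_isUnit L).1 h5
    obtain ⟨q, hq⟩ := h6.exists_right_inv
    have h7 : (1 - Complex.I • R) * (q : M) = 1 := congrArg Subtype.val hq
    have h8 : Z = q := by
      calc Z = Z * ((1 - Complex.I • R) * (q : M)) := by rw [h7, mul_one]
        _ = q := by rw [← mul_assoc, h2, one_mul]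
    rw [h8]; exact q.2
  exact ⟨Z, h1, h2, hZn, hun, mul_mem (hmL _) hZL⟩
end cayley

end part8

section part9

open Filter Topology Asymptotics

section asm9
variable {D M : Type} [CStarAlgebra D] [CStarAlgebra M]

/-- pointwise application of a star homomorphism to sequences -/
def bs (β : D →⋆ₐ[ℂ] M) : (ℕ → D) →⋆ₐ[ℂ] (ℕ → M) where
  toFun X := fun n => β (X n)
  map_one' := by ext; simp
  map_mul' X Y := by ext; simp
  map_zero' := by ext; simp
  map_add' X Y := by ext; simp
  commutes' c := by ext n; exact AlgHomClass.commutes β c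
  map_star' X := by ext; simp [map_star]

theorem bs_apply (β : D →⋆ₐ[ℂ] M) (X : ℕ → D) (n : ℕ) : bs β X n = β (X n) := rfl

theorem Sm.bs {r : ℝ} {X : ℕ → D} (β : D →⋆ₐ[ℂ] M) (h : Sm r X) : Sm r (bs β X) :=
  h.norm_le fun n => by rw [bs_apply]; exact NonUnitalStarAlgHom.norm_apply_le β _

theorem Bd.bs {X : ℕ → D} (β : D →⋆ₐ[ℂ] M) (h : Bd X) : Bd (bs β X) :=
  h.norm_le fun n => by rw [bs_apply]; exact NonUnitalStarAlgHom.norm_apply_le β _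

theorem AE.bs {r : ℝ} {X Y : ℕ → D} (β : D →⋆ₐ[ℂ] M) (h : AE r X Y) :
    AE r (bs β X) (bs β Y) := by
  have := Sm.bs β h
  rwa [map_sub] at this

theorem AE.smul {r : ℝ} {f g : ℕ → M} (c : ℂ) (h : AE r f g) : AE r (c • f) (c • g) := by
  have : AE r ((fun _ => c • (1 : M)) * f) ((fun _ => c • (1 : M)) * g) := h.mul_left (Bd.const _)
  have h2 : ∀ f : ℕ → M, (fun _ => c • (1 : M)) * f = c • f := fun f => by ext; simp
  rwa [h2, h2] at this

theorem Bd.smul {f : ℕ → M} (c : ℂ) (h : Bd f) : Bd (c • f) := by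
  have : Bd ((fun _ => c • (1 : M)) * f) := (Bd.const _).mul h
  have h2 : ∀ f : ℕ → M, (fun _ => c • (1 : M)) * f = c • f := fun f => by ext; simp
  rwa [h2] at this

theorem lemP3 (β : D →⋆ₐ[ℂ] M) (e W G : ℕ → M) (hes : star e = e)
    (hec : ∀ X, bs β X * e = e * bs β X) (he : Bd e)
    (Y U X X' : ℕ → D) (hX : Bd X) (hX' : Bd X') (hY : Bd Y) (hU : Bd U) (hYs : star Y = Y)
    (E1 : AE (1 / 4) (star W * W) (e * bs β (Y * Y)))
    (E2 : AE (1 / 4) (star W * G * W) (e * bs β (Y * U)))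
    (E3 : AE (1 / 4) (star W * (star G * G) * W) (e * bs β (star U * U)))
    (hq : AE (1 / 4) (U * X) (Y * X')) :
    AE (1 / 2) (G * W * bs β X) (W * bs β X') := by
  apply Sm.of_star_mul
  have E2' : AE (1 / 4) (star W * star G * W) (e * bs β (star U * Y)) := by
    have := E2.str
    simp only [star_mul, star_star, hes, ← map_star, hYs, hec] at this
    rwa [← mul_assoc] at this
  have hbX := hX.bs β
  have hbX' := hX'.bs β
  have h1 : AE (1/4) (star (G * W * bs β X - W * bs β X') * (G * W * bs β X - W * bs β X'))
      (e * bs β (star (U * X - Y * X') * (U * X - Y * X'))) := by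
    have t1 := (E3.mul_left hbX.str).mul_right hbX
    have t2 := (E2'.mul_left hbX.str).mul_right hbX'
    have t3 := (E2.mul_left hbX'.str).mul_right hbX
    have t4 := (E1.mul_left hbX'.str).mul_right hbX'
    have t := ((t1.sub t2).sub t3).add t4
    refine (AE.of_eq ?_).trans (t.trans (AE.of_eq ?_))
    · simp only [star_sub, star_mul]; noncomm_ring
    · simp only [star_sub, star_mul, hYs, map_mul, map_sub, ← map_star]
      have key : ∀ P Q, bs β P * (e * Q) = e * (bs β P * Q) := fun P Q => by
        rw [← mul_assoc, hec, mul_assoc]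
      simp only [mul_assoc, key]
      noncomm_ring
  have h2 : Sm (1/4) (e * bs β (star (U * X - Y * X') * (U * X - Y * X'))) := by
    refine Sm.bd_mul (Sm.bs β ?_) he
    exact Sm.bd_mul hq (Bd.str (((hU.mul hX).sub (hY.mul hX'))))
  have := Sm.add h1 h2
  rwa [sub_add_cancel] at this

theorem Bd.bound {f : ℕ → M} (h : Bd f) : ∃ C : ℝ, ∀ n, ‖f n‖ ≤ C :=
  (isBigO_one_nat_atTop_iff (f := f)).1 h

/-- commutation and intertwining -/
theorem lemDelta (w v X G R b bm e : ℕ → M)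
    (hw : Bd w) (hv : Bd v) (hX : Bd X) (hb : Bd b) (hG : Bd G) (hR : Bd R)
    (hXs : Bd (star X))
    (hwe : w * e = w) (hve : v * e = v) (hbe : b * e = e * b)
    (hvw : star v * w = 0) (hwv : star w * v = 0)
    (hRs : star R = R) (hbs : star b = b)
    (hRR : AE (1 / 2) R (w * b * star v + v * b * star w))
    (hbX : AE (1 / 2) (b * X) X) (hbXs : AE (1 / 2) (b * star X) (star X))
    (F1w : AE (1 / 2) (star w * w * X) (e * X)) (F1v : AE (1 / 2) (star v * v * X) (e * X))
    (F1ws : AE (1 / 2) (star w * w * star X) (e * star X))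
    (F1vs : AE (1 / 2) (star v * v * star X) (e * star X))
    (F3 : AE (1 / 2) (G * w * b) (w * bm)) (F4 : AE (1 / 2) (G * v * b) (v * bm))
    (F3s : AE (1 / 2) (star G * w * b) (w * star bm))
    (F4s : AE (1 / 2) (star G * v * b) (v * star bm)) :
    AE (1 / 2) ((1 + Complex.I • R) * (w * X * star w + G) * (1 - Complex.I • R))
      ((1 - Complex.I • R) * (v * X * star v + G) * (1 + Complex.I • R)) := by
  have h1 : Bd (1 : ℕ → M) := Bd.const 1
  have K1 : ∀ X : ℕ → M, Bd X → AE (1/2) (b * X) X → AE (1/2) (star w * w * X) (e * X) →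
      AE (1/2) (R * w * X) (v * X) := by
    intro X hX hbX F1w
    have a1 := (hRR.mul_right hw).mul_right hX
    refine a1.trans ((AE.of_eq ?_).trans ((F1w.mul_left (hv.mul hb)).trans
      ((AE.of_eq ?_).trans (hbX.mul_left hv))))
    · simp only [add_mul, mul_assoc, ← mul_assoc (star v) w, hvw, zero_mul, mul_zero, zero_add]
    · rw [← mul_assoc, mul_assoc v b e, hbe, ← mul_assoc v, hve, mul_assoc]
  have K2 : ∀ X : ℕ → M, Bd X → AE (1/2) (b * X) X → AE (1/2) (star v * v * X) (e * X) →
      AE (1/2) (R * v * X) (w * X) := by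
    intro X hX hbX F1v
    have a1 := (hRR.mul_right hv).mul_right hX
    refine a1.trans ((AE.of_eq ?_).trans ((F1v.mul_left (hw.mul hb)).trans
      ((AE.of_eq ?_).trans (hbX.mul_left hw))))
    · simp only [add_mul, mul_assoc, ← mul_assoc (star w) v, hwv, zero_mul, mul_zero, add_zero]
    · rw [← mul_assoc, mul_assoc w b e, hbe, ← mul_assoc w, hwe, mul_assoc]
  have K1X := K1 X hX hbX F1w
  have K2X := K2 X hX hbX F1v
  have K1s : AE (1/2) (X * star w * R) (X * star v) := by
    have := (K1 _ hXs hbXs F1ws).str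
    simpa only [star_mul, star_star, hRs, mul_assoc] using this
  have K2s : AE (1/2) (X * star v * R) (X * star w) := by
    have := (K2 _ hXs hbXs F1vs).str
    simpa only [star_mul, star_star, hRs, mul_assoc] using this
  have C : AE (1/2) (R * G) (G * R) := by
    have c1 : AE (1/2) (G * R) (w * bm * star v + v * bm * star w) := by
      refine (hRR.mul_left hG).trans ((AE.of_eq ?_).trans
        ((F3.mul_right hv.str).add (F4.mul_right hw.str)))
      noncomm_ring
    have c2 : AE (1/2) (star G * R) (w * star bm * star v + v * star bm * star w) := by
      refine (hRR.mul_left hG.str).trans ((AE.of_eq ?_).trans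
        ((F3s.mul_right hv.str).add (F4s.mul_right hw.str)))
      noncomm_ring
    have c3 := c2.str
    refine AE.trans (AE.trans (AE.of_eq ?_) (c3.trans (AE.of_eq ?_))) c1.symm
    · simp [star_mul, hRs]
    · simp only [star_add, star_mul, star_star, mul_assoc]; exact add_comm _ _
  have hm : Bd (1 - Complex.I • R) := h1.sub (hR.smul _)
  have hp : Bd (1 + Complex.I • R) := h1.add (hR.smul _)
  have A1 : AE (1/2) ((1 + Complex.I • R) * (w * X)) ((w + Complex.I • v) * X) := by
    refine (AE.of_eq ?_).trans (((AE.refl (w * X)).add (K1X.smul Complex.I)).trans (AE.of_eq ?_))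
    · simp only [add_mul, one_mul, smul_mul_assoc, mul_assoc]
    · simp only [add_mul, smul_mul_assoc]
  have A2 : AE (1/2) (X * star w * (1 - Complex.I • R)) (X * (star w - Complex.I • star v)) := by
    refine (AE.of_eq ?_).trans (((AE.refl (X * star w)).sub (K1s.smul Complex.I)).trans
      (AE.of_eq ?_))
    · simp only [mul_sub, mul_one, mul_smul_comm]
    · simp only [mul_sub, mul_smul_comm]
  have A3 : AE (1/2) ((1 - Complex.I • R) * (v * X)) ((v - Complex.I • w) * X) := by
    refine (AE.of_eq ?_).trans (((AE.refl (v * X)).sub (K2X.smul Complex.I)).trans (AE.of_eq ?_))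
    · simp only [sub_mul, one_mul, smul_mul_assoc, mul_assoc]
    · simp only [sub_mul, smul_mul_assoc]
  have A4 : AE (1/2) (X * star v * (1 + Complex.I • R)) (X * (star v + Complex.I • star w)) := by
    refine (AE.of_eq ?_).trans (((AE.refl (X * star v)).add (K2s.smul Complex.I)).trans
      (AE.of_eq ?_))
    · simp only [mul_add, mul_one, mul_smul_comm]
    · simp only [mul_add, mul_smul_comm]
  have B1 := (A1.mul_right (hw.str.mul hm)).trans ((AE.of_eq (by
    simp only [mul_assoc])).trans (A2.mul_left (hw.add (hv.smul Complex.I))))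
  have B2 := (A3.mul_right (hv.str.mul hp)).trans ((AE.of_eq (by
    simp only [mul_assoc])).trans (A4.mul_left (hv.sub (hw.smul Complex.I))))
  have B3 : (w + Complex.I • v) * (X * (star w - Complex.I • star v)) =
      (v - Complex.I • w) * (X * (star v + Complex.I • star w)) := by
    simp only [mul_add, add_mul, mul_sub, sub_mul, smul_mul_assoc, mul_smul_comm, smul_sub,
      smul_add, smul_smul, Complex.I_mul_I]
    module
  have B4 := B1.trans ((AE.of_eq B3).trans B2.symm)
  have B5 : AE (1/2) ((1 + Complex.I • R) * G * (1 - Complex.I • R))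
      ((1 - Complex.I • R) * G * (1 + Complex.I • R)) := by
    have := C.smul (2 * Complex.I)
    refine AE.trans (AE.of_eq ?_) (((this.sub (AE.refl ((2 * Complex.I) • (G * R)))).add
      (AE.refl ((1 - Complex.I • R) * G * (1 + Complex.I • R)))).trans (AE.of_eq ?_))
    · simp only [mul_add, add_mul, mul_sub, sub_mul, smul_mul_assoc, mul_smul_comm, smul_sub,
        smul_add, smul_smul, one_mul, mul_one]
      module
    · simp
  refine (AE.of_eq ?_).trans ((B4.add B5).trans (AE.of_eq ?_))
  · generalize 1 - Complex.I • R = m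
    generalize 1 + Complex.I • R = p
    noncomm_ring
  · generalize 1 - Complex.I • R = m
    generalize 1 + Complex.I • R = p
    noncomm_ring

end asm9

end part9

section part10

open Filter Topology Asymptotics

section asm10

theorem final_asm {A : Type*} [NonUnitalCStarAlgebra A] {D P M : Type} [CStarAlgebra D]
    [CStarAlgebra P] [CStarAlgebra M]
    (Dk : ℕ → StarSubalgebra ℂ D) (F : ℕ → StarSubalgebra ℂ P)
    (hDd : ∀ d : D, ∃ l : ℕ → D, (∀ n, l n ∈ Dk n) ∧ Tendsto l atTop (𝓝 d))
    (hFd : ∀ d : P, ∃ l : ℕ → P, (∀ n, l n ∈ F n) ∧ Tendsto l atTop (𝓝 d))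
    (y c : ℕ → D)
    (β : D →⋆ₐ[ℂ] M) (π : P →⋆ₐ[ℂ] M) (e : M) (w : ℕ → M) (L : ℕ → StarSubalgebra ℂ M)
    (hes : star e = e) (hec : ∀ x, β x * e = e * β x) (hei : ∀ x, e * β x = 0 → x = 0)
    (hwe : ∀ n, w n * e = w n) (hww : ∀ n m, n ≠ m → star (w n) * w m = 0)
    (hLm : Monotone L) (hLf : ∀ n, FiniteDimensional ℂ (L n))
    (hL1 : ∀ n, ∀ x ∈ Dk n, ∀ p ∈ F n, w n * β x * star (w n) + π p ∈ L n)
    (hL2 : ∀ n, w n * β (c n) * star (w (n + 1)) ∈ L (n + 1))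
    (hπn : ∀ n T p, ‖p‖ ≤ ‖w n * T * star (w n) + π p‖)
    (g : A →⋆ₙₐ[ℂ] P) (x : A →ₗ[ℂ] D) (hxs : ∀ a, x (star a) = star (x a))
    (Cx : ℝ) (hxb : ∀ a, ‖x a‖ ≤ Cx * ‖a‖) (l : A → A → D)
    (hx2 : ∀ a a', x (a * a') = x a * x a' + star (l (star a') (star a)) + l a a')
    (hgx : ∀ a, g a = 0 → x a = 0 → a = 0)
    (S : Set A) (hS : Dense S) (hSs : ∀ a ∈ S, star a ∈ S)
    (hys : ∀ n, star (y n) = y n) (hyn : ∀ n, ‖y n‖ ≤ 1) (hcy : AE (1 / 4) c y)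
    (μ : A → ℕ → D) (hμb : ∀ a, Bd (μ a))
    (H1 : ∀ a ∈ S, AE (1 / 4) (y * fun _ => x a) (fun _ => x a))
    (H2 : ∀ a ∈ S, ∀ a' ∈ S, AE (1 / 4) (y * fun _ => l a a') (fun _ => l a a'))
    (H3 : ∀ a ∈ S, ∀ a' ∈ S, AE (1 / 4) (μ a * fun _ => x a') (fun _ => l a a'))
    (H4 : ∀ a ∈ S, AE (1 / 4) (μ a * y) (y * μ a))
    (H4' : ∀ a ∈ S, AE (1 / 4) (star (μ (star a))) (μ a))
    (H5 : ∀ a ∈ S, AE (1 / 4) ((fun n => μ a (n + 1)) * y) (μ a))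
    (H6 : ∀ a ∈ S, AE (1 / 4) ((fun n => y (n + 1)) * μ a) (μ a))
    (E1 : AE (1 / 4) (fun n => star (w n) * w n) (fun n => e * β (y n * y n)))
    (E2 : ∀ a ∈ S, AE (1 / 4) (fun n => star (w n) * π (g a) * w n)
      (fun n => e * β (y n * μ a n)))
    (E3 : ∀ a ∈ S, AE (1 / 4) (fun n => star (w n) * π (star (g a) * g a) * w n)
      (fun n => e * β (star (μ a n) * μ a n))) :
    IsAFEmbeddable A := by
  -- sequence-level abbreviations
  obtain ⟨es, hesd⟩ : ∃ es : ℕ → M, es = fun _ => e := ⟨_, rfl⟩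
  obtain ⟨v, hvd⟩ : ∃ v : ℕ → M, v = fun n => w (n + 1) := ⟨_, rfl⟩
  obtain ⟨X, hXd⟩ : ∃ X : A → ℕ → M, X = fun a => bs β (fun _ => x a) := ⟨_, rfl⟩
  obtain ⟨G, hGd⟩ : ∃ G : A → ℕ → M, G = fun a _ => π (g a) := ⟨_, rfl⟩
  have hess : star es = es := by rw [hesd]; ext n; exact hes
  have hecs : ∀ T, bs β T * es = es * bs β T := fun T => by rw [hesd]; ext n; exact hec _
  have hesb : Bd es := by rw [hesd]; exact Bd.const _
  have hyb : Bd y := Bd.of_le 1 hyn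
  have hyS : star y = y := by ext n; exact hys n
  have hxbd : ∀ a, Bd (fun _ : ℕ => x a) := fun a => Bd.const _
  have hlbd : ∀ a a', Bd (fun _ : ℕ => l a a') := fun a a' => Bd.const _
  have hXb : ∀ a, Bd (X a) := fun a => by rw [hXd]; exact (hxbd a).bs β
  have hGb : ∀ a, Bd (G a) := fun a => by rw [hGd]; exact Bd.const _
  have hXs : ∀ a, star (X a) = X (star a) := fun a => by
    rw [hXd]; simp only [← map_star]; congr 1; ext n; exact (hxs a).symm
  have hGs : ∀ a, star (G a) = G (star a) := fun a => by
    rw [hGd]; ext n; simp [map_star]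
  have hwes : w * es = w := by rw [hesd]; ext n; exact hwe n
  have hves : v * es = v := by rw [hesd, hvd]; ext n; exact hwe _
  have hvw : star v * w = 0 := by rw [hvd]; ext n; exact hww _ _ (by omega)
  have hwv : star w * v = 0 := by rw [hvd]; ext n; exact hww _ _ (by omega)
  have E1w : AE (1 / 4) (star w * w) (es * bs β (y * y)) := by rw [hesd]; exact E1
  have E2w : ∀ a ∈ S, AE (1 / 4) (star w * G a * w) (es * bs β (y * μ a)) := by
    intro a ha; rw [hesd, hGd]; exact E2 a ha
  have E3w : ∀ a ∈ S, AE (1 / 4) (star w * (star (G a) * G a) * w)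
      (es * bs β (star (μ a) * μ a)) := by
    intro a ha
    have : star (G a) * G a = fun _ => π (star (g a) * g a) := by
      rw [hGd]; ext n; simp [map_star]
    rw [this, hesd]; exact E3 a ha
  obtain ⟨y', hy'd⟩ : ∃ y' : ℕ → D, y' = fun n => y (n + 1) := ⟨_, rfl⟩
  obtain ⟨μ', hμ'd⟩ : ∃ μ' : A → ℕ → D, μ' = fun a n => μ a (n + 1) := ⟨_, rfl⟩
  have E1v : AE (1 / 4) (star v * v) (es * bs β (y' * y')) := by
    have := E1w.shift; rw [hesd] at *; rw [hvd, hy'd]; exact this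
  have E2v : ∀ a ∈ S, AE (1 / 4) (star v * G a * v) (es * bs β (y' * μ' a)) := by
    intro a ha
    have := (E2w a ha).shift; rw [hesd] at *; rw [hvd, hy'd, hμ'd]; rw [hGd] at *; exact this
  have E3v : ∀ a ∈ S, AE (1 / 4) (star v * (star (G a) * G a) * v)
      (es * bs β (star (μ' a) * μ' a)) := by
    intro a ha
    have := (E3w a ha).shift; rw [hesd] at *; rw [hvd, hμ'd]; rw [hGd] at *; exact this
  have hy'b : Bd y' := by rw [hy'd]; exact hyb.shift
  have hμ'b : ∀ a, Bd (μ' a) := fun a => by rw [hμ'd]; exact (hμb a).shift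
  have hy'S : star y' = y' := by rw [hy'd]; ext n; exact hys _
  have hwb : Bd w := by
    refine Bd.of_star_mul ?_
    have h2 : Bd (es * bs β (y * y)) := hesb.mul ((hyb.mul hyb).bs β)
    have := Bd.add (Sm.bd (by norm_num) (by norm_num) E1w) h2
    rwa [sub_add_cancel] at this
  have hvb : Bd v := by rw [hvd]; exact hwb.shift
  have H1' : ∀ a ∈ S, AE (1 / 4) (y' * fun _ => x a) (fun _ => x a) := by
    intro a ha; rw [hy'd]; exact (H1 a ha).shift
  have F1w : ∀ a ∈ S, AE (1 / 2) (star w * w * X a) (es * X a) := by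
    intro a ha
    have h1 := E1w.mul_right (hXb a)
    have h2 : AE (1 / 4) (y * y * fun _ => x a) (fun _ => x a) := by
      rw [mul_assoc]; exact ((H1 a ha).mul_left hyb).trans (H1 a ha)
    have h3 := (h2.bs β).mul_left hesb
    refine (h1.trans ((AE.of_eq ?_).trans h3)).mono.trans (AE.of_eq ?_)
    · rw [hXd, map_mul _ (y * y), mul_assoc]
    · rw [hXd]
  have F1v : ∀ a ∈ S, AE (1 / 2) (star v * v * X a) (es * X a) := by
    intro a ha
    have h1 := E1v.mul_right (hXb a)
    have h2 : AE (1 / 4) (y' * y' * fun _ => x a) (fun _ => x a) := by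
      rw [mul_assoc]; exact ((H1' a ha).mul_left hy'b).trans (H1' a ha)
    have h3 := (h2.bs β).mul_left hesb
    refine (h1.trans ((AE.of_eq ?_).trans h3)).mono.trans (AE.of_eq ?_)
    · rw [hXd, map_mul _ (y' * y'), mul_assoc]
    · rw [hXd]
  have F2 : ∀ a ∈ S, ∀ a' ∈ S, AE (1 / 2) (G a * w * X a') (w * bs β (fun _ => l a a')) := by
    intro a ha a' ha'
    rw [hXd]
    exact lemP3 β es w (G a) hess hecs hesb y (μ a) _ _ (hxbd a') (hlbd a a') hyb (hμb a) hyS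
      E1w (E2w a ha) (E3w a ha) ((H3 a ha a' ha').trans (H2 a ha a' ha').symm)
  have F3 : ∀ a ∈ S, AE (1 / 2) (G a * w * bs β y) (w * bs β (μ a)) := by
    intro a ha
    exact lemP3 β es w (G a) hess hecs hesb y (μ a) _ _ hyb (hμb a) hyb (hμb a) hyS
      E1w (E2w a ha) (E3w a ha) (H4 a ha)
  have F4 : ∀ a ∈ S, AE (1 / 2) (G a * v * bs β y) (v * bs β (μ a)) := by
    intro a ha
    refine lemP3 β es v (G a) hess hecs hesb y' (μ' a) _ _ hyb (hμb a) hy'b (hμ'b a) hy'S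
      E1v (E2v a ha) (E3v a ha) ?_
    rw [hy'd, hμ'd]
    exact (H5 a ha).trans (H6 a ha).symm
  have F3s : ∀ a ∈ S, AE (1 / 2) (star (G a) * w * bs β y) (w * star (bs β (μ a))) := by
    intro a ha
    rw [hGs]
    refine (F3 _ (hSs a ha)).trans (AE.mul_left ?_ hwb)
    have := ((H4' a ha).str.bs β).mono
    rw [star_star, map_star] at this
    exact this
  have F4s : ∀ a ∈ S, AE (1 / 2) (star (G a) * v * bs β y) (v * star (bs β (μ a))) := by
    intro a ha
    rw [hGs]
    refine (F4 _ (hSs a ha)).trans (AE.mul_left ?_ hvb)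
    have := ((H4' a ha).str.bs β).mono
    rw [star_star, map_star] at this
    exact this
  have hcb : Bd c := by
    have := Bd.add (Sm.bd (by norm_num) (by norm_num) hcy) hyb
    rwa [sub_add_cancel] at this
  obtain ⟨R, hRd⟩ : ∃ R : ℕ → M, R = w * bs β c * star v + v * star (bs β c) * star w :=
    ⟨_, rfl⟩
  have hRs : star R = R := by
    rw [hRd]; simp only [star_add, star_mul, star_star, mul_assoc]; exact add_comm _ _
  have hRb : Bd R := by
    rw [hRd]
    exact ((hwb.mul (hcb.bs β)).mul hvb.str).add ((hvb.mul (hcb.bs β).str).mul hwb.str)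
  have hRR : AE (1 / 2) R (w * bs β y * star v + v * bs β y * star w) := by
    rw [hRd]
    have h1 := (hcy.bs β).mono
    have h2 := h1.str
    rw [← map_star _ y, hyS] at h2
    exact ((h1.mul_left hwb).mul_right hvb.str).add ((h2.mul_left hvb).mul_right hwb.str)
  have hRL : ∀ n, R n ∈ L (n + 1) := by
    intro n
    rw [hRd, hvd]
    refine add_mem (hL2 n) ?_
    have := star_mem (hL2 n)
    simp only [star_mul, star_star] at this
    rw [← mul_assoc] at this
    exact this
  have hbX : ∀ a ∈ S, AE (1 / 2) (bs β y * X a) (X a) := by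
    intro a ha
    have := ((H1 a ha).bs β).mono
    rw [map_mul] at this
    rw [hXd]; exact this
  have hΔ : ∀ a ∈ S, AE (1 / 2)
      ((1 + Complex.I • R) * (w * X a * star w + G a) * (1 - Complex.I • R))
      ((1 - Complex.I • R) * (v * X a * star v + G a) * (1 + Complex.I • R)) := by
    intro a ha
    refine lemDelta w v (X a) (G a) R (bs β y) (bs β (μ a)) es hwb hvb (hXb a) (hyb.bs β) (hGb a)
      hRb (hXb a).str hwes hves (hecs y) hvw hwv hRs (by rw [← map_star, hyS]) hRR (hbX a ha)
      ?_ (F1w a ha) (F1v a ha) ?_ ?_ (F3 a ha) (F4 a ha) (F3s a ha) (F4s a ha)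
    · rw [hXs]; exact hbX _ (hSs a ha)
    · rw [hXs]; exact F1w _ (hSs a ha)
    · rw [hXs]; exact F1v _ (hSs a ha)
  choose Z hZ1 hZ2 hZn hZU hZL using fun n => by
    haveI := hLf (n + 1)
    exact cayley (L (n + 1)) (R n) (hRL n) (congrFun hRs n)
  have hZb : Bd Z := Bd.of_le 1 hZn
  obtain ⟨Cw, hCw⟩ := hwb.bound
  have hCw0 : 0 ≤ Cw := (norm_nonneg _).trans (hCw 0)
  -- the maps
  let θ : ℕ → A →ₗ[ℂ] M := fun n =>
    { toFun := fun a => w n * β (x a) * star (w n) + π (g a)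
      map_add' := fun a b => by simp only [map_add, mul_add, add_mul]; abel
      map_smul' := fun r a => by
        simp only [map_smul, mul_smul_comm, smul_mul_assoc, smul_add, RingHom.id_apply] }
  have hθ : ∀ n a, θ n a = w n * β (x a) * star (w n) + π (g a) := fun n a => rfl
  have hθs : ∀ a, (fun n => θ n a) = w * X a * star w + G a := by
    intro a; rw [hXd, hGd]; rfl
  have hθs' : ∀ a, (fun n => θ (n + 1) a) = v * X a * star v + G a := by
    intro a; rw [hXd, hGd, hvd]; rfl
  have hwn' : ∀ n (d : D), ‖w n * β d * star (w n)‖ ≤ Cw * ‖d‖ * Cw := by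
    intro n d
    have h1 : ‖β d‖ ≤ ‖d‖ := NonUnitalStarAlgHom.norm_apply_le β d
    calc _ ≤ ‖w n * β d‖ * ‖star (w n)‖ := norm_mul_le _ _
      _ ≤ (‖w n‖ * ‖β d‖) * ‖star (w n)‖ := by gcongr; exact norm_mul_le _ _
      _ ≤ Cw * ‖d‖ * Cw := by
        rw [norm_star]
        have := hCw n
        gcongr
  refine core L hLm hLf θ ?_ (Cw * Cx * Cw + 1) ?_ S hS ?_ (fun n => (1 + Complex.I • R n) * Z n)
    hZU hZL ?_ ?_ ?_
  · intro n a
    simp only [hθ, hxs, map_star, star_add, star_mul, star_star, mul_assoc]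
  · intro n a
    rw [hθ]
    have h1 : ‖π (g a)‖ ≤ ‖a‖ := (NonUnitalStarAlgHom.norm_apply_le π _).trans
      (NonUnitalStarAlgHom.norm_apply_le g a)
    calc _ ≤ _ := norm_add_le _ _
      _ ≤ Cw * (Cx * ‖a‖) * Cw + ‖a‖ := by
        gcongr
        refine (hwn' n _).trans ?_
        gcongr
        exact hxb a
      _ = _ := by ring
  · intro a ha b hb
    have h1 : AE (1 / 2) ((w * X a * star w + G a) * (w * X b * star w + G b))
        (w * X (a * b) * star w + G (a * b)) := by
      have t1 : AE (1 / 2) (w * X a * (star w * w * X b) * star w) (w * X a * (es * X b) * star w) :=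
        ((F1w b hb).mul_left (hwb.mul (hXb a))).mul_right hwb.str
      have t2 := (F2 a ha b hb).mul_right hwb.str
      have t3 := ((F2 _ (hSs b hb) _ (hSs a ha)).mul_right hwb.str).str
      refine (AE.of_eq ?_).trans (((t1.add t3).add t2).add (AE.refl (G a * G b)) |>.trans
        (AE.of_eq ?_))
      · simp only [star_mul, star_star, hXs, hGs]
        noncomm_ring
      · have q1 : X (a * b) = X a * X b + star (bs β (fun _ => l (star b) (star a)))
            + bs β (fun _ => l a b) := by
          rw [hXd, ← map_star]
          simp only [← map_mul, ← map_add]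
          congr 1; ext n; exact hx2 a b
        have q2 : G (a * b) = G a * G b := by rw [hGd]; ext n; simp
        have q3 : X a * es = es * X a := by rw [hXd]; exact hecs _
        have q4 : w * X a * (es * X b) = w * (X a * X b) := by
          rw [← mul_assoc, mul_assoc w, q3, ← mul_assoc w, hwes, mul_assoc]
        rw [q1, q2, q4]
        simp only [star_mul, star_star]
        noncomm_ring
    have h2 := Sm.tendsto h1
    refine h2.congr fun n => ?_
    rw [← hθs, ← hθs, ← hθs]
    rfl
  · intro a ha
    have h1 := ((hΔ a ha).mul_left hZb).mul_right hZb
    have h2 : AE (1 / 2) (fun n => (1 + Complex.I • R n) * Z n * θ n a)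
        (fun n => θ (n + 1) a * ((1 + Complex.I • R n) * Z n)) := by
      refine (AE.of_eq ?_).trans (h1.trans (AE.of_eq ?_))
      · rw [← hθs]; ext n
        have hc : (1 + Complex.I • R n) * Z n = Z n * (1 + Complex.I • R n) := by
          have h3 : (1 + Complex.I • R n) = 2 - (1 - Complex.I • R n) := by
            rw [← one_add_one_eq_two]; abel
          rw [h3, sub_mul, mul_sub, hZ1, hZ2]
          simp [two_mul, mul_two]
        change _ = Z n * ((1 + Complex.I • R n) * θ n a * (1 - Complex.I • R n)) * Z n
        rw [mul_assoc (Z n), mul_assoc _ (1 - Complex.I • R n), hZ1, mul_one, hc, mul_assoc]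
      · rw [← hθs']; ext n
        change Z n * ((1 - Complex.I • R n) * θ (n + 1) a * (1 + Complex.I • R n)) * Z n = _
        rw [mul_assoc (1 - Complex.I • R n), ← mul_assoc (Z n), hZ2, one_mul, mul_assoc]
    exact h2
  · intro a _
    obtain ⟨dl, hdl, hdt⟩ := hDd (x a)
    obtain ⟨fl, hfl, hft⟩ := hFd (g a)
    refine ⟨fun n => w n * β (dl n) * star (w n) + π (fl n), fun n => hL1 n _ (hdl n) _ (hfl n), ?_⟩
    rw [tendsto_zero_iff_norm_tendsto_zero]
    have h1 : Tendsto (fun n => Cw * ‖x a - dl n‖ * Cw + ‖g a - fl n‖) atTop (𝓝 0) := by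
      have a1 : Tendsto (fun n => ‖x a - dl n‖) atTop (𝓝 0) := by
        have := (tendsto_const_nhds (x := x a)).sub hdt
        rw [sub_self] at this
        exact tendsto_zero_iff_norm_tendsto_zero.1 this
      have a2 : Tendsto (fun n => ‖g a - fl n‖) atTop (𝓝 0) := by
        have := (tendsto_const_nhds (x := g a)).sub hft
        rw [sub_self] at this
        exact tendsto_zero_iff_norm_tendsto_zero.1 this
      have := ((a1.const_mul Cw).mul_const Cw).add a2
      simpa using this
    refine squeeze_zero (fun _ => norm_nonneg _) (fun n => ?_) h1
    have h2 : θ n a - (w n * β (dl n) * star (w n) + π (fl n)) =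
        w n * β (x a - dl n) * star (w n) + π (g a - fl n) := by
      rw [hθ, map_sub, map_sub, mul_sub, sub_mul]; abel
    rw [h2]
    exact (norm_add_le _ _).trans (add_le_add (hwn' n _) (NonUnitalStarAlgHom.norm_apply_le π _))
  · intro a ha
    have hg : g a = 0 := by
      have h1 : Tendsto (fun n => ‖θ n a‖) atTop (𝓝 0) := tendsto_zero_iff_norm_tendsto_zero.1 ha
      have h2 : ‖g a‖ ≤ 0 := ge_of_tendsto' h1 (fun n => hπn n _ _)
      exact norm_le_zero_iff.1 h2
    refine hgx a hg ?_
    have hT : ∀ b, Tendsto (fun n => star (w n) * w n * β (x b)) atTop (𝓝 (e * β (x b))) := by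
      intro b
      rw [Metric.tendsto_atTop]
      intro ε hε
      set K := (Cw * Cw + ‖e‖) * |Cx| + 1 with hK
      have hK0 : 0 < K := by positivity
      obtain ⟨s, hs, hsS⟩ := Metric.dense_iff.1 hS b (ε / (2 * K)) (by positivity)
      have h1 := Sm.tendsto (F1w s hsS)
      rw [Metric.tendsto_atTop] at h1
      obtain ⟨N, hN⟩ := h1 (ε / 2) (by positivity)
      refine ⟨N, fun n hn => ?_⟩
      have h2 := hN n hn
      rw [dist_zero_right] at h2
      have h3 : ‖star (w n) * w n * β (x s) - e * β (x s)‖ < ε / 2 := by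
        rw [hXd, hesd] at h2; exact h2
      rw [dist_eq_norm]
      have h4 : star (w n) * w n * β (x b) - e * β (x b) =
          (star (w n) * w n * β (x s) - e * β (x s)) + (star (w n) * w n - e) * β (x (b - s)) := by
        rw [map_sub, map_sub]; noncomm_ring
      have h5 : ‖star (w n) * w n - e‖ ≤ Cw * Cw + ‖e‖ := by
        refine (norm_sub_le _ _).trans ?_
        gcongr
        rw [CStarRing.norm_star_mul_self]
        have := hCw n
        gcongr
      have h6 : ‖β (x (b - s))‖ ≤ |Cx| * (ε / (2 * K)) := by
        refine (NonUnitalStarAlgHom.norm_apply_le β _).trans ((hxb _).trans ?_)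
        have h7 : ‖b - s‖ ≤ ε / (2 * K) := by
          rw [← dist_eq_norm, dist_comm]; exact (Metric.mem_ball.1 hs).le
        have h8 := le_abs_self Cx
        gcongr
      have h9 : (Cw * Cw + ‖e‖) * (|Cx| * (ε / (2 * K))) ≤ ε / 2 := by
        have : (Cw * Cw + ‖e‖) * (|Cx| * (ε / (2 * K))) = ((Cw * Cw + ‖e‖) * |Cx|) / K * (ε / 2) := by
          field_simp
        rw [this]
        have h10 : ((Cw * Cw + ‖e‖) * |Cx|) / K ≤ 1 := by
          rw [div_le_one hK0, hK]; linarith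
        nlinarith
      calc _ ≤ ‖star (w n) * w n * β (x s) - e * β (x s)‖ +
            ‖(star (w n) * w n - e) * β (x (b - s))‖ := by rw [h4]; exact norm_add_le _ _
        _ < ε / 2 + ε / 2 := by
          refine add_lt_add_of_lt_of_le h3 ((norm_mul_le _ _).trans (le_trans ?_ h9))
          gcongr
        _ = ε := by ring
    have h1 : Tendsto (fun n => star (w n) * w n * β (x a) * (star (w n) * w n * β (x (star a))))
        atTop (𝓝 (e * β (x a) * (e * β (x (star a))))) := (hT a).mul (hT (star a))
    have h2 : Tendsto (fun n => star (w n) * w n * β (x a) * (star (w n) * w n * β (x (star a))))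
        atTop (𝓝 0) := by
      rw [tendsto_zero_iff_norm_tendsto_zero]
      have h3 : Tendsto (fun n => Cw * ‖θ n a‖ * (Cw * ‖β (x (star a))‖)) atTop (𝓝 0) := by
        have := (((tendsto_zero_iff_norm_tendsto_zero.1 ha).const_mul Cw).mul_const
          (Cw * ‖β (x (star a))‖))
        simpa using this
      refine squeeze_zero (fun _ => norm_nonneg _) (fun n => ?_) h3
      have h4 : star (w n) * w n * β (x a) * (star (w n) * w n * β (x (star a))) =
          star (w n) * θ n a * (w n * β (x (star a))) := by
        rw [hθ, hg, map_zero, add_zero]; simp only [mul_assoc]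
      rw [h4]
      have := hCw n
      calc _ ≤ ‖star (w n) * θ n a‖ * ‖w n * β (x (star a))‖ := norm_mul_le _ _
        _ ≤ (‖star (w n)‖ * ‖θ n a‖) * (‖w n‖ * ‖β (x (star a))‖) := by
          gcongr <;> exact norm_mul_le _ _
        _ ≤ _ := by rw [norm_star]; gcongr
    have h3 := tendsto_nhds_unique h1 h2
    have h4 : e * β (x a) * star (e * β (x a)) = 0 := by
      rw [star_mul, hes, ← map_star, ← hxs, hec]; exact h3
    exact hei _ ((CStarRing.mul_star_self_eq_zero_iff _).1 h4)

end asm10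

end part10

section part11

open Filter Topology

section yseq
variable {A : Type*} [NonUnitalCStarAlgebra A]

theorem approx_filter (A : Type*) [NonUnitalCStarAlgebra A] : ∃ l : Filter A, l.NeBot ∧
    (∀ a : A, Tendsto (fun u => u * a) l (𝓝 a)) ∧ (∀ a : A, Tendsto (fun u => a * u) l (𝓝 a)) ∧
    (∀ᶠ u in l, ‖u‖ ≤ 1) ∧ (∀ᶠ u in l, star u = u) := by
  letI := CStarAlgebra.spectralOrder A
  haveI := CStarAlgebra.spectralOrderedRing A
  have h := CStarAlgebra.increasingApproximateUnit A
  exact ⟨_, h.neBot, h.tendsto_mul_right, h.tendsto_mul_left, h.eventually_norm,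
    h.eventually_star_eq⟩

theorem unif_approx (l : Filter A) (h1 : ∀ a : A, Tendsto (fun u => u * a) l (𝓝 a))
    (hn : ∀ᶠ u in l, ‖u‖ ≤ 1) (x : C(I01, A)) (δ : ℝ) (hδ : 0 < δ) :
    ∀ᶠ u in l, ∀ t, ‖u * x t - x t‖ ≤ δ := by
  have hc : IsCompact (Set.range x) := isCompact_range x.continuous
  obtain ⟨T, hT, hTf, hTc⟩ := hc.finite_cover_balls (e := δ / 3) (by positivity)
  have h2 : ∀ᶠ u in l, ∀ p ∈ T, ‖u * p - p‖ < δ / 3 := by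
    rw [eventually_all_finite hTf]
    intro p _
    have := (Metric.tendsto_nhds.1 (h1 p)) (δ / 3) (by positivity)
    simpa [dist_eq_norm] using this
  filter_upwards [h2, hn] with u hu hu1 t
  obtain ⟨p, hp, hpt⟩ := Set.mem_iUnion₂.1 (hTc ⟨t, rfl⟩)
  rw [Metric.mem_ball, dist_eq_norm] at hpt
  have h3 : u * x t - x t = u * (x t - p) + (u * p - p) - (x t - p) := by
    rw [mul_sub]; abel
  have h4 : ‖u * (x t - p)‖ ≤ δ / 3 := by
    calc _ ≤ ‖u‖ * ‖x t - p‖ := norm_mul_le _ _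
      _ ≤ 1 * (δ / 3) := by gcongr
      _ = _ := one_mul _
  rw [h3]
  calc _ ≤ ‖u * (x t - p)‖ + ‖u * p - p‖ + ‖x t - p‖ :=
        (norm_sub_le _ _).trans (by gcongr; exact norm_add_le _ _)
    _ ≤ δ / 3 + δ / 3 + δ / 3 := by gcongr; exact (hu p hp).le
    _ = δ := by ring

theorem hk_approx (x : C(I01, A)) (hx : x ∈ coneAlg A) (δ : ℝ) (hδ : 0 < δ) :
    ∀ᶠ k : ℕ in atTop, ∀ t : I01, (1 - min 1 (k * (1 - (t : ℝ)))) * ‖x t‖ ≤ δ := by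
  have hx1 : x onePt = 0 := hx
  have h1 := Metric.continuousAt_iff.1 (x.continuous.continuousAt (x := onePt)) δ hδ
  obtain ⟨η, hη, h⟩ := h1
  filter_upwards [(tendsto_natCast_atTop_atTop (R := ℝ)).eventually_ge_atTop (1 / η)] with k hk t
  by_cases ht : dist t onePt < η
  · have h2 := h ht
    rw [hx1, dist_zero_right] at h2
    have ht1 : (t : ℝ) ≤ 1 := t.2.2
    have h3 : 0 ≤ min 1 (k * (1 - (t : ℝ))) := le_min zero_le_one (by
      have : 0 ≤ 1 - (t : ℝ) := by linarith
      positivity)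
    nlinarith [norm_nonneg (x t)]
  · have ht1 : (t : ℝ) ≤ 1 := t.2.2
    have h4 : η ≤ 1 - (t : ℝ) := by
      rw [Subtype.dist_eq, Real.dist_eq] at ht
      change ¬ |(t : ℝ) - 1| < η at ht
      rw [abs_of_nonpos (by linarith)] at ht
      linarith
    have h5 : 1 ≤ k * (1 - (t : ℝ)) := by
      calc (1 : ℝ) = 1 / η * η := by field_simp
        _ ≤ _ := by gcongr
    rw [min_eq_left h5]; simpa using hδ.le

theorem exists_y (Xs : Finset C(I01, A)) (hX : ∀ x ∈ Xs, x ∈ coneAlg A) (Bs : Finset A) (δ : ℝ)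
    (hδ : 0 < δ) :
    ∃ y : C(I01, A), y ∈ coneAlg A ∧ star y = y ∧ ‖y‖ ≤ 1 ∧ (∀ x ∈ Xs, ‖y * x - x‖ ≤ δ) ∧
      ∀ c ∈ Bs, ‖y * ContinuousMap.const _ c - ContinuousMap.const _ c * y‖ ≤ δ := by
  obtain ⟨l, hl, hr, hlft, hn, hs⟩ := approx_filter A
  have e1 : ∀ᶠ u in l, ∀ x ∈ Xs, ∀ t, ‖u * x t - x t‖ ≤ δ / 2 := by
    rw [eventually_all_finset]
    intro x _
    exact unif_approx l hr hn x (δ / 2) (by positivity)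
  have e2 : ∀ᶠ u in l, ∀ c ∈ Bs, ‖u * c - c * u‖ < δ := by
    rw [eventually_all_finset]
    intro c _
    have := (hr c).sub (hlft c)
    rw [sub_self] at this
    have := (Metric.tendsto_nhds.1 this) δ hδ
    simpa [dist_eq_norm] using this
  have e3 : ∀ᶠ k : ℕ in atTop, ∀ x ∈ Xs, ∀ t : I01,
      (1 - min 1 (k * (1 - (t : ℝ)))) * ‖x t‖ ≤ δ / 2 := by
    rw [eventually_all_finset]
    intro x hx
    exact hk_approx x (hX x hx) (δ / 2) (by positivity)
  obtain ⟨u, hu1, hu2, hun, hus⟩ := (e1.and (e2.and (hn.and hs))).exists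
  obtain ⟨k, hk⟩ := e3.exists
  obtain ⟨h, hh⟩ : ∃ h : C(I01, ℝ), ∀ t, h t = min 1 (k * (1 - (t : ℝ))) :=
    ⟨⟨fun t => min 1 (k * (1 - (t : ℝ))), by fun_prop⟩, fun t => rfl⟩
  have h0 : ∀ t, 0 ≤ h t := fun t => by
    rw [hh]
    have : (t : ℝ) ≤ 1 := t.2.2
    have : 0 ≤ 1 - (t : ℝ) := by linarith
    exact le_min zero_le_one (by positivity)
  have h1 : ∀ t, h t ≤ 1 := fun t => by rw [hh]; exact min_le_left _ _
  obtain ⟨y, hy⟩ : ∃ y : C(I01, A), ∀ t, y t = ((h t : ℝ) : ℂ) • u :=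
    ⟨⟨fun t => ((h t : ℝ) : ℂ) • u, by fun_prop⟩, fun t => rfl⟩
  have hnn : ∀ t, ‖((h t : ℝ) : ℂ)‖ = h t := fun t => by
    rw [Complex.norm_real, Real.norm_of_nonneg (h0 t)]
  refine ⟨y, ?_, ?_, ?_, ?_, ?_⟩
  · change y onePt = 0
    rw [hy, hh]; simp [onePt]
  · ext t
    rw [ContinuousMap.star_apply, hy, star_smul, hus]; simp
  · rw [ContinuousMap.norm_le _ zero_le_one]
    intro t
    rw [hy, norm_smul, hnn]
    nlinarith [h0 t, h1 t, norm_nonneg u]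
  · intro x hx
    rw [ContinuousMap.norm_le _ hδ.le]
    intro t
    rw [ContinuousMap.sub_apply, ContinuousMap.mul_apply, hy]
    have q1 : ((h t : ℝ) : ℂ) • u * x t - x t =
        ((h t : ℝ) : ℂ) • (u * x t - x t) - (((1 - h t : ℝ)) : ℂ) • x t := by
      rw [smul_mul_assoc]; push_cast; module
    have q2 := hu1 x hx t
    have q3 := hk x hx t
    rw [q1]
    refine (norm_sub_le _ _).trans ?_
    rw [norm_smul, norm_smul, hnn, Complex.norm_real, Real.norm_of_nonneg (by linarith [h1 t])]
    rw [← hh] at q3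
    nlinarith [h0 t, h1 t, norm_nonneg (u * x t - x t)]
  · intro c hc
    rw [ContinuousMap.norm_le _ hδ.le]
    intro t
    rw [ContinuousMap.sub_apply, ContinuousMap.mul_apply, ContinuousMap.mul_apply, hy,
      ContinuousMap.const_apply, smul_mul_assoc, mul_smul_comm, ← smul_sub, norm_smul, hnn]
    have := hu2 c hc
    nlinarith [h0 t, h1 t, norm_nonneg (u * c - c * u)]

theorem const_mul_mem (c : A) (x : C(I01, A)) (hx : x ∈ coneAlg A) :
    ContinuousMap.const I01 c * x ∈ coneAlg A := by
  have hx1 : x onePt = 0 := hx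
  change (ContinuousMap.const I01 c * x) onePt = 0
  rw [ContinuousMap.mul_apply, hx1, mul_zero]

theorem exists_yseq (x : ℕ → C(I01, A)) (hx : ∀ i, x i ∈ coneAlg A) (b : ℕ → A) :
    ∃ y : ℕ → C(I01, A), (∀ n, y n ∈ coneAlg A) ∧ (∀ n, star (y n) = y n) ∧ (∀ n, ‖y n‖ ≤ 1) ∧
      ∀ n i j, i ≤ n → j ≤ n → (‖y (n + 1) * x i - x i‖ ≤ (1 / 4 : ℝ) ^ n ∧
        ‖y (n + 1) * (ContinuousMap.const _ (b i) * x j) - ContinuousMap.const _ (b i) * x j‖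
          ≤ (1 / 4 : ℝ) ^ n ∧
        ‖y (n + 1) * ContinuousMap.const _ (b i) - ContinuousMap.const _ (b i) * y (n + 1)‖
          ≤ (1 / 4 : ℝ) ^ n ∧
        ‖y (n + 1) * y n - y n‖ ≤ (1 / 4 : ℝ) ^ n ∧
        ‖y (n + 1) * (ContinuousMap.const _ (b i) * y n) - ContinuousMap.const _ (b i) * y n‖
          ≤ (1 / 4 : ℝ) ^ n) := by
  classical
  have step : ∀ (n : ℕ) (z : coneAlg A), ∃ y : coneAlg A, star (y : C(I01, A)) = y ∧
      ‖(y : C(I01, A))‖ ≤ 1 ∧ ∀ i j, i ≤ n → j ≤ n →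
      (‖(y : C(I01, A)) * x i - x i‖ ≤ (1 / 4 : ℝ) ^ n ∧
        ‖(y : C(I01, A)) * (ContinuousMap.const _ (b i) * x j) - ContinuousMap.const _ (b i) * x j‖
          ≤ (1 / 4 : ℝ) ^ n ∧
        ‖(y : C(I01, A)) * ContinuousMap.const _ (b i) - ContinuousMap.const _ (b i) * (y : C(I01, A))‖
          ≤ (1 / 4 : ℝ) ^ n ∧
        ‖(y : C(I01, A)) * z - z‖ ≤ (1 / 4 : ℝ) ^ n ∧
        ‖(y : C(I01, A)) * (ContinuousMap.const _ (b i) * (z : C(I01, A))) - ContinuousMap.const _ (b i) * (z : C(I01, A))‖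
          ≤ (1 / 4 : ℝ) ^ n) := by
    intro n z
    let r := Finset.range (n + 1)
    obtain ⟨y, h1, h2, h3, h4, h5⟩ := exists_y
      (r.image x ∪ (r ×ˢ r).image (fun p => ContinuousMap.const _ (b p.1) * x p.2) ∪ {(z : C(I01, A))}
        ∪ r.image (fun i => ContinuousMap.const _ (b i) * (z : C(I01, A))))
      (by
        intro w hw
        simp only [Finset.mem_union, Finset.mem_image, Finset.mem_singleton] at hw
        rcases hw with ((⟨i, _, rfl⟩ | ⟨p, _, rfl⟩) | rfl) | ⟨i, _, rfl⟩
        · exact hx i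
        · exact const_mul_mem _ _ (hx _)
        · exact z.2
        · exact const_mul_mem _ _ z.2) (r.image b) ((1 / 4 : ℝ) ^ n) (by positivity)
    refine ⟨⟨y, h1⟩, h2, h3, fun i j hi hj => ?_⟩
    have hi' : i ∈ r := Finset.mem_range.2 (by omega)
    have hj' : j ∈ r := Finset.mem_range.2 (by omega)
    refine ⟨h4 _ ?_, h4 _ ?_, h5 _ (Finset.mem_image_of_mem _ hi'), h4 _ ?_, h4 _ ?_⟩
    · simp only [Finset.mem_union]
      exact Or.inl (Or.inl (Or.inl (Finset.mem_image_of_mem _ hi')))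
    · simp only [Finset.mem_union]
      exact Or.inl (Or.inl (Or.inr (Finset.mem_image.2
        ⟨(i, j), Finset.mk_mem_product hi' hj', rfl⟩)))
    · simp
    · simp only [Finset.mem_union]
      exact Or.inr (Finset.mem_image.2 ⟨i, hi', rfl⟩)
  choose Y hY1 hY2 hY3 using step
  let y : ℕ → coneAlg A := fun n => Nat.rec 0 (fun n z => Y n z) n
  have hy : ∀ n, y (n + 1) = Y n (y n) := fun n => rfl
  refine ⟨fun n => (y n).1, fun n => (y n).2, fun n => ?_, fun n => ?_, fun n i j hi hj => ?_⟩
  · cases n with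
    | zero => exact star_zero _
    | succ n => exact hY1 _ _
  · cases n with
    | zero => change ‖(0 : C(I01, A))‖ ≤ 1; simp
    | succ n => exact hY2 _ _
  · exact hY3 n (y n) i j hi hj

end yseq

end part11

section part12

open Filter Topology Asymptotics
open scoped InnerProductSpace

section stage12

theorem dil_n {Bu : Type*} {P D : Type} [CStarAlgebra Bu] [CStarAlgebra P] [CStarAlgebra D]
    [Nontrivial D] (j : Bu →⋆ₐ[ℂ] P) (hj : Function.Injective j) (m : Bu →ₗ[ℂ] D)
    (hm : ∀ z z', star (m z) * m z' = star (m 1) * m (star z * z'))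
    (Dk : ℕ → StarSubalgebra ℂ D) (hDm : Monotone Dk) (hDf : ∀ k, FiniteDimensional ℂ (Dk k))
    (hDd : ∀ d : D, ∃ l : ℕ → D, (∀ n, l n ∈ Dk n) ∧ Tendsto l atTop (𝓝 d))
    (Z : Finset Bu) (ε : ℝ) (hε : 0 < ε) :
    ∃ (r : HRep P) (n : ℕ) (ξ : Fin n → r.H) (d : Fin n → D), (∃ k, ∀ i, d i ∈ Dk k) ∧
      ∀ z ∈ Z, ‖(∑ i, ∑ k, ⟪ξ i, r.π (j z) (ξ k)⟫_ℂ • (star (d i) * d k))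
        - star (m 1) * m z‖ ≤ ε := by
  obtain ⟨R, hR⟩ := exists_faithful D
  have hinj : Function.Injective R.π := by
    rw [injective_iff_map_eq_zero]
    intro d hd
    obtain ⟨v, hv⟩ := hR (Submodule.span ℂ {d}) inferInstance
    exact hv d (Submodule.mem_span_singleton_self d) (by rw [hd]; rfl)
  have h1 : ∀ᶠ k in atTop, ∀ z ∈ Z, ∃ c ∈ Dk k, ‖star (m 1) * m z - c‖ ≤ ε / 2 := by
    rw [eventually_all_finset]
    intro z _
    obtain ⟨l, hl, hlt⟩ := hDd (star (m 1) * m z)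
    filter_upwards [(Metric.tendsto_nhds.1 hlt) (ε / 2) (by positivity)] with k hk
    refine ⟨l k, hl k, ?_⟩
    rw [dist_comm, dist_eq_norm] at hk
    exact hk.le
  obtain ⟨k, hk⟩ := h1.exists
  obtain ⟨v, hv⟩ := hR (Subalgebra.toSubmodule (Dk k).toSubalgebra) (hDf k)
  haveI := hDf k
  obtain ⟨r, n, ξ, d, hd, h⟩ := lemDil j hj m hm R hinj (Dk k) v hv
  refine ⟨r, n, ξ, d, ⟨k, hd⟩, fun z hz => ?_⟩
  obtain ⟨c, hc, hcn⟩ := hk z hz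
  have := h z c hc
  linarith

theorem stage {A : Type*} [NonUnitalCStarAlgebra A] {Bu : Type*} {P D : Type} [CStarAlgebra Bu]
    [CStarAlgebra P] [CStarAlgebra D] [Nontrivial D] [Nontrivial P]
    (j : Bu →⋆ₐ[ℂ] P) (hj : Function.Injective j) (f : A →⋆ₙₐ[ℂ] Bu)
    (Dk : ℕ → StarSubalgebra ℂ D) (hDm : Monotone Dk) (hDf : ∀ k, FiniteDimensional ℂ (Dk k))
    (F : ℕ → StarSubalgebra ℂ P) (hFm : Monotone F) (hFf : ∀ k, FiniteDimensional ℂ (F k))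
    (hDd : ∀ d : D, ∃ l : ℕ → D, (∀ n, l n ∈ Dk n) ∧ Tendsto l atTop (𝓝 d))
    (hFd : ∀ d : P, ∃ l : ℕ → P, (∀ n, l n ∈ F n) ∧ Tendsto l atTop (𝓝 d))
    (y : ℕ → D) (m : ℕ → Bu →ₗ[ℂ] D) (hm1 : ∀ n, m n 1 = y n)
    (hm : ∀ n z z', star (m n z) * m n z' = star (m n 1) * m n (star z * z'))
    (x : A →ₗ[ℂ] D) (hxs : ∀ a, x (star a) = star (x a))
    (Cx : ℝ) (hxb : ∀ a, ‖x a‖ ≤ Cx * ‖a‖) (l : A → A → D)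
    (hx2 : ∀ a a', x (a * a') = x a * x a' + star (l (star a') (star a)) + l a a')
    (hgx : ∀ a, f a = 0 → x a = 0 → a = 0)
    (s : ℕ → A) (hS : DenseRange s) (hSs : ∀ a ∈ Set.range s, star a ∈ Set.range s)
    (hys : ∀ n, star (y n) = y n) (hyn : ∀ n, ‖y n‖ ≤ 1)
    (hμb : ∀ a, Bd (fun n => m n (f a)))
    (H1 : ∀ a ∈ Set.range s, AE (1 / 4) (y * fun _ => x a) (fun _ => x a))
    (H2 : ∀ a ∈ Set.range s, ∀ a' ∈ Set.range s,
      AE (1 / 4) (y * fun _ => l a a') (fun _ => l a a'))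
    (H3 : ∀ a ∈ Set.range s, ∀ a' ∈ Set.range s,
      AE (1 / 4) ((fun n => m n (f a)) * fun _ => x a') (fun _ => l a a'))
    (H4 : ∀ a ∈ Set.range s, AE (1 / 4) ((fun n => m n (f a)) * y) (y * (fun n => m n (f a))))
    (H4' : ∀ a ∈ Set.range s, AE (1 / 4) (star (fun n => m n (f (star a)))) (fun n => m n (f a)))
    (H5 : ∀ a ∈ Set.range s, AE (1 / 4) ((fun n => m (n + 1) (f a)) * y) (fun n => m n (f a)))
    (H6 : ∀ a ∈ Set.range s, AE (1 / 4) ((fun n => y (n + 1)) * (fun n => m n (f a)))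
      (fun n => m n (f a))) :
    IsAFEmbeddable A := by
  classical
  have hc : ∀ n, ∃ c : D, (∃ k, c ∈ Dk k) ∧ ‖c - y n‖ ≤ (1 / 4 : ℝ) ^ n := by
    intro n
    obtain ⟨l, hl, hlt⟩ := hDd (y n)
    obtain ⟨k, hk⟩ := ((Metric.tendsto_nhds.1 hlt) ((1 / 4 : ℝ) ^ n) (by positivity)).exists
    exact ⟨l k, ⟨k, hl k⟩, by rw [← dist_eq_norm]; exact hk.le⟩
  choose c hcD hcy using hc
  have hd := fun n => dil_n j hj (m n) (hm n) Dk hDm hDf hDd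
    ({1} ∪ (Finset.range (n + 1)).image (fun i => f (s i)) ∪
      (Finset.range (n + 1)).image (fun i => star (f (s i)) * f (s i))) ((1 / 4 : ℝ) ^ n)
      (by positivity)
  choose r N ξ d hdD hdn using hd
  obtain ⟨M, iM, β, π, e, w, L, hes, hec, hei, hwe, hww, hwp, hLm, hLf, hL1, hL2, hπn⟩ :=
    exists_asm Dk hDm hDf F hFm hFf r N ξ d hdD c hcD
  have hE : ∀ n z, ‖(∑ i, ∑ k, ⟪ξ n i, (r n).π (j z) (ξ n k)⟫_ℂ • (star (d n i) * d n k))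
      - star (m n 1) * m n z‖ ≤ (1 / 4 : ℝ) ^ n →
      ‖star (w n) * π (j z) * w n - e * β (star (m n 1) * m n z)‖ ≤ ‖e‖ * (1 / 4 : ℝ) ^ n := by
    intro n z hz
    rw [hwp, ← mul_sub, ← map_sub]
    refine (norm_mul_le _ _).trans ?_
    gcongr
    exact (NonUnitalStarAlgHom.norm_apply_le β _).trans hz
  refine final_asm Dk F hDd hFd y c β π e w L hes hec hei hwe hww hLm hLf hL1 hL2 hπn
    ((j : Bu →⋆ₙₐ[ℂ] P).comp f) x hxs Cx hxb l hx2 ?_ (Set.range s) hS hSs hys hyn ?_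
    (fun a n => m n (f a)) hμb H1 H2 H3 H4 H4' H5 H6 ?_ ?_ ?_
  · intro a ha hx
    refine hgx a ?_ hx
    have : j (f a) = j 0 := by rw [map_zero]; exact ha
    exact hj this
  · exact Sm.of_le 1 (Eventually.of_forall fun n => by rw [one_mul]; exact hcy n) (by norm_num)
  · refine Sm.of_le ‖e‖ (Eventually.of_forall fun n => ?_) (by norm_num)
    have := hE n 1 (hdn n 1 (by simp))
    rw [map_one, map_one, mul_one, hm1, hys] at this
    exact this
  · rintro a ⟨i, rfl⟩
    refine Sm.of_le ‖e‖ ?_ (by norm_num)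
    filter_upwards [eventually_ge_atTop i] with n hn
    have := hE n (f (s i)) (hdn n _ (by
      simp only [Finset.mem_union]
      exact Or.inl (Or.inr (Finset.mem_image.2 ⟨i, Finset.mem_range.2 (by omega), rfl⟩))))
    rw [hm1, hys] at this
    exact this
  · rintro a ⟨i, rfl⟩
    refine Sm.of_le ‖e‖ ?_ (by norm_num)
    filter_upwards [eventually_ge_atTop i] with n hn
    have := hE n (star (f (s i)) * f (s i)) (hdn n _ (by
      simp only [Finset.mem_union]
      exact Or.inr (Finset.mem_image.2 ⟨i, Finset.mem_range.2 (by omega), rfl⟩)))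
    rw [← hm, map_mul j, map_star j] at this
    exact this

theorem unitize_af {D0 : Type} [NonUnitalCStarAlgebra D0]
    (Dk : ℕ → NonUnitalStarSubalgebra ℂ D0) (hm : Monotone Dk)
    (hf : ∀ k, FiniteDimensional ℂ (Dk k)) (hd : Dense (⋃ k, (Dk k : Set D0))) :
    ∃ Dk' : ℕ → StarSubalgebra ℂ (Unitization ℂ D0), Monotone Dk' ∧
      (∀ k, FiniteDimensional ℂ (Dk' k)) ∧
      ∀ d : Unitization ℂ D0, ∃ l : ℕ → Unitization ℂ D0, (∀ n, l n ∈ Dk' n) ∧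
        Tendsto l atTop (𝓝 d) := by
  classical
  let Dk' : ℕ → StarSubalgebra ℂ (Unitization ℂ D0) := fun k =>
    { carrier := {z | z.snd ∈ Dk k}
      mul_mem' := by
        intro a b ha hb
        change (a * b).snd ∈ Dk k
        rw [Unitization.snd_mul]
        exact add_mem (add_mem (SMulMemClass.smul_mem (S := NonUnitalStarSubalgebra ℂ D0) _ hb) (SMulMemClass.smul_mem (S := NonUnitalStarSubalgebra ℂ D0) _ ha)) (mul_mem ha hb)
      add_mem' := by
        intro a b ha hb
        exact add_mem (S := NonUnitalStarSubalgebra ℂ D0) ha hb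
      algebraMap_mem' := by
        intro r
        change (algebraMap ℂ (Unitization ℂ D0) r).snd ∈ Dk k
        rw [Unitization.algebraMap_eq_inl]
        exact zero_mem _
      star_mem' := by
        intro a ha
        exact star_mem (S := NonUnitalStarSubalgebra ℂ D0) ha }
  have hmem : ∀ k z, z ∈ Dk' k ↔ z.snd ∈ Dk k := fun k z => Iff.rfl
  refine ⟨Dk', fun a b hab z hz => hm hab hz, fun k => ?_, fun d => ?_⟩
  · haveI := hf k
    let T : Dk' k →ₗ[ℂ] ℂ × Dk k :=
      { toFun := fun z => (z.1.fst, ⟨z.1.snd, z.2⟩)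
        map_add' := fun a b => rfl
        map_smul' := fun a b => rfl }
    refine FiniteDimensional.of_injective T ?_
    intro a b hab
    have h1 := congrArg Prod.fst hab
    have h2 := congrArg (fun p => (p.2 : D0)) hab
    exact Subtype.ext (Unitization.ext h1 h2)
  · -- approximate the second component
    have happ : ∀ ε > 0, ∀ᶠ k in atTop, ∃ c ∈ Dk k, ‖c - d.snd‖ < ε := by
      intro ε hε
      obtain ⟨c, hc1, hc2⟩ := Metric.dense_iff.1 hd d.snd ε hε
      obtain ⟨k, hk⟩ := Set.mem_iUnion.1 hc2
      filter_upwards [eventually_ge_atTop k] with k' hk'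
      exact ⟨c, hm hk' hk, by rw [← dist_eq_norm]; exact hc1⟩
    -- near-best approximation
    have hbest : ∀ k, ∃ c ∈ Dk k, ∀ c' ∈ Dk k, ‖c - d.snd‖ ≤ ‖c' - d.snd‖ + 1 / ((k : ℝ) + 1) := by
      intro k
      let V : Set ℝ := (fun c => ‖c - d.snd‖) '' (Dk k : Set D0)
      have hV : V.Nonempty := ⟨_, 0, zero_mem _, rfl⟩
      have hVb : BddBelow V := ⟨0, by rintro _ ⟨c, _, rfl⟩; exact norm_nonneg _⟩
      obtain ⟨_, ⟨c, hc, rfl⟩, hlt⟩ := exists_lt_of_csInf_lt hV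
        (lt_add_of_pos_right (sInf V) (show 0 < 1 / ((k : ℝ) + 1) by positivity))
      refine ⟨c, hc, fun c' hc' => hlt.le.trans ?_⟩
      gcongr
      exact csInf_le hVb ⟨c', hc', rfl⟩
    choose c hc hcb using hbest
    have hct : Tendsto c atTop (𝓝 d.snd) := by
      rw [Metric.tendsto_nhds]
      intro ε hε
      filter_upwards [happ (ε / 2) (by positivity),
        (tendsto_one_div_add_atTop_nhds_zero_nat (𝕜 := ℝ)).eventually_lt_const
          (show (0 : ℝ) < ε / 2 by positivity)] with k hk hk2
      obtain ⟨c', hc', hn⟩ := hk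
      rw [dist_eq_norm]
      have := hcb k c' hc'
      linarith
    refine ⟨fun n => Unitization.inl d.fst + (c n : Unitization ℂ D0), fun n => ?_, ?_⟩
    · rw [hmem]; simpa using hc n
    · have h1 := (Unitization.continuous_inr (𝕜 := ℂ) (A := D0)).tendsto d.snd
      have h2 := (h1.comp hct).const_add (Unitization.inl d.fst)
      rw [Unitization.inl_fst_add_inr_snd_eq] at h2
      exact h2

end stage12

end part12

section part13

open Filter Topology Asymptotics

section stage13
variable {A : Type*} [NonUnitalCStarAlgebra A]

/-- left multiplication of the cone by a constant -/
def cm (b : A) (z : coneAlg A) : coneAlg A :=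
  ⟨ContinuousMap.const I01 b * z.1, const_mul_mem b z.1 z.2⟩

theorem cm_apply (b : A) (z : coneAlg A) (t : I01) : (cm b z).1 t = b * z.1 t := rfl

theorem cone_ext {z z' : coneAlg A} (h : ∀ t, z.1 t = z'.1 t) : z = z' :=
  Subtype.ext (ContinuousMap.ext h)

theorem cone_mul_apply (z z' : coneAlg A) (t : I01) : (z * z').1 t = z.1 t * z'.1 t := rfl
theorem cone_add_apply (z z' : coneAlg A) (t : I01) : (z + z').1 t = z.1 t + z'.1 t := rfl
theorem cone_sub_apply (z z' : coneAlg A) (t : I01) : (z - z').1 t = z.1 t - z'.1 t := rfl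
theorem cone_star_apply (z : coneAlg A) (t : I01) : (star z).1 t = star (z.1 t) := rfl
theorem cone_smul_apply (c : ℂ) (z : coneAlg A) (t : I01) : (c • z).1 t = c • z.1 t := rfl

theorem cm_norm (b : A) (z : coneAlg A) : ‖(cm b z).1‖ ≤ ‖b‖ * ‖z.1‖ := by
  rw [ContinuousMap.norm_le _ (by positivity)]
  intro t
  rw [cm_apply]
  exact (norm_mul_le _ _).trans (by gcongr; exact z.1.norm_coe_le_norm t)

theorem cone_closed : IsClosed ((coneAlg A : NonUnitalStarSubalgebra ℂ C(I01, A)) : Set C(I01, A)) := by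
  have : Continuous fun f : C(I01, A) => f onePt := ContinuousEvalConst.continuous_eval_const _
  exact isClosed_singleton.preimage this (t := {(0 : A)})

theorem stage2 {B : Type*} [NonUnitalCStarAlgebra B] [TopologicalSpace.SeparableSpace A]
    {P D : Type} [CStarAlgebra P] [CStarAlgebra D] [Nontrivial D] [Nontrivial P]
    (j : Unitization ℂ B →⋆ₐ[ℂ] P) (hj : Function.Injective j)
    (σ : coneAlg A →⋆ₙₐ[ℂ] D) (hσ : Function.Injective σ) (hσn : ∀ z, ‖σ z‖ ≤ ‖z.1‖)
    (Dk : ℕ → StarSubalgebra ℂ D) (hDm : Monotone Dk) (hDf : ∀ k, FiniteDimensional ℂ (Dk k))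
    (F : ℕ → StarSubalgebra ℂ P) (hFm : Monotone F) (hFf : ∀ k, FiniteDimensional ℂ (F k))
    (hDd : ∀ d : D, ∃ l : ℕ → D, (∀ n, l n ∈ Dk n) ∧ Tendsto l atTop (𝓝 d))
    (hFd : ∀ d : P, ∃ l : ℕ → P, (∀ n, l n ∈ F n) ∧ Tendsto l atTop (𝓝 d))
    (φ : A →⋆ₙₐ[ℂ] B) (ψ : B →⋆ₙₐ[ℂ] A) (γ : I01 → (A →⋆ₙₐ[ℂ] A))
    (hcont : ∀ a : A, Continuous fun t : I01 => γ t a)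
    (z0 : I01) (h0 : γ z0 = NonUnitalStarAlgHom.id ℂ A) (h1 : γ onePt = ψ.comp φ) :
    IsAFEmbeddable A := by
  have hq : ∀ a, γ onePt a = ψ (φ a) := fun a => by rw [h1]; rfl
  -- the cone-valued linear map
  let xl : A →ₗ[ℂ] coneAlg A :=
    { toFun := fun a => ⟨⟨fun t => γ t a - ψ (φ a), (hcont a).sub continuous_const⟩, by
        change γ onePt a - ψ (φ a) = 0
        rw [hq, sub_self]⟩
      map_add' := fun a b => cone_ext fun t => by
        rw [cone_add_apply]
        change γ t (a + b) - ψ (φ (a + b)) = (γ t a - ψ (φ a)) + (γ t b - ψ (φ b))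
        simp only [map_add]; abel
      map_smul' := fun c a => cone_ext fun t => by
        rw [RingHom.id_apply, cone_smul_apply]
        change γ t (c • a) - ψ (φ (c • a)) = c • (γ t a - ψ (φ a))
        simp only [map_smul, smul_sub] }
  have hxl : ∀ a t, (xl a).1 t = γ t a - ψ (φ a) := fun a t => rfl
  have hxln : ∀ a, ‖(xl a).1‖ ≤ 2 * ‖a‖ := by
    intro a
    rw [ContinuousMap.norm_le _ (by positivity)]
    intro t
    rw [hxl, two_mul]
    refine (norm_sub_le _ _).trans (add_le_add (NonUnitalStarAlgHom.norm_apply_le (γ t) a) ?_)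
    exact (NonUnitalStarAlgHom.norm_apply_le ψ _).trans (NonUnitalStarAlgHom.norm_apply_le φ a)
  let σl : coneAlg A →ₗ[ℂ] D :=
    { toFun := σ, map_add' := map_add σ, map_smul' := fun c a => map_smul σ c a }
  have hσl : ∀ z, σl z = σ z := fun z => rfl
  -- the dense sequence
  obtain ⟨s, hs, hss⟩ : ∃ s : ℕ → A, DenseRange s ∧
      ∀ a ∈ Set.range s, star a ∈ Set.range s := by
    let u := TopologicalSpace.denseSeq A
    refine ⟨fun n => if n % 2 = 0 then u (n / 2) else star (u (n / 2)), ?_, ?_⟩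
    · refine (TopologicalSpace.denseRange_denseSeq A).mono ?_
      rintro _ ⟨n, rfl⟩
      exact ⟨2 * n, by simp [u]⟩
    · rintro _ ⟨n, rfl⟩
      by_cases hn : n % 2 = 0
      · refine ⟨n + 1, ?_⟩
        have e1 : (n + 1) % 2 ≠ 0 := by omega
        have e2 : (n + 1) / 2 = n / 2 := by omega
        simp only [hn, e1, e2, if_true, if_false]
      · refine ⟨n - 1, ?_⟩
        have e1 : (n - 1) % 2 = 0 := by omega
        have e2 : (n - 1) / 2 = n / 2 := by omega
        simp only [hn, e1, e2, if_true, if_false, star_star]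
  obtain ⟨y0, hy0, hy0s, hy0n, hY⟩ := exists_yseq (fun i => (xl (s i)).1) (fun i => (xl (s i)).2)
    (fun i => ψ (φ (s i)))
  obtain ⟨y, hy⟩ : ∃ y : ℕ → coneAlg A, ∀ n, (y n).1 = y0 n := ⟨fun n => ⟨y0 n, hy0 n⟩, fun n => rfl⟩
  simp only [← hy] at hy0 hy0s hy0n hY
  have hys : ∀ n, star (y n) = y n := fun n => Subtype.ext (hy0s n)
  have hys' : ∀ n t, star ((y n).1 t) = (y n).1 t := fun n t => by
    rw [← cone_star_apply, hys]
  let m : ℕ → Unitization ℂ B →ₗ[ℂ] D := fun n =>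
    { toFun := fun z => σ (z.fst • y n + cm (ψ z.snd) (y n))
      map_add' := fun z z' => by
        rw [← map_add]; congr 1
        refine cone_ext fun t => ?_
        simp only [cone_add_apply, cone_smul_apply, cm_apply, Unitization.fst_add,
          Unitization.snd_add, map_add, add_smul, add_mul]
        abel
      map_smul' := fun c z => by
        rw [RingHom.id_apply, ← map_smul]; congr 1
        refine cone_ext fun t => ?_
        simp only [cone_add_apply, cone_smul_apply, cm_apply, Unitization.fst_smul,
          Unitization.snd_smul, map_smul, smul_mul_assoc, smul_add, smul_eq_mul, mul_smul] }
  have hmd : ∀ n z, m n z = σ (z.fst • y n + cm (ψ z.snd) (y n)) := fun n z => rfl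
  have hm1 : ∀ n, m n 1 = σ (y n) := by
    intro n
    rw [hmd]; congr 1
    refine cone_ext fun t => ?_
    simp [cone_add_apply, cone_smul_apply, cm_apply]
  let f : A →⋆ₙₐ[ℂ] Unitization ℂ B := (Unitization.inrNonUnitalStarAlgHom ℂ B).comp φ
  have hfd : ∀ a, f a = (φ a : Unitization ℂ B) := fun a => rfl
  have hmf : ∀ n a, m n (f a) = σ (cm (ψ (φ a)) (y n)) := by
    intro n a
    rw [hmd, hfd]; congr 1
    refine cone_ext fun t => ?_
    simp [cone_add_apply, cone_smul_apply, cm_apply]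
  have hSm : ∀ (u : ℕ → coneAlg A) (C : ℝ) (N : ℕ),
      (∀ n ≥ N, ‖(u (n + 1)).1‖ ≤ C * (1 / 4 : ℝ) ^ n) → Sm (1 / 4) (fun n => σ (u n)) := by
    intro u C N h
    refine Sm.of_le (C * 4) ?_ (by norm_num)
    filter_upwards [eventually_ge_atTop (N + 1)] with n hn
    obtain ⟨k, rfl⟩ : ∃ k, n = k + 1 := ⟨n - 1, by omega⟩
    refine (hσn _).trans ((h k (by omega)).trans (le_of_eq ?_))
    rw [pow_succ]; ring
  have hψφ : ∀ a, ‖ψ (φ a)‖ ≤ ‖a‖ := fun a =>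
    (NonUnitalStarAlgHom.norm_apply_le ψ _).trans (NonUnitalStarAlgHom.norm_apply_le φ a)
  refine stage j hj f Dk hDm hDf F hFm hFf hDd hFd (fun n => σ (y n)) m hm1 ?_ (σl.comp xl) ?_
    2 ?_ (fun a a' => σ (cm (ψ (φ a)) (xl a'))) ?_ ?_ s hs hss ?_ ?_ ?_ ?_ ?_ ?_ ?_ ?_ ?_ ?_
  · -- hm
    intro n z z'
    rw [hm1, hmd, hmd, hmd, ← map_star, ← map_star, ← map_mul, ← map_mul]
    congr 1
    refine cone_ext fun t => ?_
    simp only [cone_add_apply, cone_smul_apply, cm_apply, cone_mul_apply, cone_star_apply,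
      Unitization.fst_mul, Unitization.snd_mul, Unitization.fst_star, Unitization.snd_star,
      star_add, star_smul, star_mul, map_add, map_smul, map_mul, map_star, hys']
    simp only [add_mul, mul_add, smul_mul_assoc, mul_smul_comm, smul_smul, mul_assoc, smul_add]
    module
  · -- hxs
    intro a
    change σ (xl (star a)) = star (σ (xl a))
    rw [← map_star]; congr 1
    refine cone_ext fun t => ?_
    rw [cone_star_apply, hxl, hxl, star_sub]; simp only [map_star]
  · intro a
    exact (hσn _).trans (hxln a)
  · -- hx2
    intro a a'
    change σ (xl (a * a')) = σ (xl a) * σ (xl a') + star (σ (cm _ (xl (star a)))) + _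
    rw [← map_star σ, ← map_mul, ← map_add, ← map_add]; congr 1
    refine cone_ext fun t => ?_
    simp only [cone_add_apply, cone_mul_apply, cone_star_apply, cm_apply, hxl, map_mul, map_star,
      star_mul, star_sub, star_star]
    noncomm_ring
  · -- injectivity
    intro a ha hx
    have hφ : φ a = 0 := Unitization.inr_injective (by rw [← hfd, ha]; rfl)
    have hx' : xl a = 0 := hσ (by rw [map_zero]; exact hx)
    have h2 : (xl a).1 z0 = 0 := by rw [hx']; rfl
    rw [hxl, hφ, map_zero, sub_zero, h0] at h2
    exact h2
  · intro n
    rw [← map_star, hys]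
  · intro n
    exact (hσn _).trans (hy0n n)
  · -- bounded
    intro a
    refine Bd.of_le ‖a‖ fun n => ?_
    rw [hmf]
    refine (hσn _).trans ((cm_norm _ _).trans ?_)
    calc _ ≤ ‖a‖ * 1 := by gcongr <;> first | exact hψφ a | exact hy0n n
      _ = _ := mul_one _
  · -- H1
    rintro _ ⟨i, rfl⟩
    have := hSm (fun n => y n * xl (s i) - xl (s i)) 1 i fun n hn => by
      rw [one_mul]; exact (hY n i i hn hn).1
    simp only [map_sub, map_mul] at this
    exact this
  · -- H2
    rintro _ ⟨i, rfl⟩ _ ⟨k, rfl⟩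
    have := hSm (fun n => y n * cm (ψ (φ (s i))) (xl (s k)) - cm (ψ (φ (s i))) (xl (s k))) 1
      (max i k) fun n hn => by
      rw [one_mul]
      exact (hY n i k (le_trans (le_max_left _ _) hn) (le_trans (le_max_right _ _) hn)).2.1
    simp only [map_sub, map_mul] at this
    exact this
  · -- H3
    rintro _ ⟨i, rfl⟩ _ ⟨k, rfl⟩
    have := hSm (fun n => cm (ψ (φ (s i))) (y n) * xl (s k) - cm (ψ (φ (s i))) (xl (s k)))
      ‖s i‖ k fun n hn => by
      have e1 : cm (ψ (φ (s i))) (y (n + 1)) * xl (s k) - cm (ψ (φ (s i))) (xl (s k)) =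
          cm (ψ (φ (s i))) (y (n + 1) * xl (s k) - xl (s k)) := cone_ext fun t => by
        simp only [cone_sub_apply, cone_mul_apply, cm_apply]; noncomm_ring
      rw [e1]
      refine (cm_norm _ _).trans ?_
      gcongr
      · exact hψφ _
      · exact (hY n k k hn hn).1
    simp only [map_sub, map_mul, ← hmf] at this
    exact this
  · -- H4
    rintro _ ⟨i, rfl⟩
    have := hSm (fun n => cm (ψ (φ (s i))) (y n) * y n - y n * cm (ψ (φ (s i))) (y n))
      1 i fun n hn => by
      have e1 : (cm (ψ (φ (s i))) (y (n + 1)) * y (n + 1) -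
          y (n + 1) * cm (ψ (φ (s i))) (y (n + 1))).1 =
          -(((y (n + 1)).1 * ContinuousMap.const _ (ψ (φ (s i))) -
            ContinuousMap.const _ (ψ (φ (s i))) * (y (n + 1)).1) * (y (n + 1)).1) :=
        ContinuousMap.ext fun t => by
          simp only [cone_sub_apply, cone_mul_apply, cm_apply, ContinuousMap.neg_apply,
            ContinuousMap.mul_apply, ContinuousMap.sub_apply, ContinuousMap.const_apply]
          noncomm_ring
      rw [e1, norm_neg, one_mul]
      refine (norm_mul_le _ _).trans ?_
      calc _ ≤ (1 / 4 : ℝ) ^ n * 1 := by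
            gcongr
            · exact (hY n i i hn hn).2.2.1
            · exact hy0n _
        _ = _ := mul_one _
    simp only [map_sub, map_mul, ← hmf] at this
    exact this
  · -- H4 star
    rintro _ ⟨i, rfl⟩
    have := hSm (fun n => star (cm (ψ (φ (star (s i)))) (y n)) - cm (ψ (φ (s i))) (y n))
      1 i fun n hn => by
      have e1 : (star (cm (ψ (φ (star (s i)))) (y (n + 1))) - cm (ψ (φ (s i))) (y (n + 1))).1 =
          (y (n + 1)).1 * ContinuousMap.const _ (ψ (φ (s i))) -
            ContinuousMap.const _ (ψ (φ (s i))) * (y (n + 1)).1 :=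
        ContinuousMap.ext fun t => by
          simp only [cone_sub_apply, cone_star_apply, cm_apply, map_star, star_mul, star_star, hys',
            ContinuousMap.mul_apply, ContinuousMap.sub_apply, ContinuousMap.const_apply]
      rw [e1, one_mul]
      exact (hY n i i hn hn).2.2.1
    simp only [map_sub, map_star σ, ← hmf] at this
    exact this
  · -- H5
    rintro _ ⟨i, rfl⟩
    have := hSm (fun n => cm (ψ (φ (s i))) (y (n + 1)) * y n - cm (ψ (φ (s i))) (y n))
      ‖s i‖ 0 fun n hn => by
      have e1 : cm (ψ (φ (s i))) (y (n + 1 + 1)) * y (n + 1) - cm (ψ (φ (s i))) (y (n + 1)) =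
          cm (ψ (φ (s i))) (y (n + 1 + 1) * y (n + 1) - y (n + 1)) := cone_ext fun t => by
        simp only [cone_sub_apply, cone_mul_apply, cm_apply]; noncomm_ring
      rw [e1]
      refine (cm_norm _ _).trans ?_
      gcongr
      · exact hψφ _
      · refine ((hY (n + 1) 0 0 (by omega) (by omega)).2.2.2.1).trans ?_
        exact pow_le_pow_of_le_one (by norm_num) (by norm_num) (by omega)
    simp only [map_sub, map_mul, ← hmf] at this
    exact this
  · -- H6
    rintro _ ⟨i, rfl⟩
    have := hSm (fun n => y (n + 1) * cm (ψ (φ (s i))) (y n) - cm (ψ (φ (s i))) (y n))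
      1 i fun n hn => by
      rw [one_mul]
      refine ((hY (n + 1) i i (by omega) (by omega)).2.2.2.2).trans ?_
      exact pow_le_pow_of_le_one (by norm_num) (by norm_num) (by omega)
    simp only [map_sub, map_mul, ← hmf] at this
    exact this

end stage13

end part13

/-- if `A` is a separable C*-algebra whose cone is AF-embeddable and `A` is
homotopically dominated by an AF-embeddable C*-algebra `B`, then `A` is AF-embeddable. -/
theorem stmt_8 (A B : Type*) [NonUnitalCStarAlgebra A] [NonUnitalCStarAlgebra B]
    [TopologicalSpace.SeparableSpace A]
    (hcone : IsAFEmbeddable ↥(coneAlg A)) (hB : IsAFEmbeddable B)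
    (φ : A →⋆ₙₐ[ℂ] B) (ψ : B →⋆ₙₐ[ℂ] A) (γ : I01 → (A →⋆ₙₐ[ℂ] A))
    (hcont : ∀ a : A, Continuous fun t : I01 => γ t a)
    (h0 : γ ⟨0, by norm_num⟩ = NonUnitalStarAlgHom.id ℂ A)
    (h1 : γ onePt = ψ.comp φ) :
    IsAFEmbeddable A := by
  obtain ⟨D0, Dk, hDm, hDf, hDd, σ0, hσ0⟩ := hcone
  obtain ⟨P0, F, hFm, hFf, hFd, j0, hj0⟩ := hB
  obtain ⟨Dk', hDm', hDf', hDd'⟩ := unitize_af Dk hDm hDf hDd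
  obtain ⟨F', hFm', hFf', hFd'⟩ := unitize_af F hFm hFf hFd
  haveI : IsClosed ((coneAlg A : NonUnitalStarSubalgebra ℂ C(I01, A)) : Set C(I01, A)) :=
    cone_closed
  refine stage2 (Unitization.starMap j0) (Unitization.starMap_injective hj0)
    ((Unitization.inrNonUnitalStarAlgHom ℂ D0).comp σ0) ?_ ?_ Dk' hDm' hDf' F' hFm' hFf' hDd' hFd'
    φ ψ γ hcont _ h0 h1
  · exact Unitization.inr_injective.comp hσ0
  · intro z
    change ‖(σ0 z : Unitization ℂ D0)‖ ≤ ‖z‖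
    rw [Unitization.norm_inr]
    exact NonUnitalStarAlgHom.norm_apply_le σ0 z
end

section
/- Let C and D be unital C*-algebras and let φ : C → D be a unital completely positive map such that φ(u) is a unitary in D for every unitary u ∈ C. Then φ is multiplicative, i.e., φ is a unital *-homomorphism. -/
theorem aux_sum_zero {D : Type*} [CStarAlgebra D] (w : Fin 3 → D)
    (h : ∑ i, star (w i) * w i = 0) : ∀ i, w i = 0 := by
  let := CStarAlgebra.spectralOrder D
  have := CStarAlgebra.spectralOrderedRing D
  intro i
  have := (Finset.sum_eq_zero_iff_of_nonneg
    (fun i _ => star_mul_self_nonneg (w i))).1 h i (Finset.mem_univ i)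
  exact CStarRing.star_mul_self_eq_zero_iff _ |>.1 this

theorem aux_gram {C D : Type*} [CStarAlgebra C] [CStarAlgebra D] (φ : C →ₗ[ℂ] D)
    (hφ : IsUcp φ) (v : Fin 3 → C) :
    ∃ z : Matrix (Fin 3) (Fin 3) D, ∀ i j,
      φ (star (v i) * v j) = ∑ k, star (z k i) * z k j := by
  obtain ⟨z, hz⟩ := hφ.2 3 (Matrix.of fun i j => star (v i) * v j)
    ⟨Matrix.of fun i j => if i = 0 then v j else 0, by
      ext i j
      simp [Matrix.mul_apply, Matrix.conjTranspose_apply, Fin.sum_univ_three]⟩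
  refine ⟨z, fun i j => ?_⟩
  have := congrFun (congrFun hz i) j
  simpa [Matrix.mul_apply, Matrix.conjTranspose_apply] using this

theorem aux_star {C D : Type*} [CStarAlgebra C] [CStarAlgebra D] (φ : C →ₗ[ℂ] D)
    (hφ : IsUcp φ) (b : C) : φ (star b) = star (φ b) := by
  obtain ⟨z, hz⟩ := aux_gram φ hφ ![1, b, b]
  have h1 := hz 0 1
  have h2 := hz 1 0
  simp at h1 h2
  rw [h1, h2]
  simp [star_sum]

theorem aux_mul {C D : Type*} [CStarAlgebra C] [CStarAlgebra D] (φ : C →ₗ[ℂ] D)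
    (hφ : IsUcp φ) (hu : ∀ u : C, u ∈ unitary C → φ u ∈ unitary D)
    (u b : C) (h : u ∈ unitary C) : φ (star u * b) = star (φ u) * φ b := by
  obtain ⟨z, hz⟩ := aux_gram φ hφ ![1, u, b]
  have h00 := hz 0 0
  have h01 := hz 0 1
  have h10 := hz 1 0
  have h11 := hz 1 1
  have h02 := hz 0 2
  have h12 := hz 1 2
  have huu : star u * u = 1 := (Unitary.mem_iff.1 h).1
  have hvv : star (φ u) * φ u = 1 := (Unitary.mem_iff.1 (hu u h)).1
  simp [huu, hφ.1, aux_star φ hφ] at h00 h01 h10 h11 h02 h12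
  have hw := aux_sum_zero (fun k => z k 1 - z k 0 * φ u) (by
    have e : ∀ k, star (z k 1 - z k 0 * φ u) * (z k 1 - z k 0 * φ u) =
        star (z k 1) * z k 1 - (star (z k 1) * z k 0) * φ u
        - star (φ u) * (star (z k 0) * z k 1)
        + star (φ u) * (star (z k 0) * z k 0) * φ u := by
      intro k
      simp only [star_sub, star_mul]
      noncomm_ring
    simp only [e, Finset.sum_add_distrib, Finset.sum_sub_distrib, ← Finset.mul_sum,
      ← Finset.sum_mul]
    rw [← h00, ← h01, ← h10, ← h11]
    simp [hvv])
  rw [h12, h02, Finset.mul_sum]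
  refine Finset.sum_congr rfl fun k _ => ?_
  rw [sub_eq_zero.1 (hw k), star_mul, mul_assoc]

/-- a ucp map between unital C*-algebras which sends unitaries to unitaries
is multiplicative and star-preserving, i.e. a unital `*`-homomorphism. -/
theorem stmt_11 {C D : Type*} [CStarAlgebra C] [CStarAlgebra D] (φ : C →ₗ[ℂ] D)
    (hφ : IsUcp φ) (hu : ∀ u : C, u ∈ unitary C → φ u ∈ unitary D) :
    (∀ a b : C, φ (a * b) = φ a * φ b) ∧ (∀ a : C, φ (star a) = star (φ a)) ∧ φ 1 = 1 := by
  refine ⟨fun a b => ?_, aux_star φ hφ, hφ.1⟩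
  have ha : a ∈ Submodule.span ℂ (unitary C : Set C) := by
    rw [CStarAlgebra.span_unitary]; trivial
  induction ha using Submodule.span_induction with
  | mem x hx =>
    have := aux_mul φ hφ hu (star x) b (Unitary.star_mem hx)
    rwa [← aux_star φ hφ, star_star] at this
  | zero => simp
  | add x y _ _ hx hy => simp [add_mul, hx, hy]
  | smul c x _ hx => simp [hx]
end

section
/- Let C be a unital C*-algebra, (u_i)_{i∈ℕ} a sequence of unitaries in C that is dense in the unitary group of C, and for k ∈ ℕ let F_k = {u_1, …, u_k}. Assume moreover that the linear span of the unitaries of C is dense in C (which holds automatically). Let D be a unital C*-algebra, H a complex Hilbert space, and ι : C → B(H) an injective unital *-homomorphism. Suppose given ucp maps θ_k : C → D and ucp maps α_k : D → B(H), k ∈ ℕ, such that: (i) ‖θ_{k+1}(f) − θ_k(f)‖ < 3/2^k for all f ∈ F_k; (ii) each θ_k is (F_k, 1/2^k)-multiplicative; and (iii) ‖ι(f) − α_k(θ_k(f))‖ < 1/2^k for all f ∈ F_k. Then for every a ∈ C the sequence (θ_k(a))_k converges in norm, and the map θ : C → D, θ(a) = lim_k θ_k(a), is an injective unital *-homomorphism.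 -/
open Filter Topology

section helpers

theorem cs_fin {D : Type*} [CStarAlgebra D] (p q : Fin 3 → D) :
    ‖∑ i, star (p i) * q i‖ ^ 2 ≤ ‖∑ i, star (p i) * p i‖ * ‖∑ i, star (q i) * q i‖ := by
  let _ := CStarAlgebra.spectralOrder D
  let _ := CStarAlgebra.spectralOrderedRing D
  let X : WithCStarModule D (Fin 3 → D) := (WithCStarModule.equiv D _).symm (fun i => star (q i))
  let Y : WithCStarModule D (Fin 3 → D) := (WithCStarModule.equiv D _).symm (fun i => star (p i))
  have h := CStarModule.norm_inner_le (A := D) (WithCStarModule D (Fin 3 → D)) (x := X) (y := Y)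
  have hX := CStarModule.norm_eq_sqrt_norm_inner_self (A := D) X
  have hY := CStarModule.norm_eq_sqrt_norm_inner_self (A := D) Y
  have e1 : inner D X Y = ∑ i, star (p i) * q i := by
    rw [WithCStarModule.pi_inner]
    simp [X, Y, WithCStarModule.inner_def]
  have e2 : inner D X X = ∑ i, star (q i) * q i := by
    rw [WithCStarModule.pi_inner]
    simp [X, WithCStarModule.inner_def]
  have e3 : inner D Y Y = ∑ i, star (p i) * p i := by
    rw [WithCStarModule.pi_inner]
    simp [Y, WithCStarModule.inner_def]
  rw [e2] at hX
  rw [e3] at hY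
  rw [e1, hX, hY] at h
  calc _ ≤ (√‖∑ i, star (q i) * q i‖ * √‖∑ i, star (p i) * p i‖) ^ 2 := by gcongr
    _ = _ := by
      rw [mul_pow, Real.sq_sqrt (norm_nonneg _), Real.sq_sqrt (norm_nonneg _), mul_comm]

variable {A B : Type*} [CStarAlgebra A] [CStarAlgebra B]

theorem ucp_key {φ : A →ₗ[ℂ] B} (h : IsUcp φ) (a b : A) :
    ∃ p q : Fin 3 → B, φ (star a) = star (φ a) ∧
      ∑ i, star (p i) * p i = φ (star a * a) - star (φ a) * φ a ∧
      ∑ i, star (q i) * q i = φ (star b * b) - star (φ b) * φ b ∧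
      ∑ i, star (p i) * q i = φ (star a * b) - star (φ a) * φ b := by
  obtain ⟨h1, h2⟩ := h
  let y : Matrix (Fin 3) (Fin 3) A := !![1, a, b; 0, 0, 0; 0, 0, 0]
  obtain ⟨z, hz⟩ := h2 3 _ ⟨y, rfl⟩
  have H : ∀ i j, φ (star (y 0 i) * y 0 j) = ∑ k, star (z k i) * z k j := by
    intro i j
    have := congrFun (congrFun hz i) j
    simp only [Matrix.map_apply, Matrix.mul_apply, Matrix.conjTranspose_apply] at this
    rw [← this]
    congr 1
    fin_cases j <;> simp [Fin.sum_univ_three, y]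
  have H00 := H 0 0
  have H01 := H 0 1
  have H02 := H 0 2
  have H10 := H 1 0
  have H20 := H 2 0
  have H11 := H 1 1
  have H12 := H 1 2
  have H22 := H 2 2
  simp [y, h1] at H00 H01 H02 H10 H20 H11 H12 H22
  have sa : φ (star a) = star (φ a) := by
    rw [H10, H01]; simp
  have sb : φ (star b) = star (φ b) := by
    rw [H20, H02]; simp
  rw [sa] at H10
  rw [sb] at H20
  have gen : ∀ (i j : Fin 3) (s t : B), star s = ∑ k, star (z k i) * z k 0 →
      t = ∑ k, star (z k 0) * z k j →
      ∑ k, star (z k i - z k 0 * s) * (z k j - z k 0 * t)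
        = ∑ k, star (z k i) * z k j - star s * t := by
    intro i j s t hs ht
    have : ∀ k, star (z k i - z k 0 * s) * (z k j - z k 0 * t)
        = star (z k i) * z k j - (star (z k i) * z k 0) * t - star s * (star (z k 0) * z k j)
          + star s * (star (z k 0) * z k 0) * t := by
      intro k
      simp only [star_sub, star_mul]
      noncomm_ring
    simp only [this, Finset.sum_add_distrib, Finset.sum_sub_distrib, ← Finset.sum_mul,
      ← Finset.mul_sum]
    rw [← hs, ← ht, ← H00]
    noncomm_ring
  refine ⟨fun k => z k 1 - z k 0 * φ a, fun k => z k 2 - z k 0 * φ b, sa, ?_, ?_, ?_⟩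
  · rw [H11]; exact gen 1 1 _ _ H10 H01
  · rw [H22]; exact gen 2 2 _ _ H20 H02
  · rw [H12]; exact gen 1 2 _ _ H10 H02

theorem ucp_star {φ : A →ₗ[ℂ] B} (h : IsUcp φ) (a : A) : φ (star a) = star (φ a) := by
  obtain ⟨p, q, h, -⟩ := ucp_key h a a
  exact h

theorem ucp_norm {φ : A →ₗ[ℂ] B} (h : IsUcp φ) (a : A) : ‖φ a‖ ≤ ‖a‖ := by
  let _ := CStarAlgebra.spectralOrder A
  let _ := CStarAlgebra.spectralOrderedRing A
  let _ := CStarAlgebra.spectralOrder B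
  let _ := CStarAlgebra.spectralOrderedRing B
  obtain ⟨p, q, -, hp, -⟩ := ucp_key h a a
  have c1 : star (φ a) * φ a ≤ φ (star a * a) := by
    rw [← sub_nonneg, ← hp]
    exact Finset.sum_nonneg fun i _ => star_mul_self_nonneg _
  have c2 : 0 ≤ algebraMap ℝ A (‖a‖ ^ 2) - star a * a :=
    sub_nonneg.2 CStarAlgebra.star_mul_le_algebraMap_norm_sq
  obtain ⟨y, hy⟩ := CStarAlgebra.nonneg_iff_eq_star_mul_self.1 c2
  obtain ⟨r, s, -, hr, -⟩ := ucp_key h y y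
  have c3 : 0 ≤ φ (star y * y) := by
    have : φ (star y * y) = ∑ i, star (r i) * r i + star (φ y) * φ y := by rw [hr]; abel
    rw [this]
    exact add_nonneg (Finset.sum_nonneg fun i _ => star_mul_self_nonneg _)
      (star_mul_self_nonneg _)
  have c4 : φ (algebraMap ℝ A (‖a‖ ^ 2)) = algebraMap ℝ B (‖a‖ ^ 2) := by
    have e : ∀ x : ℝ, algebraMap ℝ A x = (x : ℂ) • (1 : A) := by
      intro x; rw [Algebra.algebraMap_eq_smul_one]; simp
    have e' : ∀ x : ℝ, algebraMap ℝ B x = (x : ℂ) • (1 : B) := by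
      intro x; rw [Algebra.algebraMap_eq_smul_one]; simp
    rw [e, e', map_smul, h.1]
  rw [← hy, map_sub, c4, sub_nonneg] at c3
  have c5 := (CStarAlgebra.norm_le_iff_le_algebraMap (star (φ a) * φ a) (sq_nonneg ‖a‖)
    (star_mul_self_nonneg _)).2 (c1.trans c3)
  rw [CStarRing.norm_star_mul_self, ← sq] at c5
  exact le_of_sq_le_sq c5 (norm_nonneg _)

theorem ucp_mul {φ : A →ₗ[ℂ] B} (h : IsUcp φ) (a b : A) :
    ‖φ (star a * b) - star (φ a) * φ b‖ ^ 2 ≤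
      ‖φ (star a * a) - star (φ a) * φ a‖ * (2 * ‖b‖ ^ 2) := by
  obtain ⟨p, q, -, h1, h2, h3⟩ := ucp_key h a b
  rw [← h3, ← h1]
  refine (cs_fin p q).trans ?_
  gcongr
  rw [h2]
  refine (norm_sub_le _ _).trans ?_
  have n1 := ucp_norm h (star b * b)
  have n2 := ucp_norm h b
  rw [CStarRing.norm_star_mul_self] at n1
  rw [CStarRing.norm_star_mul_self]
  nlinarith [norm_nonneg (φ b), norm_nonneg b]

theorem closed_induction {C : Type*} [CStarAlgebra C]
    (u : ℕ → C)
    (hdense : ∀ v ∈ unitary C, ∀ ε > 0, ∃ i, ‖v - u i‖ < ε)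
    (hspan : Dense ((Submodule.span ℂ ((unitary C : Submonoid C) : Set C) : Submodule ℂ C) : Set C))
    (S : Submodule ℂ C) (hS : ∀ i, 1 ≤ i → u i ∈ S)
    (hc : ∀ a, (∀ ε > 0, ∃ b ∈ S, ‖a - b‖ < ε) → a ∈ S) (a : C) : a ∈ S := by
  have key : ∀ v ∈ unitary C, v ≠ u 0 → v ∈ S := by
    intro v hv hne
    apply hc
    intro ε hε
    have hpos : 0 < ‖v - u 0‖ := norm_pos_iff.2 (sub_ne_zero.2 hne)
    obtain ⟨i, hi⟩ := hdense v hv (min ε ‖v - u 0‖) (lt_min hε hpos)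
    refine ⟨u i, hS i ?_, hi.trans_le (min_le_left _ _)⟩
    rcases Nat.eq_zero_or_pos i with rfl | h
    · exact absurd (hi.trans_le (min_le_right _ _)) (lt_irrefl _)
    · exact h
  have key2 : Submodule.span ℂ ((unitary C : Submonoid C) : Set C) ≤ S := by
    rw [Submodule.span_le]
    intro v hv
    by_cases hne : v = u 0
    · by_cases hne' : -v = u 0
      · have : v = 0 := by
          have h2 : (2 : ℂ) • v = 0 := by
            rw [two_smul]; nth_rewrite 2 [hne.trans hne'.symm]; simp
          simpa using h2
        rw [this]; exact S.zero_mem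
      · have := key (-v) (by
          have hv' := (Unitary.mem_iff (R := C)).1 hv
          rw [Unitary.mem_iff]; simpa using hv') hne'
        simpa using S.neg_mem this
    · exact key v hv hne
  apply hc
  intro ε hε
  obtain ⟨b, hb, hd⟩ := Metric.dense_iff.1 hspan a ε hε
  refine ⟨b, key2 hd, ?_⟩
  rw [← dist_eq_norm, dist_comm]; exact hb

/-- Elements on which a uniformly bounded sequence of linear maps is Cauchy. -/
theorem cauchy_closed {C D : Type*} [CStarAlgebra C] [CStarAlgebra D]
    (θ : ℕ → C →ₗ[ℂ] D) (hn : ∀ k a, ‖θ k a‖ ≤ ‖a‖) (a : C)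
    (h : ∀ ε > 0, ∃ b, CauchySeq (fun k => θ k b) ∧ ‖a - b‖ < ε) :
    CauchySeq (fun k => θ k a) := by
  rw [Metric.cauchySeq_iff]
  intro ε hε
  obtain ⟨b, hb, hab⟩ := h (ε / 3) (by positivity)
  obtain ⟨N, hN⟩ := Metric.cauchySeq_iff.1 hb (ε / 3) (by positivity)
  refine ⟨N, fun m hm n hn' => ?_⟩
  have h1 := hN m hm n hn'
  have h2 := hn m (a - b)
  have h3 := hn n (a - b)
  rw [dist_eq_norm] at h1 ⊢
  rw [map_sub] at h2 h3
  have e : θ m a - θ n a = (θ m a - θ m b) + (θ m b - θ n b) - (θ n a - θ n b) := by abel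
  rw [e]
  have := norm_sub_le ((θ m a - θ m b) + (θ m b - θ n b)) (θ n a - θ n b)
  have := norm_add_le (θ m a - θ m b) (θ m b - θ n b)
  linarith

theorem tendsto_zero_closed {C E : Type*} [NormedAddCommGroup C] [Module ℂ C]
    [NormedAddCommGroup E] [Module ℂ E]
    (f : ℕ → C →ₗ[ℂ] E) (K : ℝ) (hK : 0 < K) (hn : ∀ k a, ‖f k a‖ ≤ K * ‖a‖) (a : C)
    (h : ∀ ε > 0, ∃ b, Tendsto (fun k => f k b) atTop (𝓝 0) ∧ ‖a - b‖ < ε) :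
    Tendsto (fun k => f k a) atTop (𝓝 0) := by
  rw [Metric.tendsto_atTop]
  intro ε hε
  obtain ⟨b, hb, hab⟩ := h (ε / (2 * K)) (by positivity)
  obtain ⟨N, hN⟩ := Metric.tendsto_atTop.1 hb (ε / 2) (by positivity)
  refine ⟨N, fun n hn' => ?_⟩
  have h1 := hN n hn'
  have h2 := hn n (a - b)
  rw [dist_zero_right] at h1 ⊢
  rw [lt_div_iff₀ (by positivity)] at hab
  rw [map_sub] at h2
  have := norm_add_le (f n a - f n b) (f n b)
  rw [sub_add_cancel] at this
  linarith

end helpers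

/-- a sequence of approximately multiplicative, approximately faithful ucp
maps `θ_k : C → D` which is Cauchy on a dense set of unitaries converges pointwise to an
injective unital `*`-homomorphism `θ : C → D`.  Here `(u_i)` is a sequence of unitaries
dense in the unitary group, `F_k = {u_1, …, u_k}`, and `ι : C → B(H)` is a faithful
unital representation. -/
theorem stmt_12 {C D : Type*} [CStarAlgebra C] [CStarAlgebra D]
    (u : ℕ → C) (hu : ∀ i, u i ∈ unitary C)
    (hdense : ∀ v ∈ unitary C, ∀ ε > 0, ∃ i, ‖v - u i‖ < ε)
    (hspan : Dense ((Submodule.span ℂ ((unitary C : Submonoid C) : Set C) : Submodule ℂ C) : Set C))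
    {H : Type*} [NormedAddCommGroup H] [InnerProductSpace ℂ H] [CompleteSpace H]
    (ι : C →⋆ₐ[ℂ] (H →L[ℂ] H)) (hι : Function.Injective ι)
    (θ : ℕ → C →ₗ[ℂ] D) (hθ : ∀ k, IsUcp (θ k))
    (α : ℕ → D →ₗ[ℂ] (H →L[ℂ] H)) (hα : ∀ k, IsUcp (α k))
    (h1 : ∀ k, ∀ i ∈ Finset.Icc 1 k, ‖θ (k + 1) (u i) - θ k (u i)‖ < 3 / 2 ^ k)
    (h2 : ∀ k, ∀ i ∈ Finset.Icc 1 k,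
      ‖θ k (star (u i) * u i) - star (θ k (u i)) * θ k (u i)‖ < 1 / 2 ^ k ∧
      ‖θ k (u i * star (u i)) - θ k (u i) * star (θ k (u i))‖ < 1 / 2 ^ k)
    (h3 : ∀ k, ∀ i ∈ Finset.Icc 1 k, ‖ι (u i) - α k (θ k (u i))‖ < 1 / 2 ^ k) :
    (∀ a : C, ∃ L : D, Tendsto (fun k => θ k a) atTop (𝓝 L)) ∧
    ∃ Θ : C →⋆ₐ[ℂ] D, Function.Injective Θ ∧
      ∀ a : C, Tendsto (fun k => θ k a) atTop (𝓝 (Θ a)) := by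
  have hθn : ∀ k a, ‖θ k a‖ ≤ ‖a‖ := fun k a => ucp_norm (hθ k) a
  have half : Tendsto (fun k : ℕ => (1 : ℝ) / 2 ^ k) atTop (𝓝 0) := by
    have := tendsto_pow_atTop_nhds_zero_of_lt_one (r := (1 / 2 : ℝ)) (by norm_num) (by norm_num)
    simpa [one_div, inv_pow] using this
  -- Step 1: convergence
  have hconv : ∀ a, ∃ L, Tendsto (fun k => θ k a) atTop (𝓝 L) := by
    let S : Submodule ℂ C :=
      { carrier := {a | ∃ L, Tendsto (fun k => θ k a) atTop (𝓝 L)}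
        zero_mem' := ⟨0, by simp⟩
        add_mem' := by
          rintro a b ⟨L, hL⟩ ⟨M, hM⟩
          exact ⟨L + M, by simpa using hL.add hM⟩
        smul_mem' := by
          rintro c a ⟨L, hL⟩
          exact ⟨c • L, by simpa using hL.const_smul c⟩ }
    intro a
    refine closed_induction u hdense hspan S ?_ ?_ a
    · intro i hi
      apply cauchySeq_tendsto_of_complete
      have hs : CauchySeq (fun n => θ (n + i) (u i)) := by
        refine cauchySeq_of_le_geometric (1 / 2) 3 (by norm_num) ?_
        intro n
        rw [dist_comm, dist_eq_norm]
        have hb := h1 (n + i) i (Finset.mem_Icc.2 ⟨hi, by omega⟩)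
        rw [show n + 1 + i = n + i + 1 by omega]
        refine hb.le.trans ?_
        rw [one_div, inv_pow, ← div_eq_mul_inv]
        gcongr
        · norm_num
        · omega
      obtain ⟨L, hL⟩ := cauchySeq_tendsto_of_complete hs
      exact ((tendsto_add_atTop_iff_nat (f := fun n => θ n (u i)) i).1 hL).cauchySeq
    · intro a ha
      apply cauchySeq_tendsto_of_complete
      apply cauchy_closed θ hθn
      intro ε hε
      obtain ⟨b, ⟨L, hL⟩, hab⟩ := ha ε hε
      exact ⟨b, hL.cauchySeq, hab⟩
  refine ⟨hconv, ?_⟩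
  choose T hT using hconv
  have Tadd : ∀ a b, T (a + b) = T a + T b := fun a b =>
    tendsto_nhds_unique (hT _) (by simpa using (hT a).add (hT b))
  have Tsmul : ∀ (c : ℂ) a, T (c • a) = c • T a := fun c a =>
    tendsto_nhds_unique (hT _) (by simpa using (hT a).const_smul c)
  have Tstar : ∀ a, T (star a) = star (T a) := fun a =>
    tendsto_nhds_unique (hT _) (by simpa [ucp_star (hθ _)] using (hT a).star)
  have Tone : T 1 = 1 := tendsto_nhds_unique (hT _) (by simp [(hθ _).1])
  have Tzero : T 0 = 0 := by simpa using Tsmul 0 0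
  have Tn : ∀ a, ‖T a‖ ≤ ‖a‖ := fun a =>
    le_of_tendsto (hT a).norm (Eventually.of_forall fun k => hθn k a)
  let TL : C →ₗ[ℂ] D := { toFun := T, map_add' := Tadd, map_smul' := Tsmul }
  have Tcont : Continuous T :=
    (LinearMap.mkContinuous TL 1 (by simpa [TL] using Tn)).continuous
  -- Step 2: multiplicativity
  have hmul : ∀ a, ∀ b, T (star a * b) = star (T a) * T b := by
    let S : Submodule ℂ C :=
      { carrier := {a | ∀ b, T (star a * b) = star (T a) * T b}
        zero_mem' := by intro b; simp [Tzero]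
        add_mem' := by
          intro a b ha hb c
          simp only [Set.mem_setOf_eq] at ha hb
          simp [add_mul, Tadd, ha, hb]
        smul_mem' := by
          intro c a ha b
          simp only [Set.mem_setOf_eq] at ha
          simp [Tsmul, ha] }
    intro a
    refine closed_induction u hdense hspan S ?_ ?_ a
    · intro i hi b
      have t1 : Tendsto (fun k => θ k (star (u i) * b) - star (θ k (u i)) * θ k b) atTop
          (𝓝 (T (star (u i) * b) - star (T (u i)) * T b)) :=
        (hT _).sub ((hT _).star.mul (hT _))
      have t2 : Tendsto (fun k => ‖θ k (star (u i) * b) - star (θ k (u i)) * θ k b‖ ^ 2) atTop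
          (𝓝 0) := by
        refine squeeze_zero' (g := fun k : ℕ => 1 / 2 ^ k * (2 * ‖b‖ ^ 2))
          (Eventually.of_forall fun k => sq_nonneg _) ?_ ?_
        · filter_upwards [eventually_ge_atTop i] with k hk
          refine (ucp_mul (hθ k) _ _).trans ?_
          have := (h2 k i (Finset.mem_Icc.2 ⟨hi, hk⟩)).1.le
          gcongr
        · simpa using half.mul_const (2 * ‖b‖ ^ 2)
      have t3 := tendsto_nhds_unique (t1.norm.pow 2) t2
      exact sub_eq_zero.1 (norm_eq_zero.1 (pow_eq_zero_iff (two_ne_zero) |>.1 t3))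
    · intro a ha b
      have hcl : IsClosed {a | T (star a * b) = star (T a) * T b} :=
        isClosed_eq (by fun_prop) (by fun_prop)
      have : a ∈ closure {a | T (star a * b) = star (T a) * T b} := by
        rw [Metric.mem_closure_iff]
        intro ε hε
        obtain ⟨c, hc, hac⟩ := ha ε hε
        exact ⟨c, hc b, by rwa [dist_eq_norm]⟩
      rwa [hcl.closure_eq] at this
  -- Step 3: approximate faithfulness
  have hfaith : ∀ a, Tendsto (fun k => (ι.toAlgHom.toLinearMap - (α k) ∘ₗ (θ k)) a) atTop
      (𝓝 0) := by
    let S : Submodule ℂ C :=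
      { carrier := {a | Tendsto (fun k => (ι.toAlgHom.toLinearMap - (α k) ∘ₗ (θ k)) a) atTop
          (𝓝 0)}
        zero_mem' := by
          simp only [Set.mem_setOf_eq, map_zero]; exact tendsto_const_nhds
        add_mem' := by
          intro a b ha hb
          simp only [Set.mem_setOf_eq, map_add] at ha hb ⊢
          simpa using ha.add hb
        smul_mem' := by
          intro c a ha
          simp only [Set.mem_setOf_eq, map_smul] at ha ⊢
          simpa using ha.const_smul c }
    intro a
    refine closed_induction u hdense hspan S ?_ ?_ a
    · intro i hi
      refine squeeze_zero_norm' ?_ half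
      filter_upwards [eventually_ge_atTop i] with k hk
      exact (h3 k i (Finset.mem_Icc.2 ⟨hi, hk⟩)).le
    · intro a ha
      refine tendsto_zero_closed _ 2 (by norm_num) ?_ a ha
      intro k a
      have n1 : ‖ι a‖ ≤ ‖a‖ := NonUnitalStarAlgHom.norm_apply_le ι a
      have n2 := (ucp_norm (hα k) (θ k a)).trans (hθn k a)
      have n3 := norm_sub_le (ι a) (α k (θ k a))
      change ‖ι a - α k (θ k a)‖ ≤ _
      linarith
  refine ⟨{ toFun := T, map_one' := Tone, map_mul' := ?_, map_zero' := Tzero, map_add' := Tadd,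
            commutes' := ?_, map_star' := Tstar }, ?_, hT⟩
  · intro a b
    have := hmul (star a) b
    rwa [star_star, Tstar, star_star] at this
  · intro c
    simp only [Algebra.algebraMap_eq_smul_one, Tsmul, Tone]
  · rw [injective_iff_map_eq_zero]
    intro a ha
    have ha' : T a = 0 := ha
    have l1 := hT a
    rw [ha'] at l1
    have l2 : Tendsto (fun k => α k (θ k a)) atTop (𝓝 0) :=
      squeeze_zero_norm (fun k => ucp_norm (hα k) (θ k a)) (by simpa using l1.norm)
    have l3 : Tendsto (fun _ : ℕ => ι a) atTop (𝓝 0) := by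
      have := (hfaith a).add l2
      simpa using this
    have := tendsto_nhds_unique tendsto_const_nhds l3
    exact hι (by rw [this, map_zero])
end
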